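/- arXiv:0707.4339 — 4 statements merged into one kernel-verified Lean document; each statement's English description precedes it below -/
import Mathlib

section
/- If a finite group G acts freely and linearly (via PGL(8,ℂ)) on a smooth complete intersection X of four quadrics in ℙ⁷, then |G| divides 256. -/
open MvPolynomial

/-- `ℂ⁸` with coordinates indexed by `Fin 8`. -/
abbrev V8 := Fin 8 → ℂ

/-- `GL(8, ℂ)`, realized as the group of `ℂ`-linear automorphisms of `ℂ⁸`. -/
abbrev GL8 := V8 ≃ₗ[ℂ] V8

/-- `PGL(8, ℂ) = GL(8, ℂ)/center`. -/
abbrev PGL8 := GL8 ⧸ Subgroup.center GL8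

/-! ### Part 1: depth and associated primes over a Noetherian local ring -/

section PartOne

open RingTheory.Sequence IsLocalRing CategoryTheory Abelian Pointwise

lemma exists_exact_prime {R : Type*} [CommRing R] [IsNoetherianRing R] {M : Type*}
    [AddCommGroup M] [Module R M] (z : M) (hz : z ≠ 0) :
    ∃ P : Ideal R, P.IsPrime ∧ (∀ r : R, r • z = 0 → r ∈ P) ∧
      ∃ w : M, w ≠ 0 ∧ ∀ r : R, r ∈ P ↔ r • w = 0 := by
  obtain ⟨P, hP, hle⟩ := exists_le_isAssociatedPrime_of_isNoetherianRing R z hz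
  obtain ⟨hpr, w, hw⟩ := Submodule.isAssociatedPrime_iff.mp hP
  refine ⟨P, hpr, fun r hr => hle (by simpa [Submodule.mem_colon_singleton] using hr), w, ?_, ?_⟩
  · rintro rfl
    apply hpr.ne_top
    rw [hw, eq_top_iff]
    intro r _
    simp [Submodule.mem_colon_singleton]
  · intro r
    conv_lhs => rw [hw]
    simp [Submodule.mem_colon_singleton]

lemma dim_quot_succ_le {R : Type*} [CommRing R] {P Q : Ideal R} [P.IsPrime] (hPQ : P ≤ Q)
    (x : R) (hx : x ∉ P) (hxQ : x ∈ Q) :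
    ringKrullDim (R ⧸ Q) + 1 ≤ ringKrullDim (R ⧸ P) := by
  have h1 : (Ideal.Quotient.mk P x) ∈ nonZeroDivisors (R ⧸ P) := by
    rw [mem_nonZeroDivisors_iff_ne_zero, Ne, Ideal.Quotient.eq_zero_iff_mem]
    exact hx
  refine le_trans ?_ (ringKrullDim_quotient_succ_le_of_nonZeroDivisor h1)
  gcongr
  let f : (R ⧸ P) ⧸ Ideal.span {Ideal.Quotient.mk P x} →+* R ⧸ Q :=
    Ideal.Quotient.lift _ (Ideal.Quotient.factor hPQ) (by
      intro a ha
      have : Ideal.span {Ideal.Quotient.mk P x} ≤ RingHom.ker (Ideal.Quotient.factor hPQ) := by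
        rw [Ideal.span_le, Set.singleton_subset_iff]
        simp [RingHom.mem_ker, Ideal.Quotient.eq_zero_iff_mem, hxQ]
      exact this ha)
  apply ringKrullDim_le_of_surjective f
  apply Ideal.Quotient.lift_surjective_of_surjective
  exact Ideal.Quotient.factor_surjective hPQ

lemma length_le_dim_of_regular {R : Type} [CommRing R] [IsLocalRing R] [IsNoetherianRing R]
    (rs : List R) : ∀ (M : Type) [AddCommGroup M] [Module R M] [Module.Finite R M],
    (∀ r ∈ rs, r ∈ maximalIdeal R) → IsWeaklyRegular M rs →
    ∀ P : Ideal R, P.IsPrime → ∀ z : M, z ≠ 0 → (∀ r ∈ P, r • z = 0) →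
    (rs.length : WithBot ℕ∞) ≤ ringKrullDim (R ⧸ P) := by
  induction rs with
  | nil =>
    intro M _ _ _ _ _ P hP z hz h
    have : Nontrivial (R ⧸ P) := Ideal.Quotient.nontrivial_iff.mpr hP.ne_top
    simpa using! (ringKrullDim_nonneg_of_nontrivial (R := R ⧸ P))
  | cons x rs ih =>
    intro M _ _ _ hmem hreg P hP z hz hPz
    rw [isWeaklyRegular_cons_iff] at hreg
    have hxm : x ∈ maximalIdeal R := hmem x (by simp)
    let N : Submodule R M :=
      { carrier := {m | ∀ r ∈ P, r • m = 0}
        add_mem' := by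
          intro a b ha hb r hr
          rw [smul_add, ha r hr, hb r hr, add_zero]
        zero_mem' := by intro r _; simp
        smul_mem' := by
          intro c a ha r hr
          rw [smul_comm, ha r hr, smul_zero] }
    have hxP : x ∉ P := by
      intro hxP
      apply hz
      exact hreg.1 (by simpa using hPz x hxP)
    have hN : ∃ m ∈ N, m ∉ x • (⊤ : Submodule R M) := by
      by_contra! hcon
      have h1 : N ≤ maximalIdeal R • N := by
        intro m hm
        obtain ⟨m', -, rfl⟩ := hcon m hm
        refine Submodule.smul_mem_smul hxm ?_
        intro r hr
        have := hm r hr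
        apply hreg.1
        simp only [DistribSMul.toLinearMap_apply] at this
        simp only [smul_zero]
        rw [smul_comm, this]
      have h2 : N = ⊥ := Submodule.eq_bot_of_le_smul_of_le_jacobson_bot _ N
        (IsNoetherian.noetherian N) h1 (maximalIdeal_le_jacobson _)
      have : z ∈ N := hPz
      rw [h2] at this
      exact hz (by simpa using this)
    obtain ⟨m, hmN, hm⟩ := hN
    have hmb : (Submodule.Quotient.mk m : QuotSMulTop x M) ≠ 0 := by
      rwa [Ne, Submodule.Quotient.mk_eq_zero]
    obtain ⟨Q, hQ, hQ1, w, hw, hQ2⟩ := exists_exact_prime (R := R) _ hmb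
    have hxQ : x ∈ Q := by
      apply hQ1
      rw [← Submodule.Quotient.mk_smul, Submodule.Quotient.mk_eq_zero]
      exact Submodule.smul_mem_pointwise_smul _ _ _ trivial
    have hPQ : P ≤ Q := by
      intro r hr
      apply hQ1
      rw [← Submodule.Quotient.mk_smul, hmN r hr, Submodule.Quotient.mk_zero]
    have := ih (QuotSMulTop x M) (fun r hr => hmem r (by simp [hr])) hreg.2 Q hQ w hw
      (fun r hr => (hQ2 r).1 hr)
    refine le_trans ?_ (dim_quot_succ_le hPQ x hxP hxQ)
    push_cast [List.length_cons]
    gcongr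

/-- Existence of a regular sequence of length `n` in the maximal ideal. -/
def HasDepth (R : Type) [CommRing R] [IsLocalRing R] (M : Type) [AddCommGroup M] [Module R M]
    (n : ℕ) : Prop :=
  ∃ rs : List R, rs.length = n ∧ (∀ r ∈ rs, r ∈ maximalIdeal R) ∧ IsRegular M rs

lemma hasDepth_quot {R : Type} [CommRing R] [IsLocalRing R] [IsNoetherianRing R] (M : Type)
    [AddCommGroup M] [Module R M] [Module.Finite R M] [Nontrivial M] (n : ℕ)
    (h : HasDepth R M (n + 1)) (x : R) (hx : x ∈ maximalIdeal R) (hreg : IsSMulRegular M x) :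
    HasDepth R (QuotSMulTop x M) n := by
  have key : ∀ (L : Type) [AddCommGroup L] [Module R L] [Module.Finite R L] [Nontrivial L],
      maximalIdeal R • (⊤ : Submodule R L) < ⊤ := by
    intro L _ _ _ _
    rw [lt_top_iff_ne_top]
    intro hcon
    have := Submodule.eq_bot_of_le_smul_of_le_jacobson_bot (maximalIdeal R) (⊤ : Submodule R L)
      Module.Finite.fg_top hcon.ge (maximalIdeal_le_jacobson _)
    exact bot_ne_top this.symm
  have nt : Nontrivial (QuotSMulTop x M) := by
    refine Submodule.Quotient.nontrivial_iff.mpr ?_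
    intro hcon
    have h1 : x • (⊤ : Submodule R M) ≤ maximalIdeal R • (⊤ : Submodule R M) := by
      rintro _ ⟨m, -, rfl⟩
      exact Submodule.smul_mem_smul hx trivial
    exact (key M).not_ge (hcon.ge.trans h1)
  obtain ⟨rs, hlen, hmem, hr⟩ := h
  let N : ModuleCat.{0} R := ModuleCat.of R (R ⧸ maximalIdeal R)
  have hsupp : Module.support R N = PrimeSpectrum.zeroLocus (maximalIdeal R : Set R) := by
    change Module.support R (R ⧸ maximalIdeal R) = _
    rw [Module.support_eq_zeroLocus, Ideal.annihilator_quotient]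
  have fN : Module.Finite R N := inferInstanceAs (Module.Finite R (R ⧸ maximalIdeal R))
  have e1 := ModuleCat.subsingleton_ext_of_exists_isRegular (maximalIdeal R) N hsupp.subset
    (ModuleCat.of R M) (key M) rs hmem hr
  refine ModuleCat.exists_isRegular_of_exists_subsingleton_ext (maximalIdeal R) n
    (ModuleCat.of R (QuotSMulTop x M)) (key _) N hsupp ?_
  intro i hi
  have zero1 := AddCommGrpCat.isZero_of_iff_subsingleton.mpr (e1 i (by omega))
  have zero2 := AddCommGrpCat.isZero_of_iff_subsingleton.mpr (e1 (i + 1) (by omega))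
  exact AddCommGrpCat.subsingleton_of_isZero <| ShortComplex.Exact.isZero_of_both_zeros
    ((Ext.covariant_sequence_exact₃' N
      (IsSMulRegular.smulShortComplex_shortExact (M := ModuleCat.of R M) hreg)) i (i + 1) rfl)
    (zero1.eq_zero_of_src _) (zero2.eq_zero_of_tgt _)

lemma supportDim_le_add_length {R : Type} [CommRing R] [IsLocalRing R] [IsNoetherianRing R]
    (s : List R) : ∀ (M : Type) [AddCommGroup M] [Module R M] [Module.Finite R M],
    (∀ r ∈ s, r ∈ maximalIdeal R) →
    Module.supportDim R M ≤
      Module.supportDim R (M ⧸ (Ideal.ofList s • (⊤ : Submodule R M))) + s.length := by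
  induction s with
  | nil =>
    intro M _ _ _ _
    simp only [List.length_nil, Nat.cast_zero, add_zero]
    have : (Ideal.ofList ([] : List R) • (⊤ : Submodule R M)) = ⊥ := by simp
    rw [this]
    exact (Module.supportDim_eq_of_equiv (Submodule.quotEquivOfEqBot _ rfl)).ge
  | cons x s ih =>
    intro M _ _ _ hmem
    have h1 := Module.supportDim_le_supportDim_quotSMulTop_succ (M := M) (hmem x (by simp))
    have h2 := ih (QuotSMulTop x M) (fun r hr => hmem r (by simp [hr]))
    rw [Module.supportDim_eq_of_equiv
      (Submodule.quotOfListConsSMulTopEquivQuotSMulTopInner M x s)]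
    refine h1.trans ?_
    push_cast [List.length_cons]
    rw [← add_assoc]
    gcongr

/-- Unmixedness. -/
theorem unmixed_local {R : Type} [CommRing R] [IsLocalRing R] [IsNoetherianRing R]
    (s : List R) : ∀ (n : ℕ) (M : Type) [AddCommGroup M] [Module R M] [Module.Finite R M]
    [Nontrivial M], (∀ r ∈ s, r ∈ maximalIdeal R) → HasDepth R M n →
    Module.supportDim R (M ⧸ (Ideal.ofList s • (⊤ : Submodule R M))) + s.length ≤ n →
    ∀ P : Ideal R, P.IsPrime → ∀ z : M ⧸ (Ideal.ofList s • (⊤ : Submodule R M)), z ≠ 0 →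
    (∀ r ∈ P, r • z = 0) → (n : WithBot ℕ∞) ≤ ringKrullDim (R ⧸ P) + s.length := by
  induction s with
  | nil =>
    intro n M _ _ _ _ hmem hdepth hdim P hP z hz hPz
    obtain ⟨rs, hlen, hrs, hreg⟩ := hdepth
    have hbot : (Ideal.ofList ([] : List R) • (⊤ : Submodule R M)) = ⊥ := by simp
    let e := Submodule.quotEquivOfEqBot _ hbot
    have := length_le_dim_of_regular rs M hrs hreg.1 P hP (e z) (by simpa using hz)
      (fun r hr => by rw [← map_smul, hPz r hr, map_zero])
    simpa [hlen] using this
  | cons x s ih =>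
    intro n M _ _ _ _ hmem hdepth hdim P hP z hz hPz
    have hxm : x ∈ maximalIdeal R := hmem x (by simp)
    let e := Submodule.quotOfListConsSMulTopEquivQuotSMulTopInner M x s
    rw [Module.supportDim_eq_of_equiv e] at hdim
    have hsd := supportDim_le_add_length s (QuotSMulTop x M) (fun r hr => hmem r (by simp [hr]))
    have hsd' : Module.supportDim R (QuotSMulTop x M) + 1 ≤ n := by
      refine le_trans ?_ hdim
      push_cast [List.length_cons]
      rw [← add_assoc]
      gcongr
    have hreg : IsSMulRegular M x := by
      by_contra hcon
      obtain ⟨y, hy, hy0⟩ : ∃ y : M, x • y = 0 ∧ y ≠ 0 := by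
        by_contra! hc
        apply hcon
        exact isSMulRegular_iff_right_eq_zero_of_smul.2 hc
      obtain ⟨Q, hQ, hQ1, w, hw, hQ2⟩ := exists_exact_prime (R := R) y hy0
      obtain ⟨rs, hlen, hrs, hrr⟩ := hdepth
      have h1 := length_le_dim_of_regular rs M hrs hrr.1 Q hQ w hw (fun r hr => (hQ2 r).1 hr)
      have h2 : ringKrullDim (R ⧸ Q) ≤ Module.supportDim R (QuotSMulTop x M) := by
        rw [Module.supportDim_eq_ringKrullDim_quotient_annihilator]
        have hle : Module.annihilator R (QuotSMulTop x M) ≤ Q := by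
          have : (⟨Q, hQ⟩ : PrimeSpectrum R) ∈ Module.support R (QuotSMulTop x M) := by
            rw [Module.support_quotSMulTop]
            refine ⟨?_, by simpa using hQ1 x hy⟩
            rw [Module.mem_support_iff_of_finite]
            intro r hr
            exact (hQ2 r).2 (Module.mem_annihilator.1 hr w)
          rw [Module.mem_support_iff_of_finite] at this
          exact this
        exact ringKrullDim_le_of_surjective (Ideal.Quotient.factor hle)
          (Ideal.Quotient.factor_surjective hle)
      rw [hlen] at h1
      have h3 := (add_le_add_left (h1.trans h2) 1).trans hsd'
      have : n + 1 ≤ n := by exact_mod_cast h3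
      omega
    cases n with
    | zero =>
      have : Nontrivial (R ⧸ P) := Ideal.Quotient.nontrivial_iff.mpr hP.ne_top
      have h0 := (ringKrullDim_nonneg_of_nontrivial (R := R ⧸ P))
      exact le_trans (by simpa using h0) (le_add_of_nonneg_right (by positivity))
    | succ n =>
      have hd := hasDepth_quot M n hdepth x hxm hreg
      have nt : Nontrivial (QuotSMulTop x M) := by
        obtain ⟨rs, -, -, h⟩ := hd
        exact h.nontrivial
      have := ih n (QuotSMulTop x M) (fun r hr => hmem r (by simp [hr])) hd
        (by
          push_cast [List.length_cons] at hdim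
          rw [← add_assoc] at hdim
          exact ENat.WithBot.add_le_add_one_right_iff.mp hdim) P hP (e z) (by simpa using hz)
        (fun r hr => by rw [← map_smul, hPz r hr, map_zero])
      push_cast [List.length_cons]
      rw [← add_assoc]
      gcongr

end PartOne
section PartTwo

open RingTheory.Sequence IsLocalRing

/-- The maximal ideal of a point. -/
noncomputable def ptIdeal {d : ℕ} (v : Fin d → ℂ) : Ideal (MvPolynomial (Fin d) ℂ) := RingHom.ker (eval v)

lemma mem_ptIdeal {d : ℕ} {v : Fin d → ℂ} {f : MvPolynomial (Fin d) ℂ} :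
    f ∈ ptIdeal v ↔ eval v f = 0 := RingHom.mem_ker

instance ptIdeal_isMaximal {d : ℕ} (v : Fin d → ℂ) : (ptIdeal v).IsMaximal :=
  RingHom.ker_isMaximal_of_surjective _ (fun c => ⟨C c, by simp⟩)

/-- The coordinate sequence at a point. -/
noncomputable def coordSeq {d : ℕ} (v : Fin d → ℂ) : List (MvPolynomial (Fin d) ℂ) :=
  List.ofFn (fun i => X i - C (v i))

lemma mem_coordSeq {d : ℕ} {v : Fin d → ℂ} {r} (hr : r ∈ coordSeq v) : r ∈ ptIdeal v := by
  obtain ⟨i, rfl⟩ := List.mem_ofFn.1 hr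
  simp [mem_ptIdeal]

lemma coordSeq_length {d : ℕ} (v : Fin d → ℂ) : (coordSeq v).length = d := by
  simp [coordSeq]

lemma coordSeq_get {d : ℕ} (v : Fin d → ℂ) (i : ℕ) (hi : i < d) :
    (coordSeq v)[i]'(by simpa [coordSeq] using hi) = X ⟨i, hi⟩ - C (v ⟨i, hi⟩) := by
  simp [coordSeq]

lemma mem_take_coordSeq {d : ℕ} (v : Fin d → ℂ) (i : ℕ) (r : MvPolynomial (Fin d) ℂ) :
    r ∈ (coordSeq v).take i ↔ ∃ j : Fin d, j.1 < i ∧ r = X j - C (v j) := by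
  rw [List.mem_take_iff_getElem]
  constructor
  · rintro ⟨j, hj, rfl⟩
    have hj' : j < d := by rw [coordSeq_length] at hj; omega
    exact ⟨⟨j, hj'⟩, by simp only; omega, coordSeq_get v j hj'⟩
  · rintro ⟨j, hj, rfl⟩
    refine ⟨j.1, by rw [coordSeq_length]; omega, coordSeq_get v j.1 j.2⟩

lemma coordSeq_weaklyRegular {d : ℕ} (v : Fin d → ℂ) :
    IsWeaklyRegular (MvPolynomial (Fin d) ℂ) (coordSeq v) := by
  refine ⟨fun i hi => ?_⟩
  have hid : i < d := by rwa [coordSeq_length] at hi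
  let I : Ideal (MvPolynomial (Fin d) ℂ) := Ideal.ofList ((coordSeq v).take i)
  let φ : MvPolynomial (Fin d) ℂ →ₐ[ℂ] MvPolynomial (Fin d) ℂ :=
    aeval (fun j : Fin d => if j.1 < i then C (v j) else X j)
  have h1 : I ≤ RingHom.ker φ := by
    refine Ideal.span_le.2 ?_
    intro r hr
    obtain ⟨j, hj, rfl⟩ := (mem_take_coordSeq v i r).1 hr
    simp only [SetLike.mem_coe, RingHom.mem_ker, map_sub, φ, aeval_X, if_pos hj, algHom_C,
      algebraMap_eq, sub_self]
  have h2 : (Ideal.Quotient.mkₐ ℂ I).comp φ = Ideal.Quotient.mkₐ ℂ I := by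
    apply MvPolynomial.algHom_ext
    intro j
    by_cases hj : j.1 < i
    · simp only [φ, AlgHom.comp_apply, aeval_X, if_pos hj, Ideal.Quotient.mkₐ_eq_mk]
      symm
      rw [Ideal.Quotient.eq]
      exact Ideal.subset_span ((mem_take_coordSeq v i _).2 ⟨j, hj, rfl⟩)
    · simp only [φ, AlgHom.comp_apply, aeval_X, if_neg hj]
  have h3 : ∀ f, φ f = 0 → f ∈ I := by
    intro f hf
    have := DFunLike.congr_fun h2 f
    rw [AlgHom.comp_apply, hf, map_zero] at this
    exact Ideal.Quotient.eq_zero_iff_mem.1 this.symm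
  rw [coordSeq_get v i hid]
  rw [isSMulRegular_iff_right_eq_zero_of_smul]
  intro m
  obtain ⟨f, rfl⟩ := Submodule.Quotient.mk_surjective _ m
  intro hm
  rw [← Submodule.Quotient.mk_smul, Submodule.Quotient.mk_eq_zero] at hm
  rw [Submodule.Quotient.mk_eq_zero]
  simp only [smul_eq_mul, Ideal.mul_top] at hm ⊢
  apply h3
  have := h1 hm
  rw [RingHom.mem_ker, map_mul] at this
  refine (mul_eq_zero.1 this).resolve_left ?_
  have : φ (X ⟨i, hid⟩ - C (v ⟨i, hid⟩)) = X ⟨i, hid⟩ - C (v ⟨i, hid⟩) := by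
    simp [φ, algHom_C]
  rw [this]
  intro h
  have := congrArg (eval (fun _ => v ⟨i, hid⟩ + 1)) h
  simp at this

lemma coordSeq_regular_loc {d : ℕ} (v : Fin d → ℂ) :
    IsRegular (Localization.AtPrime (ptIdeal v))
      ((coordSeq v).map (algebraMap _ (Localization.AtPrime (ptIdeal v)))) :=
  (coordSeq_weaklyRegular v).isRegular_of_isLocalization_of_mem _ (ptIdeal v)
    (fun _ hr => mem_coordSeq hr)

lemma hasDepth_loc {d : ℕ} (v : Fin d → ℂ) :
    HasDepth (Localization.AtPrime (ptIdeal v)) (Localization.AtPrime (ptIdeal v)) d := by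
  refine ⟨_, by simp [coordSeq_length], ?_, coordSeq_regular_loc v⟩
  intro r hr
  obtain ⟨s, hs, rfl⟩ := List.mem_map.1 hr
  exact (IsLocalization.AtPrime.to_map_mem_maximal_iff _ (ptIdeal v) s).2 (mem_coordSeq hs)

lemma ringKrullDim_loc {d : ℕ} (v : Fin d → ℂ) :
    ringKrullDim (Localization.AtPrime (ptIdeal v)) = d := by
  apply le_antisymm
  · rw [IsLocalization.AtPrime.ringKrullDim_eq_height (ptIdeal v)]
    refine (Ideal.height_le_ringKrullDim_of_ne_top (Ideal.IsPrime.ne_top inferInstance)).trans ?_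
    rw [MvPolynomial.ringKrullDim_of_isNoetherianRing]
    simp
  · have h := ringKrullDim_add_length_eq_ringKrullDim_of_isRegular _ (coordSeq_regular_loc v)
    rw [← h]
    have : Nontrivial (Localization.AtPrime (ptIdeal v) ⧸ Ideal.ofList
        ((coordSeq v).map (algebraMap _ (Localization.AtPrime (ptIdeal v))))) := by
      refine Ideal.Quotient.nontrivial_iff.2 ?_
      have := (coordSeq_regular_loc v).2
      simpa using this.symm
    have h0 := ringKrullDim_nonneg_of_nontrivial (R := Localization.AtPrime (ptIdeal v) ⧸ Ideal.ofList
        ((coordSeq v).map (algebraMap _ (Localization.AtPrime (ptIdeal v)))))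
    refine le_trans ?_ (le_add_of_nonneg_left h0)
    simp [coordSeq_length]

lemma height_ptIdeal {d : ℕ} (v : Fin d → ℂ) : (ptIdeal v).height = d := by
  have h := ringKrullDim_loc v
  rw [IsLocalization.AtPrime.ringKrullDim_eq_height (ptIdeal v)] at h
  exact_mod_cast h

lemma exists_zero_of_isPrime {d : ℕ} (P : Ideal (MvPolynomial (Fin d) ℂ)) [P.IsPrime] 
    (f : MvPolynomial (Fin d) ℂ) (hf : f ∉ P) : ∃ v, P ≤ ptIdeal v ∧ eval v f ≠ 0 := by
  by_contra! hcon
  apply hf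
  rw [← IsPrime.vanishingIdeal_zeroLocus (K := ℂ) P, mem_vanishingIdeal_iff]
  intro v hv
  refine hcon v ?_
  intro p hp
  exact mem_ptIdeal.2 (hv p hp)

end PartTwo
section PartThree

open IsLocalRing

/-- Independent cotangent vectors extend to generators of the maximal ideal. -/
lemma exists_gens {R : Type} [CommRing R] [IsLocalRing R] [IsNoetherianRing R] {k : ℕ}
    (x : Fin k → maximalIdeal R)
    (hx : LinearIndependent (ResidueField R)
      (fun i => ((maximalIdeal R).toCotangent (x i) : CotangentSpace R))) :
    ∃ t : Finset R, t.card + k ≤ Module.finrank (ResidueField R) (CotangentSpace R) ∧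
      maximalIdeal R = Ideal.span (Set.range (fun i => (x i : R)) ∪ (t : Set R)) := by
  classical
  let W : Submodule (ResidueField R) (CotangentSpace R) :=
    Submodule.span _ (Set.range (fun i => ((maximalIdeal R).toCotangent (x i) : CotangentSpace R)))
  obtain ⟨W', hW'⟩ := Submodule.exists_isCompl W
  have hfin := Submodule.finrank_add_eq_of_isCompl hW'
  have hW : Module.finrank (ResidueField R) W = k := by
    have := finrank_span_eq_card hx
    simpa using this
  let b := Module.finBasis (ResidueField R) W'
  choose y hy using fun i => (maximalIdeal R).toCotangent_surjective ((b i : W') : CotangentSpace R)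
  refine ⟨Finset.univ.image (fun i => (y i : R)), ?_, ?_⟩
  · have := Finset.card_image_le (s := (Finset.univ : Finset (Fin (Module.finrank (ResidueField R) W'))))
      (f := fun i => (y i : R))
    rw [Finset.card_univ, Fintype.card_fin] at this
    omega
  · have h1 : Submodule.span (ResidueField R)
        ((maximalIdeal R).toCotangent '' (Set.range x ∪ Set.range y)) = ⊤ := by
      rw [Set.image_union, Submodule.span_union, ← Set.range_comp, ← Set.range_comp]
      have e2 : (⇑(maximalIdeal R).toCotangent ∘ y) = fun i => (W'.subtype (b i)) :=
        funext hy
      rw [e2]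
      have e3 : Submodule.span (ResidueField R) (Set.range fun i => (W'.subtype (b i))) = W' := by
        have : (Set.range fun i => (W'.subtype (b i))) = W'.subtype '' (Set.range b) := by
          rw [← Set.range_comp]; rfl
        rw [this, Submodule.span_image, b.span_eq, Submodule.map_top, Submodule.range_subtype]
      rw [e3]
      exact hW'.sup_eq_top
    rw [CotangentSpace.span_image_eq_top_iff] at h1
    have h2 := congrArg (Submodule.map (maximalIdeal R).subtype) h1
    rw [Submodule.map_top, Submodule.range_subtype, Submodule.map_span, Set.image_union,
      ← Set.range_comp, ← Set.range_comp] at h2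
    refine h2.symm.trans ?_
    congr 2
    ext z
    simp

lemma pderiv_mem_of_mem_sq {d : ℕ} (P : Ideal (MvPolynomial (Fin d) ℂ)) (j : Fin d)
    (f : MvPolynomial (Fin d) ℂ) (hf : f ∈ P ^ 2) : pderiv j f ∈ P := by
  rw [pow_two] at hf
  induction hf using Submodule.mul_induction_on' with
  | mem_mul_mem a ha b hb =>
    rw [Derivation.leibniz]
    exact P.add_mem (P.mul_mem_right _ ha) (P.mul_mem_right _ hb)
  | add a _ b _ ha hb =>
    rw [map_add]
    exact P.add_mem ha hb

lemma coeff_mem {d k : ℕ} (P : Ideal (MvPolynomial (Fin d) ℂ)) [hP : P.IsPrime]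
    (q : Fin k → MvPolynomial (Fin d) ℂ) (hq : ∀ i, q i ∈ P) (v : Fin d → ℂ) (hv : P ≤ ptIdeal v)
    (hrank : (Matrix.of fun (i : Fin k) (j : Fin d) => eval v (pderiv j (q i))).rank = k)
    (b : Fin k → MvPolynomial (Fin d) ℂ) (u : MvPolynomial (Fin d) ℂ) (hu : u ∉ P)
    (h : u * ∑ i, b i * q i ∈ P ^ 2) (i : Fin k) : b i ∈ P := by
  have h1 : ∀ j, ∑ i, b i * pderiv j (q i) ∈ P := by
    intro j
    have h2 := pderiv_mem_of_mem_sq P j _ h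
    rw [Derivation.leibniz, map_sum] at h2
    have h3 : (∑ i, b i * q i) • pderiv j u ∈ P :=
      P.mul_mem_right _ (P.sum_mem fun i _ => P.mul_mem_left _ (hq i))
    rw [P.add_mem_iff_left h3] at h2
    have h4 := (hP.mem_or_mem h2).resolve_left hu
    have h5 : ∑ i, q i * pderiv j (b i) ∈ P := P.sum_mem fun i _ => P.mul_mem_right _ (hq i)
    have h6 : ∑ i, pderiv j (b i * q i) = ∑ i, b i * pderiv j (q i) + ∑ i, q i * pderiv j (b i) := by
      rw [← Finset.sum_add_distrib]
      exact Finset.sum_congr rfl fun i _ => by rw [Derivation.leibniz]; rfl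
    rw [h6, P.add_mem_iff_left h5] at h4
    exact h4
  obtain ⟨B, hB⟩ : ∃ B : Matrix (Fin d) (Fin k) ℂ,
      (Matrix.of fun (i : Fin k) (j : Fin d) => eval v (pderiv j (q i))) * B = 1 := by
    rw [← Matrix.mulVec_surjective_iff_exists_right_inverse]
    have h2 : LinearMap.range (Matrix.of fun (i : Fin k) (j : Fin d) =>
        eval v (pderiv j (q i))).mulVecLin = ⊤ := by
      apply Submodule.eq_top_of_finrank_eq
      simpa [Matrix.rank] using hrank
    exact LinearMap.range_eq_top.1 h2
  let Jac : Matrix (Fin k) (Fin d) (MvPolynomial (Fin d) ℂ) := Matrix.of fun i j => pderiv j (q i)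
  let D : Matrix (Fin k) (Fin k) (MvPolynomial (Fin d) ℂ) := Jac * B.map C
  have hDap : ∀ i j, D i j = ∑ l, Jac i l * C (B l j) := fun i j => rfl
  have hD : D.det ∉ P := by
    intro hcon
    have := mem_ptIdeal.1 (hv hcon)
    rw [RingHom.map_det] at this
    have h3 : (eval v).mapMatrix D = 1 := by
      rw [← hB]
      ext i j
      simp [hDap, Jac, Matrix.mul_apply]
    rw [h3, Matrix.det_one] at this
    exact one_ne_zero this
  let π := Ideal.Quotient.mk P
  have hD' : (π.mapMatrix D).det ≠ 0 := by
    rw [← RingHom.map_det]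
    rwa [Ne, Ideal.Quotient.eq_zero_iff_mem]
  have hz : (fun i => π (b i)) = 0 := by
    apply Matrix.eq_zero_of_vecMul_eq_zero hD'
    have : π.mapMatrix D = Jac.map π * (B.map C).map π := by
      ext i j
      simp [hDap, Matrix.mul_apply]
    rw [this, ← Matrix.vecMul_vecMul]
    have : Matrix.vecMul (fun i => π (b i)) (Jac.map π) = 0 := by
      ext j
      have := Ideal.Quotient.eq_zero_iff_mem.2 (h1 j)
      simpa [Matrix.vecMul, dotProduct, Jac, π] using this
    rw [this, Matrix.zero_vecMul]
  exact Ideal.Quotient.eq_zero_iff_mem.1 (congrFun hz i)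

lemma cot_indep {d k : ℕ} (P : Ideal (MvPolynomial (Fin d) ℂ)) [hP : P.IsPrime]
    (q : Fin k → MvPolynomial (Fin d) ℂ) (hq : ∀ i, q i ∈ P) (v : Fin d → ℂ) (hv : P ≤ ptIdeal v)
    (hrank : (Matrix.of fun (i : Fin k) (j : Fin d) => eval v (pderiv j (q i))).rank = k)
    (x : Fin k → maximalIdeal (Localization.AtPrime P))
    (hx : ∀ i, (x i : Localization.AtPrime P) = algebraMap _ _ (q i)) :
    LinearIndependent (ResidueField (Localization.AtPrime P))
      (fun i => ((maximalIdeal (Localization.AtPrime P)).toCotangent (x i) :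
        CotangentSpace (Localization.AtPrime P))) := by
  rw [Fintype.linearIndependent_iff]
  intro g hg
  choose a ha using fun i => IsLocalRing.residue_surjective (g i)
  have h1 : ∑ i, a i * algebraMap _ (Localization.AtPrime P) (q i) ∈
      maximalIdeal (Localization.AtPrime P) ^ 2 := by
    have h2 : (maximalIdeal (Localization.AtPrime P)).toCotangent (∑ i, a i • x i) = 0 := by
      rw [map_sum, ← hg]
      refine Finset.sum_congr rfl fun i _ => ?_
      rw [map_smul, ← ha i]
      exact (IsScalarTower.algebraMap_smul (ResidueField (Localization.AtPrime P)) (a i) 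
       ((maximalIdeal (Localization.AtPrime P)).toCotangent (x i) :
        CotangentSpace (Localization.AtPrime P))).symm
    rw [Ideal.toCotangent_eq_zero] at h2
    simpa [hx] using h2
  obtain ⟨s, hs⟩ := IsLocalization.exist_integer_multiples_of_finite P.primeCompl a
  choose b hb using hs
  have hu : IsUnit (algebraMap _ (Localization.AtPrime P) s.1) := IsLocalization.map_units _ s
  have h3 : algebraMap _ (Localization.AtPrime P) (∑ i, b i * q i) ∈
      (P ^ 2).map (algebraMap _ (Localization.AtPrime P)) := by
    rw [Ideal.map_pow, Localization.AtPrime.map_eq_maximalIdeal]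
    have : algebraMap _ (Localization.AtPrime P) (∑ i, b i * q i) =
        algebraMap _ (Localization.AtPrime P) s.1 *
          ∑ i, a i * algebraMap _ (Localization.AtPrime P) (q i) := by
      rw [map_sum, Finset.mul_sum]
      refine Finset.sum_congr rfl fun i _ => ?_
      rw [map_mul, hb, Algebra.smul_def, mul_assoc]
    rw [this]
    exact Ideal.mul_mem_left _ _ h1
  rw [IsLocalization.algebraMap_mem_map_algebraMap_iff P.primeCompl] at h3
  obtain ⟨u, hu', h4⟩ := h3
  intro i
  have h5 := coeff_mem P q hq v hv hrank b u hu' h4 i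
  have h6 := (IsLocalization.AtPrime.to_map_mem_maximal_iff (Localization.AtPrime P) P (b i)).2 h5
  rw [hb, Algebra.smul_def] at h6
  rw [← ha i, IsLocalRing.residue_eq_zero_iff]
  exact (Ideal.unit_mul_mem_iff_mem _ hu).1 h6

/-- Regular parameters of the localization at `P` containing the equations. -/
lemma exists_params {d k : ℕ} (P : Ideal (MvPolynomial (Fin d) ℂ)) [hP : P.IsPrime]
    (q : Fin k → MvPolynomial (Fin d) ℂ) (hq : ∀ i, q i ∈ P) (v : Fin d → ℂ) (hv : P ≤ ptIdeal v)
    (hrank : (Matrix.of fun (i : Fin k) (j : Fin d) => eval v (pderiv j (q i))).rank = k) :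
    ∃ t : Finset (Localization.AtPrime P), ((t.card + k : ℕ) : ℕ∞) ≤ P.height ∧
      maximalIdeal (Localization.AtPrime P) = Ideal.span
        (Set.range (fun i => algebraMap _ (Localization.AtPrime P) (q i)) ∪ (t : Set _)) := by
  let x : Fin k → maximalIdeal (Localization.AtPrime P) := fun i =>
    ⟨algebraMap _ _ (q i),
      (IsLocalization.AtPrime.to_map_mem_maximal_iff (Localization.AtPrime P) P (q i)).2 (hq i)⟩
  obtain ⟨t, ht, h⟩ := exists_gens x (cot_indep P q hq v hv hrank x fun i => rfl)
  refine ⟨t, ?_, h⟩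
  have h1 := (IsRegularLocalRing.iff_finrank_cotangentSpace (Localization.AtPrime P)).1 inferInstance
  rw [IsLocalization.AtPrime.ringKrullDim_eq_height P] at h1
  have h2 : ((Module.finrank (ResidueField (Localization.AtPrime P))
    (CotangentSpace (Localization.AtPrime P)) : ℕ) : ℕ∞) = P.height := by exact_mod_cast h1
  rw [← h2]
  exact_mod_cast ht

lemma dim_le_of_hom {d k : ℕ} (P : Ideal (MvPolynomial (Fin d) ℂ)) [hP : P.IsPrime]
    (q : Fin k → MvPolynomial (Fin d) ℂ) (hq : ∀ i, q i ∈ P) (v : Fin d → ℂ) (hv : P ≤ ptIdeal v)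
    (hrank : (Matrix.of fun (i : Fin k) (j : Fin d) => eval v (pderiv j (q i))).rank = k)
    (A : Type) [CommRing A] [IsLocalRing A] [IsNoetherianRing A]
    (ψ : MvPolynomial (Fin d) ℂ →+* A) (hψq : ∀ i, ψ (q i) = 0)
    (hcomap : ∀ f, f ∉ P → IsUnit (ψ f)) (hmap : maximalIdeal A = P.map ψ) :
    ringKrullDim A + k ≤ P.height := by
  classical
  obtain ⟨t, ht, h⟩ := exists_params P q hq v hv hrank
  let φ : Localization.AtPrime P →+* A :=
    IsLocalization.lift (M := P.primeCompl) (g := ψ) (fun y => hcomap _ y.2)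
  have hφ : φ.comp (algebraMap _ _) = ψ := IsLocalization.lift_comp _
  have h1 : maximalIdeal A = Ideal.span (t.image φ : Set A) := by
    rw [hmap, ← hφ, ← Ideal.map_map, Localization.AtPrime.map_eq_maximalIdeal, h, Ideal.map_span,
      Set.image_union, Ideal.span_union, Finset.coe_image, sup_eq_right, Ideal.span_le]
    rintro _ ⟨_, ⟨i, rfl⟩, rfl⟩
    have : φ (algebraMap _ _ (q i)) = ψ (q i) := by rw [← hφ]; rfl
    simp only [this, hψq, SetLike.mem_coe, zero_mem]
  have h2 := ringKrullDim_le_spanFinrank_maximalIdeal A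
  have h3 : (maximalIdeal A).spanFinrank ≤ t.card := by
    rw [h1]
    refine (Submodule.spanFinrank_span_le_ncard_of_finite (Finset.finite_toSet _)).trans ?_
    rw [Set.ncard_coe_finset]
    exact Finset.card_image_le
  have h4 : ringKrullDim A ≤ (t.card : WithBot ℕ∞) := h2.trans (by exact_mod_cast h3)
  calc ringKrullDim A + k ≤ (t.card : WithBot ℕ∞) + k := by gcongr
    _ = (((t.card + k : ℕ) : ℕ∞) : WithBot ℕ∞) := by push_cast; rfl
    _ ≤ _ := by exact_mod_cast ht

end PartThree
section PartFour

open IsLocalRing RingTheory.Sequence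

lemma wb_add_le (a b : ℕ∞) (n : ℕ) :
    ((a : WithBot ℕ∞) + (n : WithBot ℕ∞) ≤ (b : WithBot ℕ∞)) ↔ a + n ≤ b :=
  WithBot.coe_le_coe (a := a + n) (b := b)

lemma wb_le_add (a b : ℕ∞) (n : ℕ) :
    ((b : WithBot ℕ∞) ≤ (a : WithBot ℕ∞) + (n : WithBot ℕ∞)) ↔ b ≤ a + n :=
  WithBot.coe_le_coe (a := b) (b := a + n)

lemma height_add_dim_quot_le {R : Type} [CommRing R] (P : Ideal R) [hP : P.IsPrime] :
    (P.height : WithBot ℕ∞) + ringKrullDim (R ⧸ P) ≤ ringKrullDim R := by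
  let p : PrimeSpectrum R := ⟨P, hP⟩
  have : Nonempty (PrimeSpectrum R) := ⟨p⟩
  have h1 : (PrimeSpectrum.zeroLocus (R := R) P) = Set.Ici p := by
    ext x
    simp only [PrimeSpectrum.mem_zeroLocus, SetLike.coe_subset_coe, Set.mem_Ici]
    rfl
  rw [ringKrullDim_quotient, h1, ← Order.coheight_eq_krullDim_Ici, ringKrullDim,
    Order.krullDim_eq_iSup_height_add_coheight_of_nonempty, 
    show P.height = Order.height p from PrimeSpectrum.height_eq_orderHeight p, ← WithBot.coe_add, WithBot.coe_le_coe]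
  exact le_iSup (fun a : PrimeSpectrum R => Order.height a + Order.coheight a) p

lemma exists_ne_zero_of_lt {d : ℕ} (P : Ideal (MvPolynomial (Fin d) ℂ)) [P.IsPrime]
    (hne : P ≠ ptIdeal 0) : ∃ v, v ≠ 0 ∧ P ≤ ptIdeal v := by
  by_cases hle : P ≤ ptIdeal 0
  · obtain ⟨f, hf, hfP⟩ := SetLike.exists_of_lt (lt_of_le_of_ne hle hne)
    obtain ⟨v, hv, hfv⟩ := exists_zero_of_isPrime P f hfP
    refine ⟨v, ?_, hv⟩
    rintro rfl
    exact hfv (mem_ptIdeal.1 hf)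
  · obtain ⟨v, hv, -⟩ := exists_zero_of_isPrime P 1 (P.ne_top_iff_one.1 (Ideal.IsPrime.ne_top ‹_›))
    refine ⟨v, ?_, hv⟩
    rintro rfl
    exact hle hv

variable (q : Fin 4 → MvPolynomial (Fin 8) ℂ)

lemma dim_abs
    (hsmooth : ∀ v : Fin 8 → ℂ, v ≠ 0 → (∀ i, eval v (q i) = 0) →
      (Matrix.of fun (i : Fin 4) (j : Fin 8) => eval v (pderiv j (q i))).rank = 4)
    (v : Fin 8 → ℂ) (hv : ∀ i, eval v (q i) = 0)
    (A : Type) [CommRing A] [IsLocalRing A] [IsNoetherianRing A]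
    (ψ : MvPolynomial (Fin 8) ℂ →+* A) (hψq : ∀ i, ψ (q i) = 0)
    (hunit : ∀ f, f ∉ ptIdeal v → IsUnit (ψ f)) (hmap : maximalIdeal A = (ptIdeal v).map ψ)
    (hmc : ∀ q' : Ideal A, (q'.comap ψ).map ψ = q') :
    ringKrullDim A + (4 : ℕ) ≤ (8 : ℕ) := by
  by_cases hv0 : v = 0
  · suffices h : (maximalIdeal A).height ≤ (4 : ℕ) by
      rw [← IsLocalRing.maximalIdeal_height_eq_ringKrullDim]
      have h2 : (maximalIdeal A).height + (4 : ℕ) ≤ (8 : ℕ) := by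
        refine (add_le_add_left h _).trans ?_
        norm_num
      exact (wb_add_le _ ((8 : ℕ) : ℕ∞) 4).2 h2
    rw [Ideal.height_le_iff]
    intro q' hq' hlt
    let A' := Localization.AtPrime q'
    let ψ' : MvPolynomial (Fin 8) ℂ →+* A' := (algebraMap A A').comp ψ
    let P : Ideal (MvPolynomial (Fin 8) ℂ) := q'.comap ψ
    have hPp : P.IsPrime := Ideal.IsPrime.comap ψ
    have hPmap : P.map ψ = q' := hmc q'
    have hPne : P ≠ ptIdeal 0 := by
      intro h
      rw [h, ← hv0, ← hmap] at hPmap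
      exact hlt.ne hPmap.symm
    have hPle : P ≤ ptIdeal v := by
      intro f hf
      by_contra hcon
      exact hq'.ne_top (Ideal.eq_top_of_isUnit_mem _ hf (hunit f hcon))
    obtain ⟨w, hw0, hw⟩ := exists_ne_zero_of_lt P hPne
    have hqP : ∀ i, q i ∈ P := fun i => by
      change ψ (q i) ∈ q'
      rw [hψq]; exact zero_mem _
    have hqw : ∀ i, eval w (q i) = 0 := fun i => mem_ptIdeal.1 (hw (hqP i))
    have hd := dim_le_of_hom P q hqP w hw (hsmooth w hw0 hqw) A' ψ'
      (fun i => by change algebraMap _ A' (ψ (q i)) = 0; rw [hψq, map_zero])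
      (fun f hf => IsLocalization.map_units A' (⟨ψ f, hf⟩ : q'.primeCompl))
      (by rw [← Ideal.map_map, hPmap, Localization.AtPrime.map_eq_maximalIdeal])
    rw [IsLocalization.AtPrime.ringKrullDim_eq_height q'] at hd
    have hfh : (ptIdeal v).FiniteHeight := inferInstance
    have hlt2 : P.height < (ptIdeal v).height := Ideal.height_strict_mono_of_isPrime_of_isPrime
      (lt_of_le_of_ne hPle (by rw [hv0]; exact hPne))
    rw [height_ptIdeal] at hlt2
    have hd' : q'.height + (4 : ℕ) ≤ P.height := (wb_add_le _ _ 4).1 hd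
    have h3 := hd'.trans_lt hlt2
    have hq'f : q'.height ≠ ⊤ := by
      intro h
      rw [h] at h3
      simp at h3
    obtain ⟨n, hn⟩ := ENat.ne_top_iff_exists.1 hq'f
    rw [← hn] at h3 ⊢
    norm_cast at h3 ⊢
    omega
  · have := dim_le_of_hom (ptIdeal v) q (fun i => mem_ptIdeal.2 (hv i)) v le_rfl
      (hsmooth v hv0 hv) A ψ hψq hunit hmap
    rw [height_ptIdeal] at this
    exact this

lemma dim_quot_loc
    (hsmooth : ∀ v : Fin 8 → ℂ, v ≠ 0 → (∀ i, eval v (q i) = 0) →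
      (Matrix.of fun (i : Fin 4) (j : Fin 8) => eval v (pderiv j (q i))).rank = 4)
    (v : Fin 8 → ℂ) (hv : ∀ i, eval v (q i) = 0) :
    ringKrullDim (Localization.AtPrime (ptIdeal v) ⧸
      (Ideal.span (Set.range q)).map (algebraMap _ (Localization.AtPrime (ptIdeal v)))) + (4 : ℕ) ≤
      (8 : ℕ) := by
  let R := Localization.AtPrime (ptIdeal v)
  let I : Ideal R := (Ideal.span (Set.range q)).map (algebraMap _ R)
  have hIm : I ≤ maximalIdeal R := by
    change (Ideal.span (Set.range q)).map (algebraMap _ R) ≤ _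
    rw [Ideal.map_le_iff_le_comap, Ideal.span_le]
    rintro _ ⟨i, rfl⟩
    exact (IsLocalization.AtPrime.to_map_mem_maximal_iff R (ptIdeal v) (q i)).2
      (mem_ptIdeal.2 (hv i))
  have hnt : Nontrivial (R ⧸ I) := Ideal.Quotient.nontrivial_iff.2
    (fun h => (maximalIdeal.isMaximal R).ne_top (top_le_iff.1 (h ▸ hIm)))
  have hloc : IsLocalRing (R ⧸ I) := IsLocalRing.of_surjective' (Ideal.Quotient.mk I)
    Ideal.Quotient.mk_surjective
  let ψ : MvPolynomial (Fin 8) ℂ →+* R ⧸ I := (Ideal.Quotient.mk I).comp (algebraMap _ R)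
  refine dim_abs q hsmooth v hv (R ⧸ I) ψ ?_ ?_ ?_ ?_
  · exact fun i => Ideal.Quotient.eq_zero_iff_mem.2
      (Ideal.mem_map_of_mem _ (Ideal.subset_span ⟨i, rfl⟩))
  · exact fun f hf =>
      (IsLocalization.map_units R (⟨f, hf⟩ : (ptIdeal v).primeCompl)).map (Ideal.Quotient.mk I)
  · rw [← Ideal.map_map, Localization.AtPrime.map_eq_maximalIdeal,
      IsLocalRing.map_maximalIdeal_of_surjective _ Ideal.Quotient.mk_surjective]
  · intro q'
    have e1 : q'.comap ψ = (q'.comap (Ideal.Quotient.mk I)).comap (algebraMap _ R) := rfl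
    rw [← Ideal.map_map, e1]
    have e2 := IsLocalization.map_under (ptIdeal v).primeCompl R (q'.comap (Ideal.Quotient.mk I))
    rw [Ideal.under] at e2
    rw [e2, Ideal.map_comap_of_surjective _ Ideal.Quotient.mk_surjective]

theorem mem_ideal_of_vanishing
    (hsmooth : ∀ v : Fin 8 → ℂ, v ≠ 0 → (∀ i, eval v (q i) = 0) →
      (Matrix.of fun (i : Fin 4) (j : Fin 8) => eval v (pderiv j (q i))).rank = 4)
    (f : MvPolynomial (Fin 8) ℂ)
    (hf : ∀ v, (∀ i, eval v (q i) = 0) → eval v f = 0) :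
    f ∈ Ideal.span (Set.range q) := by
  by_contra hfJ
  set J := Ideal.span (Set.range q) with hJ
  have hz : (Ideal.Quotient.mk J f) ≠ 0 := by rwa [Ne, Ideal.Quotient.eq_zero_iff_mem]
  obtain ⟨P, hP, hP1, w, hw, hP2⟩ :=
    exists_exact_prime (R := MvPolynomial (Fin 8) ℂ) (Ideal.Quotient.mk J f) hz
  obtain ⟨w, rfl⟩ := Ideal.Quotient.mk_surjective w
  have hsm : ∀ r g, r • Ideal.Quotient.mk J g = 0 ↔ r * g ∈ J := by
    intro r g
    rw [← Ideal.Quotient.eq_zero_iff_mem, map_mul]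
    rfl
  have hJP : J ≤ P := fun r hr => hP1 r ((hsm r f).2 (J.mul_mem_right _ hr))
  have hqP : ∀ i, q i ∈ P := fun i => hJP (Ideal.subset_span ⟨i, rfl⟩)
  obtain ⟨v, hPv, hv⟩ : ∃ v, P ≤ ptIdeal v ∧ (v ≠ 0 ∨ P = ptIdeal v) := by
    by_cases h : P = ptIdeal 0
    · exact ⟨0, h.le, Or.inr h⟩
    · obtain ⟨v, h1, h2⟩ := exists_ne_zero_of_lt P h
      exact ⟨v, h2, Or.inl h1⟩
  have hqv : ∀ i, eval v (q i) = 0 := fun i => mem_ptIdeal.1 (hPv (hqP i))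
  let R := Localization.AtPrime (ptIdeal v)
  have hdisj : Disjoint ((ptIdeal v).primeCompl : Set (MvPolynomial (Fin 8) ℂ)) P := by
    rw [Set.disjoint_left]
    exact fun a ha hb => ha (hPv hb)
  let PR : Ideal R := P.map (algebraMap _ R)
  have hPR : PR.IsPrime := IsLocalization.isPrime_of_isPrime_disjoint (ptIdeal v).primeCompl R P hP hdisj
  let s : List R := (List.ofFn q).map (algebraMap _ R)
  have hs : Ideal.ofList s • (⊤ : Submodule R R) = J.map (algebraMap _ R) := by
    rw [smul_eq_mul, Ideal.mul_top, Ideal.ofList, hJ, Ideal.map_span]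
    congr 1
    ext x
    simp only [s, List.mem_map, List.mem_ofFn, Set.mem_ofPred_eq, Set.mem_image, Set.mem_range]
  have hdim := dim_quot_loc q hsmooth v hqv
  have key : ((8 : ℕ) : WithBot ℕ∞) ≤ ringKrullDim (R ⧸ PR) + s.length := by
    refine unmixed_local s 8 R ?_ (hasDepth_loc v) ?_ PR hPR
      (Submodule.Quotient.mk (algebraMap _ R w)) ?_ ?_
    · intro r hr
      obtain ⟨a, ha, rfl⟩ := List.mem_map.1 hr
      obtain ⟨i, rfl⟩ := List.mem_ofFn.1 ha
      exact (IsLocalization.AtPrime.to_map_mem_maximal_iff R (ptIdeal v) (q i)).2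
        (mem_ptIdeal.2 (hqv i))
    · rw [hs]
      have := Module.supportDim_quotient_eq_ringKrullDim (J.map (algebraMap _ R))
      rw [this]
      simpa [s] using! hdim
    · rw [Ne, Submodule.Quotient.mk_eq_zero, hs]
      rw [IsLocalization.algebraMap_mem_map_algebraMap_iff (ptIdeal v).primeCompl]
      rintro ⟨u, hu, h⟩
      exact hu (hPv ((hP2 u).2 ((hsm u w).2 h)))
    · intro r hr
      rw [← Submodule.Quotient.mk_smul, Submodule.Quotient.mk_eq_zero, hs]
      have hle : PR ≤ Submodule.comap (LinearMap.toSpanSingleton R R (algebraMap _ R w))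
          (J.map (algebraMap _ R)) := by
        refine Ideal.map_le_iff_le_comap.2 ?_
        intro a ha
        change algebraMap _ R a * algebraMap _ R w ∈ J.map (algebraMap _ R)
        rw [← map_mul]
        exact Ideal.mem_map_of_mem _ ((hsm a w).1 ((hP2 a).1 ha))
      exact hle hr
  have hslen : s.length = 4 := by simp [s]
  rw [hslen] at key
  have hht := height_add_dim_quot_le PR
  have hPRh : PR.height = P.height :=
    IsLocalization.height_map_of_disjoint (ptIdeal v).primeCompl P hdisj
  rw [hPRh] at hht
  have hRd : ringKrullDim R = (8 : ℕ) := ringKrullDim_loc v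
  rw [hRd] at hht
  have hP4 : P.height ≤ (4 : ℕ) := by
    have hnt : Nontrivial (R ⧸ PR) := Ideal.Quotient.nontrivial_iff.2 hPR.ne_top
    have hfin : ringKrullDim (R ⧸ PR) ≠ ⊥ := by
      intro h
      have := ringKrullDim_nonneg_of_nontrivial (R := R ⧸ PR)
      rw [h] at this
      simp at this
    obtain ⟨e, he⟩ := WithBot.ne_bot_iff_exists.1 hfin
    rw [← he] at key hht
    have key' : ((8 : ℕ) : ℕ∞) ≤ e + (4 : ℕ) := (wb_le_add e ((8 : ℕ) : ℕ∞) 4).1 key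
    have hht' : P.height + e ≤ ((8 : ℕ) : ℕ∞) := by
      rw [← WithBot.coe_le_coe]
      exact hht
    have hef : e ≠ ⊤ := by
      rintro rfl
      simp at hht'
    have hPf : P.height ≠ ⊤ := by
      intro h
      rw [h] at hht'
      simp at hht'
    obtain ⟨n, hn⟩ := ENat.ne_top_iff_exists.1 hef
    obtain ⟨m, hm⟩ := ENat.ne_top_iff_exists.1 hPf
    rw [← hn] at key' hht'
    rw [← hm] at hht' ⊢
    norm_cast at key' hht' ⊢
    omega
  rcases hv with hv0 | hPm
  · obtain ⟨t, ht, hmax⟩ := exists_params P q hqP v hPv (hsmooth v hv0 hqv)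
    have ht0 : t = ∅ := by
      have := ht.trans hP4
      have : t.card + 4 ≤ 4 := by exact_mod_cast this
      exact Finset.card_eq_zero.1 (by omega)
    have hfP : f ∈ P := by
      by_contra hcon
      obtain ⟨x, hx, hfx⟩ := exists_zero_of_isPrime P f hcon
      exact hfx (hf x fun i => mem_ptIdeal.1 (hx (hqP i)))
    have h1 := (IsLocalization.AtPrime.to_map_mem_maximal_iff (Localization.AtPrime P) P f).2 hfP
    have h2 : algebraMap _ (Localization.AtPrime P) f ∈
        J.map (algebraMap _ (Localization.AtPrime P)) := by
      rw [hmax, ht0] at h1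
      rw [hJ, Ideal.map_span]
      rw [← Set.range_comp]
      simpa using! h1
    rw [IsLocalization.algebraMap_mem_map_algebraMap_iff P.primeCompl] at h2
    obtain ⟨u, hu, h⟩ := h2
    exact hu (hP1 u ((hsm u f).2 h))
  · rw [hPm, height_ptIdeal] at hP4
    norm_cast at hP4

end PartFour

section LinearAction

lemma eval_smul_of_hom {d n : ℕ} {f : MvPolynomial (Fin d) ℂ} (hf : f.IsHomogeneous n) (t : ℂ)
    (v : Fin d → ℂ) : eval (t • v) f = t ^ n * eval v f := by
  rw [eval_eq, eval_eq, Finset.mul_sum]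
  refine Finset.sum_congr rfl fun m hm => ?_
  have h : m.degree = n := by
    have := hf (mem_support_iff.mp hm)
    rw [Finsupp.degree_eq_weight_one]; exact this
  have h2 : ∏ i ∈ m.support, (t • v) i ^ m i = t ^ n * ∏ i ∈ m.support, v i ^ m i := by
    simp only [Pi.smul_apply, smul_eq_mul, mul_pow, Finset.prod_mul_distrib]
    rw [Finset.prod_pow_eq_pow_sum, ← h]
    rfl
  rw [h2]; ring

lemma exists_const_coeffs {d k : ℕ} (q : Fin k → MvPolynomial (Fin d) ℂ)
    (hq : ∀ i (t : ℂ) v, eval (t • v) (q i) = t ^ 2 * eval v (q i))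
    (f : MvPolynomial (Fin d) ℂ)
    (hfh : ∀ (t : ℂ) v, eval (t • v) f = t ^ 2 * eval v f)
    (hf : f ∈ Ideal.span (Set.range q)) :
    ∃ c : Fin k → ℂ, ∀ v, eval v f = ∑ i, c i * eval v (q i) := by
  obtain ⟨a, ha⟩ := Ideal.mem_span_range_iff_exists_fun.mp hf
  refine ⟨fun i => eval 0 (a i), fun v => ?_⟩
  have key : (fun _ : ℂ => eval v f) = fun t : ℂ => ∑ i, eval (t • v) (a i) * eval v (q i) := by
    refine Continuous.ext_on (dense_compl_singleton (0 : ℂ)) continuous_const ?_ ?_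
    · refine continuous_finsetSum _ fun i _ => Continuous.mul ?_ continuous_const
      exact (MvPolynomial.continuous_eval (a i)).comp (continuous_id.smul continuous_const)
    · intro t ht
      have ht : t ≠ 0 := ht
      have h1 := hfh t v
      rw [← ha] at h1
      simp only [map_sum, map_mul, hq] at h1
      apply mul_left_cancel₀ (pow_ne_zero 2 ht)
      simp only
      conv_lhs => rw [← ha]
      simp only [map_sum, map_mul]
      rw [← h1, Finset.mul_sum]
      exact Finset.sum_congr rfl fun i _ => by ring
  have := congrFun key 0
  simpa using this

/-- Composition of a polynomial function with a linear map. -/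
noncomputable def compLin {d e : ℕ} (L : (Fin d → ℂ) →ₗ[ℂ] (Fin e → ℂ))
    (f : MvPolynomial (Fin e) ℂ) : MvPolynomial (Fin d) ℂ :=
  bind₁ (fun j => ∑ k, C (L (Pi.single k 1) j) * X k) f

lemma eval_compLin {d e : ℕ} (L : (Fin d → ℂ) →ₗ[ℂ] (Fin e → ℂ))
    (f : MvPolynomial (Fin e) ℂ) (u : Fin d → ℂ) : eval u (compLin L f) = eval (L u) f := by
  have h : (fun j => eval u (∑ k, C (L (Pi.single k 1) j) * X k : MvPolynomial (Fin d) ℂ)) = L u := by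
    funext j
    have hu : u = ∑ k, u k • (Pi.single k 1 : Fin d → ℂ) := by
      simpa using (pi_eq_sum_univ' u)
    conv_rhs => rw [hu]
    simp [map_sum, Finset.sum_apply, mul_comm]
  unfold compLin
  rw [← h]
  change eval₂Hom (RingHom.id ℂ) u (bind₁ _ f) = _
  rw [eval₂Hom_bind₁]
  rfl

lemma exists_zero_few {d k : ℕ} (F : Fin k → MvPolynomial (Fin d) ℂ) (h0 : ∀ i, eval 0 (F i) = 0)
    (hkd : k < d) : ∃ v : Fin d → ℂ, v ≠ 0 ∧ ∀ i, eval v (F i) = 0 := by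
  classical
  by_contra hcon
  push Not at hcon
  have hle : Ideal.span (Set.range F) ≤ ptIdeal (0 : Fin d → ℂ) := by
    rw [Ideal.span_le]
    rintro _ ⟨i, rfl⟩
    exact mem_ptIdeal.mpr (h0 i)
  have : (ptIdeal (0 : Fin d → ℂ)).IsPrime := RingHom.ker_isPrime _
  obtain ⟨P, hP, hP2⟩ := Ideal.exists_minimalPrimes_le hle
  have := hP.1.1
  have hPe : P = ptIdeal 0 := by
    by_contra hne
    obtain ⟨v, hv, hPv⟩ := exists_ne_zero_of_lt P hne
    obtain ⟨i, hi⟩ := hcon v hv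
    exact hi (mem_ptIdeal.mp (hPv (hP.1.2 (Ideal.subset_span ⟨i, rfl⟩))))
  have hmin : ptIdeal (0 : Fin d → ℂ) ∈ (Ideal.span ((Finset.univ.image F : Finset _) : Set (MvPolynomial (Fin d) ℂ))).minimalPrimes := by
    rw [← hPe]; simpa using hP
  have := Ideal.height_le_card_of_mem_minimalPrimes_span_finset hmin
  rw [height_ptIdeal] at this
  have h3 : (Finset.univ.image F).card ≤ k := by simpa using Finset.card_image_le (s := Finset.univ) (f := F)
  have : d ≤ (Finset.univ.image F).card := by exact_mod_cast this
  omega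

end LinearAction

section EigenCount
open Module

lemma sum_finrank_le {V : Type*} [AddCommGroup V] [Module ℂ V] [FiniteDimensional ℂ V]
    {ι : Type*} (N : ι → Submodule ℂ V) (h : iSupIndep N) (s : Finset ι) :
    ∑ i ∈ s, finrank ℂ (N i) ≤ finrank ℂ V := by
  classical
  have h' : iSupIndep (fun i : s => N i) := h.comp Subtype.val_injective
  have hinj := h'.dfinsupp_lsum_injective
  have := LinearMap.finrank_le_finrank_of_injective hinj
  have h2 := Module.finrank_directSum (R := ℂ) (fun i : s => N i)
  rw [← Finset.sum_coe_sort, ← h2]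
  exact this

lemma trace_eq_zero_of_count {V W : Type*} [AddCommGroup V] [Module ℂ V] [FiniteDimensional ℂ V]
    [AddCommGroup W] [Module ℂ W] [FiniteDimensional ℂ W] (g : End ℂ V) (M : End ℂ W)
    (hg : ⨆ μ, g.eigenspace μ = ⊤) (hVW : finrank ℂ V = 2 * finrank ℂ W)
    (hle : ∀ l, finrank ℂ (g.eigenspace l) ≤ finrank ℂ (M.eigenspace (l ^ 2))) :
    LinearMap.trace ℂ V g = 0 := by
  classical
  have hInt := DirectSum.isInternal_submodule_of_iSupIndep_of_iSup_eq_top g.eigenspaces_iSupIndep hg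
  have hfin : {μ | g.eigenspace μ ≠ ⊥}.Finite :=
    WellFoundedGT.finite_ne_bot_of_iSupIndep g.eigenspaces_iSupIndep
  have hmaps : ∀ l, Set.MapsTo g (g.eigenspace l) (g.eigenspace l) := by
    intro l x hx
    have hx' : g x = l • x := End.mem_eigenspace_iff.mp hx
    rw [hx']
    exact Submodule.smul_mem _ _ hx
  let S : Finset ℂ := hfin.toFinset ∪ hfin.toFinset.image (fun x => -x)
  have hSneg : ∀ l ∈ S, -l ∈ S := by
    intro l hl
    simp only [S, Finset.mem_union, Finset.mem_image] at hl ⊢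
    rcases hl with hl | ⟨a, ha, rfl⟩
    · exact Or.inr ⟨l, hl, rfl⟩
    · left; simpa using ha
  have hsub : hfin.toFinset ⊆ S := Finset.subset_union_left
  have hbot : ∀ l, l ∉ hfin.toFinset → finrank ℂ (g.eigenspace l) = 0 := by
    intro l hl
    have : g.eigenspace l = ⊥ := by simpa using hl
    rw [this]; simp
  -- trace formula
  have htr : LinearMap.trace ℂ V g = ∑ l ∈ S, (finrank ℂ (g.eigenspace l) : ℂ) * l := by
    rw [LinearMap.trace_eq_sum_trace_restrict' hInt hfin hmaps,
      ← Finset.sum_subset hsub (fun l _ hl => by rw [hbot l hl]; simp)]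
    refine Finset.sum_congr rfl fun l _ => ?_
    have : g.restrict (hmaps l) = l • LinearMap.id := by
      refine LinearMap.ext fun x => Subtype.ext ?_
      exact End.mem_eigenspace_iff.mp x.2
    rw [this, map_smul, LinearMap.trace_id, smul_eq_mul, mul_comm]
  have hdim : finrank ℂ V = ∑ l ∈ S, finrank ℂ (g.eigenspace l) := by
    have h1 : LinearMap.trace ℂ V LinearMap.id = ∑ l ∈ hfin.toFinset, (finrank ℂ (g.eigenspace l) : ℂ) := by
      rw [LinearMap.trace_eq_sum_trace_restrict' hInt hfin (f := LinearMap.id) (fun l x hx => hx)]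
      refine Finset.sum_congr rfl fun l _ => ?_
      rw [← LinearMap.trace_id]
      rfl
    rw [LinearMap.trace_id] at h1
    rw [← Finset.sum_subset hsub (fun l _ hl => hbot l hl)]
    exact_mod_cast h1
  have hsq : ∑ l ∈ S, finrank ℂ (M.eigenspace (l ^ 2)) ≤ 2 * finrank ℂ W := by
    calc ∑ l ∈ S, finrank ℂ (M.eigenspace (l ^ 2))
        = ∑ m ∈ S.image (· ^ 2), ∑ l ∈ S with l ^ 2 = m, finrank ℂ (M.eigenspace (l ^ 2)) :=
          (Finset.sum_fiberwise_of_maps_to (fun l hl => Finset.mem_image_of_mem _ hl) _).symm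
      _ ≤ ∑ m ∈ S.image (· ^ 2), 2 * finrank ℂ (M.eigenspace m) := by
          refine Finset.sum_le_sum fun m _ => ?_
          rw [Finset.sum_congr rfl (g := fun _ => finrank ℂ (M.eigenspace m))
            (fun l hl => by rw [(Finset.mem_filter.mp hl).2]), Finset.sum_const, smul_eq_mul]
          refine Nat.mul_le_mul_right _ ?_
          obtain ⟨r, hr⟩ : ∃ r : ℂ, r ^ 2 = m := IsAlgClosed.exists_pow_nat_eq m (by norm_num)
          refine (Finset.card_le_card (t := {r, -r}) ?_).trans Finset.card_le_two
          intro l hl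
          have := (Finset.mem_filter.mp hl).2
          rw [← hr, sq_eq_sq_iff_eq_or_eq_neg] at this
          simpa using this
      _ ≤ 2 * finrank ℂ W := by
          rw [← Finset.mul_sum]
          exact Nat.mul_le_mul_left _ (sum_finrank_le _ M.eigenspaces_iSupIndep _)
  have heq : ∀ l ∈ S, finrank ℂ (g.eigenspace l) = finrank ℂ (M.eigenspace (l ^ 2)) := by
    rw [← Finset.sum_eq_sum_iff_of_le (fun l _ => hle l)]
    refine le_antisymm (Finset.sum_le_sum fun l _ => hle l) ?_
    omega
  rw [htr]
  have h2 : ∑ l ∈ S, (finrank ℂ (g.eigenspace l) : ℂ) * l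
      = ∑ l ∈ S, -((finrank ℂ (g.eigenspace l) : ℂ) * l) := by
    refine Finset.sum_nbij' (fun l => -l) (fun l => -l) hSneg hSneg (by simp) (by simp) ?_
    intro l hl
    rw [heq l hl, heq (-l) (hSneg l hl), neg_sq]
    simp
  rw [Finset.sum_neg_distrib] at h2
  exact self_eq_neg.mp h2

end EigenCount

section SingleElement
open Module

lemma scalar_of_mem_center (g : GL8) (hg : g ∈ Subgroup.center GL8) :
    ∃ c : ℂ, ∀ v, g v = c • v := by
  have h : ∃ a : Subring.center ℂ, (g : V8 →ₗ[ℂ] V8) = a • 1 := by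
    apply LinearMap.commute_transvections_iff_of_basis (Pi.basisFun ℂ (Fin 8))
    intro i j r hij
    have h0 : ((Pi.basisFun ℂ (Fin 8)).coord i) (r • (Pi.basisFun ℂ (Fin 8)) j) = 0 := by
      simp [hij]
    have := Subgroup.mem_center_iff.mp hg (LinearEquiv.transvection h0)
    refine LinearMap.ext fun x => ?_
    exact (LinearEquiv.congr_fun this x).symm
  obtain ⟨a, ha⟩ := h
  refine ⟨a, fun v => ?_⟩
  have := LinearMap.congr_fun ha v
  exact this

lemma mem_center_of_scalar (g : GL8) (c : ℂ) (hc : ∀ v, g v = c • v) :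
    g ∈ Subgroup.center GL8 := by
  rw [Subgroup.mem_center_iff]
  intro h
  refine LinearEquiv.ext fun v => ?_
  change h (g v) = g (h v)
  rw [hc, hc, map_smul]

lemma iSup_eigenspace_of_finite_order (g : GL8) (n : ℕ) (hn : 0 < n)
    (h : g ^ n ∈ Subgroup.center GL8) :
    ⨆ μ, End.eigenspace (g : End ℂ V8) μ = ⊤ := by
  obtain ⟨c, hc⟩ := scalar_of_mem_center _ h
  have hc0 : c ≠ 0 := by
    rintro rfl
    have h1 := hc (Pi.single 0 1)
    rw [zero_smul] at h1
    have := (LinearEquiv.map_eq_zero_iff (g ^ n)).mp h1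
    have := congrFun this 0
    simp at this
  have hpow : ∀ m : ℕ, ∀ v, ((g : End ℂ V8) ^ m) v = (g ^ m) v := by
    intro m
    induction m with
    | zero => intro v; rfl
    | succ m ih => intro v; rw [pow_succ, pow_succ]; exact ih (g v)
  apply End.IsSemisimple.iSup_eigenspace_eq_top
  refine End.isSemisimple_of_squarefree_aeval_eq_zero
    (p := Polynomial.X ^ n - Polynomial.C c)
    (Polynomial.separable_X_pow_sub_C c (by exact_mod_cast hn.ne') hc0).squarefree ?_
  refine LinearMap.ext fun v => ?_
  have := hpow n v
  rw [hc] at this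
  simp only [map_sub, map_pow, Polynomial.aeval_X, Polynomial.aeval_C, LinearMap.sub_apply, this]
  simp [Module.algebraMap_end_apply]

lemma sum_single_apply {d e : ℕ} (p : (Fin d → ℂ) →ₗ[ℂ] (Fin e → ℂ)) (x : Fin d → ℂ) (k : Fin e) :
    ∑ i, p (Pi.single i 1) k * x i = p x k := by
  have hu : x = ∑ k, x k • (Pi.single k 1 : Fin d → ℂ) := by
    simpa using (pi_eq_sum_univ' x)
  conv_rhs => rw [hu]
  simp [map_sum, Finset.sum_apply, mul_comm]

lemma finrank_eigenspace_le (q : Fin 4 → MvPolynomial (Fin 8) ℂ)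
    (hq : ∀ i (t : ℂ) v, eval (t • v) (q i) = t ^ 2 * eval v (q i))
    (g : End ℂ V8) (M : End ℂ (Fin 4 → ℂ))
    (hM : ∀ v, (fun i => eval (g v) (q i)) = M (fun i => eval v (q i)))
    (hfree : ∀ v : V8, v ≠ 0 → (∀ i, eval v (q i) = 0) → ¬ ∃ c : ℂ, g v = c • v) (l : ℂ) :
    finrank ℂ (g.eigenspace l) ≤ finrank ℂ (M.eigenspace (l ^ 2)) := by
  by_contra hlt
  push Not at hlt
  let b := Module.finBasis ℂ (g.eigenspace l)
  let L : (Fin (finrank ℂ (g.eigenspace l)) → ℂ) →ₗ[ℂ] V8 :=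
    (g.eigenspace l).subtype ∘ₗ b.equivFun.symm.toLinearMap
  have hLinj : Function.Injective L :=
    (Submodule.subtype_injective _).comp b.equivFun.symm.injective
  let b2 := Module.finBasis ℂ (M.eigenspace (l ^ 2))
  obtain ⟨p, hp⟩ := LinearMap.exists_extend b2.equivFun.toLinearMap
  have hL : ∀ u, g (L u) = l • L u := fun u => End.mem_eigenspace_iff.mp (b.equivFun.symm u).2
  have hmem : ∀ u, (fun i => eval (L u) (q i)) ∈ M.eigenspace (l ^ 2) := by
    intro u
    rw [End.mem_eigenspace_iff, ← hM, hL]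
    funext i
    simp [hq]
  let F : Fin (finrank ℂ (M.eigenspace (l ^ 2))) →
      MvPolynomial (Fin (finrank ℂ (g.eigenspace l))) ℂ :=
    fun k => ∑ i, C (p (Pi.single i 1) k) * compLin L (q i)
  have hF : ∀ u k, eval u (F k) = p (fun i => eval (L u) (q i)) k := by
    intro u k
    rw [← sum_single_apply p]
    simp only [F, map_sum, map_mul, eval_C, eval_compLin]
  have hq0 : ∀ i, eval 0 (q i) = 0 := fun i => by
    have := hq i 0 0
    simpa using this
  obtain ⟨u, hu, hu2⟩ := exists_zero_few F (fun k => by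
    rw [hF, map_zero]
    have : (fun i => eval (0 : V8) (q i)) = 0 := funext hq0
    rw [this]; simp) hlt
  refine hfree (L u) ?_ ?_ ⟨l, hL u⟩
  · intro h
    exact hu (hLinj (h.trans (map_zero L).symm))
  · have h1 : p (fun i => eval (L u) (q i)) = 0 := funext fun k => by rw [← hF, hu2]; rfl
    have h2 := LinearMap.congr_fun hp ⟨_, hmem u⟩
    have h3 : b2.equivFun ⟨_, hmem u⟩ = 0 := h2.symm.trans h1
    have h4 := (LinearEquiv.map_eq_zero_iff _).mp h3
    have h5 := congrArg Subtype.val h4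
    exact fun i => congrFun h5 i

lemma trace_eq_zero_of_mem (q : Fin 4 → MvPolynomial (Fin 8) ℂ)
    (hhom : ∀ i, (q i).IsHomogeneous 2)
    (hsmooth : ∀ v : V8, v ≠ 0 → (∀ i, eval v (q i) = 0) →
      (Matrix.of fun (i : Fin 4) (j : Fin 8) => eval v (pderiv j (q i))).rank = 4)
    (g : GL8) (n : ℕ) (hn : 0 < n) (hgn : g ^ n ∈ Subgroup.center GL8)
    (hpres : ∀ v : V8, (∀ i, eval v (q i) = 0) → ∀ i, eval (g v) (q i) = 0)
    (hfree : ∀ v : V8, v ≠ 0 → (∀ i, eval v (q i) = 0) → ¬ ∃ c : ℂ, g v = c • v) :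
    LinearMap.trace ℂ V8 (g : V8 →ₗ[ℂ] V8) = 0 := by
  have hq : ∀ i (t : ℂ) v, eval (t • v) (q i) = t ^ 2 * eval v (q i) :=
    fun i t v => eval_smul_of_hom (hhom i) t v
  have hex : ∀ i, ∃ c : Fin 4 → ℂ, ∀ v, eval (g v) (q i) = ∑ j, c j * eval v (q j) := by
    intro i
    obtain ⟨c, hc⟩ := exists_const_coeffs q hq (compLin (g : V8 →ₗ[ℂ] V8) (q i))
      (fun t v => by rw [eval_compLin, eval_compLin, map_smul, hq])
      (mem_ideal_of_vanishing q hsmooth _ fun v hv => by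
        rw [eval_compLin]; exact hpres v hv i)
    refine ⟨c, fun v => ?_⟩
    rw [← hc, eval_compLin]; rfl
  choose c hc using hex
  refine trace_eq_zero_of_count (g : End ℂ V8) (Matrix.toLin' (Matrix.of c))
    (iSup_eigenspace_of_finite_order g n hn hgn) (by simp) ?_
  refine finrank_eigenspace_le q hq _ _ ?_ hfree
  intro v
  funext i
  rw [Matrix.toLin'_apply]
  exact hc i v

end SingleElement

section Averaging
open Module

/-- The tautological representation of `GL8`. -/
def tautRep : Representation ℂ GL8 V8 where
  toFun g := (g : V8 →ₗ[ℂ] V8)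
  map_one' := rfl
  map_mul' _ _ := rfl

/-- The conjugation representation of `PGL8` on the endomorphisms of `V8`. -/
def conjRep : Representation ℂ PGL8 (V8 →ₗ[ℂ] V8) :=
  QuotientGroup.lift (Subgroup.center GL8) (Representation.linHom tautRep tautRep) (by
    intro g hg
    obtain ⟨c, hc⟩ := scalar_of_mem_center g hg
    refine LinearMap.ext fun A => LinearMap.ext fun v => ?_
    change g (A (g⁻¹ v)) = A v
    rw [hc, ← map_smul, ← hc]
    congr 1
    exact LinearEquiv.apply_symm_apply g v)

lemma conjRep_character (g : GL8) : conjRep.character (QuotientGroup.mk g : PGL8)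
    = tautRep.character g⁻¹ * tautRep.character g := by
  rw [← Representation.char_linHom]
  rfl

lemma card_dvd_of_trace (G : Subgroup PGL8) [Finite G]
    (h : ∀ g : GL8, (QuotientGroup.mk g : PGL8) ∈ G → (QuotientGroup.mk g : PGL8) ≠ 1 →
      LinearMap.trace ℂ V8 (g : V8 →ₗ[ℂ] V8) = 0) : Nat.card G ∣ 64 := by
  classical
  have := Fintype.ofFinite G
  have hne : (Nat.card G : ℂ) ≠ 0 := by exact_mod_cast Nat.card_pos.ne'
  letI : Invertible (Nat.card G : ℂ) := invertibleOfNonzero hne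
  let ρ : Representation ℂ G (V8 →ₗ[ℂ] V8) := conjRep.comp G.subtype
  have h1 := Representation.card_inv_mul_sum_char_eq_finrank ρ
  have h2 : ∑ g : G, ρ.character g = 64 := by
    rw [Finset.sum_eq_single 1]
    · rw [Representation.char_one]
      simp [Module.finrank_linearMap]
    · rintro ⟨x, hx⟩ - hx1
      obtain ⟨g, rfl⟩ := QuotientGroup.mk_surjective x
      have h3 : ρ.character ⟨(QuotientGroup.mk g : PGL8), hx⟩
        = tautRep.character g⁻¹ * tautRep.character g := conjRep_character g
      have h4 : tautRep.character g = 0 := h g hx fun h => hx1 (Subtype.ext h)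
      rw [h3, h4, mul_zero]
    · simp
  rw [h2, inv_mul_eq_iff_eq_mul₀ hne] at h1
  exact ⟨_, by exact_mod_cast h1⟩

end Averaging

/-- If a finite group `G ⊆ PGL(8, ℂ)` acts freely on a smooth complete intersection
`X ⊆ ℙ⁷` of four quadrics (so `deg X = 16`, and smoothness/completeness of the
intersection is expressed by the Jacobian of the four quadrics having rank 4 at every
nonzero point of the affine cone over `X`), then `|G|` divides `256`. -/
theorem card_dvd_256_of_free_action_on_quadric_ci
    (q : Fin 4 → MvPolynomial (Fin 8) ℂ)
    (hhom : ∀ i, (q i).IsHomogeneous 2)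
    (hsmooth : ∀ v : V8, v ≠ 0 → (∀ i, eval v (q i) = 0) →
      (Matrix.of fun (i : Fin 4) (j : Fin 8) => eval v (pderiv j (q i))).rank = 4)
    (G : Subgroup PGL8) [Finite G]
    (hpres : ∀ g : GL8, (QuotientGroup.mk g : PGL8) ∈ G →
      ∀ v : V8, (∀ i, eval v (q i) = 0) → ∀ i, eval (g v) (q i) = 0)
    (hfree : ∀ g : GL8, (QuotientGroup.mk g : PGL8) ∈ G →
      (QuotientGroup.mk g : PGL8) ≠ 1 →
      ∀ v : V8, v ≠ 0 → (∀ i, eval v (q i) = 0) → ¬ ∃ c : ℂ, g v = c • v) :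
    Nat.card G ∣ 256 := by
  have hfin : ∀ g : GL8, (QuotientGroup.mk g : PGL8) ∈ G →
      ∃ n : ℕ, 0 < n ∧ g ^ n ∈ Subgroup.center GL8 := by
    intro g hg
    obtain ⟨n, hn, h⟩ := isOfFinOrder_iff_pow_eq_one.mp (isOfFinOrder_of_finite (⟨_, hg⟩ : G))
    refine ⟨n, hn, (QuotientGroup.eq_one_iff _).mp ?_⟩
    exact congrArg Subtype.val h
  refine (card_dvd_of_trace G fun g hg hg1 => ?_).trans (by norm_num)
  obtain ⟨n, hn, hgn⟩ := hfin g hg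
  exact trace_eq_zero_of_mem q hhom hsmooth g n hn hgn (hpres g hg) (hfree g hg hg1)
end

section
/- The quaternion group Q8 acts freely on the complete intersection X ⊆ ℙ⁷ cut out by four generic quadrics q₁, ..., q₄, where V = ℂ⁸ is the regular representation of Q8 and each qᵢ lies in the isotypic component of the i-th one-dimensional irreducible representation Vᵢ inside Sym²(V*). That is, no non-identity element of Q8 has a fixed point on X. -/
open MvPolynomial

namespace BQ8

abbrev Q := QuaternionGroup 2

/-- Build a function on `Q₈` from its eight values. -/
def mk (p0 p1 p2 p3 r0 r1 r2 r3 : ℂ) : Q → ℂ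
  | QuaternionGroup.a j => (![p0, p1, p2, p3] : Fin 4 → ℂ) j
  | QuaternionGroup.xa j => (![r0, r1, r2, r3] : Fin 4 → ℂ) j

/-- Translation. -/
def T (g : Q) : (Q → ℂ) →ₗ[ℂ] (Q → ℂ) where
  toFun v := fun h => v (g * h)
  map_add' _ _ := rfl
  map_smul' _ _ := rfl

lemma T_apply (g : Q) (v : Q → ℂ) : T g v = fun h => v (g * h) := rfl

lemma T_mul (g k : Q) (v : Q → ℂ) : T (g * k) v = T k (T g v) := by
  ext h; simp [T_apply, mul_assoc]

abbrev A : Q := QuaternionGroup.a 1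
abbrev Y : Q := QuaternionGroup.xa 0

lemma fun_ext8 {u v : Q → ℂ}
    (h0 : u (.a 0) = v (.a 0)) (h1 : u (.a 1) = v (.a 1))
    (h2 : u (.a 2) = v (.a 2)) (h3 : u (.a 3) = v (.a 3))
    (k0 : u (.xa 0) = v (.xa 0)) (k1 : u (.xa 1) = v (.xa 1))
    (k2 : u (.xa 2) = v (.xa 2)) (k3 : u (.xa 3) = v (.xa 3)) : u = v := by
  ext g
  rcases g with j | j
  · change Fin 4 at j
    fin_cases j
    exacts [h0, h1, h2, h3]
  · change Fin 4 at j
    fin_cases j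
    exacts [k0, k1, k2, k3]

lemma eq_mk (v : Q → ℂ) : v = mk (v (.a 0)) (v (.a 1)) (v (.a 2)) (v (.a 3))
    (v (.xa 0)) (v (.xa 1)) (v (.xa 2)) (v (.xa 3)) := by
  apply fun_ext8 <;> rfl

lemma T_A (p0 p1 p2 p3 r0 r1 r2 r3 : ℂ) :
    T A (mk p0 p1 p2 p3 r0 r1 r2 r3) = mk p1 p2 p3 p0 r3 r0 r1 r2 := by
  apply fun_ext8 <;> rfl

lemma T_Y (p0 p1 p2 p3 r0 r1 r2 r3 : ℂ) :
    T Y (mk p0 p1 p2 p3 r0 r1 r2 r3) = mk r0 r1 r2 r3 p2 p3 p0 p1 := by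
  apply fun_ext8 <;> rfl

lemma T_Z (p0 p1 p2 p3 r0 r1 r2 r3 : ℂ) :
    T (.a 2) (mk p0 p1 p2 p3 r0 r1 r2 r3) = mk p2 p3 p0 p1 r2 r3 r0 r1 := by
  apply fun_ext8 <;> rfl

lemma mk_add (p0 p1 p2 p3 r0 r1 r2 r3 p0' p1' p2' p3' r0' r1' r2' r3' : ℂ) :
    mk p0 p1 p2 p3 r0 r1 r2 r3 + mk p0' p1' p2' p3' r0' r1' r2' r3' =
     mk (p0 + p0') (p1 + p1') (p2 + p2') (p3 + p3') (r0 + r0') (r1 + r1') (r2 + r2') (r3 + r3') := by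
  apply fun_ext8 <;> rfl

lemma mk_smul (c p0 p1 p2 p3 r0 r1 r2 r3 : ℂ) :
    c • mk p0 p1 p2 p3 r0 r1 r2 r3 =
     mk (c * p0) (c * p1) (c * p2) (c * p3) (c * r0) (c * r1) (c * r2) (c * r3) := by
  apply fun_ext8 <;> rfl

lemma mk_inj {p0 p1 p2 p3 r0 r1 r2 r3 p0' p1' p2' p3' r0' r1' r2' r3' : ℂ}
    (h : mk p0 p1 p2 p3 r0 r1 r2 r3 = mk p0' p1' p2' p3' r0' r1' r2' r3') :
    p0 = p0' ∧ p1 = p1' ∧ p2 = p2' ∧ p3 = p3' ∧ r0 = r0' ∧ r1 = r1' ∧ r2 = r2' ∧ r3 = r3' :=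
  ⟨congrFun h (.a 0), congrFun h (.a 1), congrFun h (.a 2), congrFun h (.a 3),
   congrFun h (.xa 0), congrFun h (.xa 1), congrFun h (.xa 2), congrFun h (.xa 3)⟩

def e1 : Q → ℂ := mk 1 1 1 1 1 1 1 1
def e2 : Q → ℂ := mk 1 1 1 1 (-1) (-1) (-1) (-1)
def e3 : Q → ℂ := mk 1 (-1) 1 (-1) 1 (-1) 1 (-1)
def e4 : Q → ℂ := mk 1 (-1) 1 (-1) (-1) 1 (-1) 1
open Complex in
def w11 : Q → ℂ := mk 1 I (-1) (-I) 0 0 0 0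
open Complex in
def w12 : Q → ℂ := mk 0 0 0 0 1 (-I) (-1) I
open Complex in
def w21 : Q → ℂ := mk 0 0 0 0 (-1) (-I) 1 I
open Complex in
def w22 : Q → ℂ := mk 1 (-I) (-1) I 0 0 0 0

lemma Ae1 : T A e1 = (1 : ℂ) • e1 := by simp only [e1, T_A, mk_smul]; congr 1 <;> norm_num
lemma Ae2 : T A e2 = (1 : ℂ) • e2 := by simp only [e2, T_A, mk_smul]; congr 1 <;> norm_num
lemma Ae3 : T A e3 = (-1 : ℂ) • e3 := by simp only [e3, T_A, mk_smul]; congr 1 <;> norm_num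
lemma Ae4 : T A e4 = (-1 : ℂ) • e4 := by simp only [e4, T_A, mk_smul]; congr 1 <;> norm_num
lemma Ye1 : T Y e1 = (1 : ℂ) • e1 := by simp only [e1, T_Y, mk_smul]; congr 1 <;> norm_num
lemma Ye2 : T Y e2 = (-1 : ℂ) • e2 := by simp only [e2, T_Y, mk_smul]; congr 1 <;> norm_num
lemma Ye3 : T Y e3 = (1 : ℂ) • e3 := by simp only [e3, T_Y, mk_smul]; congr 1 <;> norm_num
lemma Ye4 : T Y e4 = (-1 : ℂ) • e4 := by simp only [e4, T_Y, mk_smul]; congr 1 <;> norm_num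
lemma Aw11 : T A w11 = Complex.I • w11 := by simp only [w11, T_A, mk_smul]; congr 1 <;> simp
lemma Aw12 : T A w12 = Complex.I • w12 := by simp only [w12, T_A, mk_smul]; congr 1 <;> simp
lemma Aw21 : T A w21 = (-Complex.I) • w21 := by simp only [w21, T_A, mk_smul]; congr 1 <;> simp
lemma Aw22 : T A w22 = (-Complex.I) • w22 := by simp only [w22, T_A, mk_smul]; congr 1 <;> simp
lemma Yw11 : T Y w11 = w21 := by simp only [w11, w21, T_Y]
lemma Yw12 : T Y w12 = w22 := by simp only [w12, w22, T_Y]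
lemma Yw21 : T Y w21 = (-1 : ℂ) • w11 := by simp only [w11, w21, T_Y, mk_smul]; congr 1 <;> simp
lemma Yw22 : T Y w22 = (-1 : ℂ) • w12 := by simp only [w12, w22, T_Y, mk_smul]; congr 1 <;> simp

lemma plus_decomp (v : Q → ℂ) (h : T (.a 2) v = v) :
    ∃ x1 x2 x3 x4 : ℂ, v = x1 • e1 + x2 • e2 + x3 • e3 + x4 • e4 := by
  obtain ⟨p0, p1, p2, p3, r0, r1, r2, r3, rfl⟩ : ∃ p0 p1 p2 p3 r0 r1 r2 r3,
    v = mk p0 p1 p2 p3 r0 r1 r2 r3 := ⟨_, _, _, _, _, _, _, _, eq_mk v⟩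
  rw [T_Z] at h
  obtain ⟨rfl, rfl, -, -, rfl, rfl, -, -⟩ := mk_inj h
  refine ⟨(p2 + p3 + r2 + r3) / 4, (p2 + p3 - r2 - r3) / 4,
    (p2 - p3 + r2 - r3) / 4, (p2 - p3 - r2 + r3) / 4, ?_⟩
  simp only [e1, e2, e3, e4, mk_smul, mk_add]
  congr 1 <;> ring

lemma minus_decomp (v : Q → ℂ) (h : T (.a 2) v = (-1 : ℂ) • v) :
    ∃ p1 p2 r1 r2 : ℂ, v = p1 • w11 + p2 • w12 + r1 • w21 + r2 • w22 := by
  obtain ⟨p0, p1, p2, p3, r0, r1, r2, r3, rfl⟩ : ∃ p0 p1 p2 p3 r0 r1 r2 r3,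
    v = mk p0 p1 p2 p3 r0 r1 r2 r3 := ⟨_, _, _, _, _, _, _, _, eq_mk v⟩
  rw [T_Z, mk_smul] at h
  obtain ⟨rfl, rfl, -, -, rfl, rfl, -, -⟩ := mk_inj h
  refine ⟨(p0 - Complex.I * p1) / 2, (r0 + Complex.I * r1) / 2,
    (-r0 + Complex.I * r1) / 2, (p0 + Complex.I * p1) / 2, ?_⟩
  simp only [w11, w12, w21, w22, mk_smul, mk_add]
  have := Complex.I_mul_I
  congr 1 <;> grind

/-- Symmetric bilinear form representing a homogeneous quadric. -/
lemma exists_matrix (q : MvPolynomial Q ℂ) (hq : q.IsHomogeneous 2) :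
    ∃ B : Matrix Q Q ℂ, ∀ v, eval v q = Matrix.toBilin' B v v := by
  have hd : ∀ d : Q →₀ ℕ, d ∈ q.support → ∃ B : Matrix Q Q ℂ, ∀ v,
      eval v (monomial d (q.coeff d)) = Matrix.toBilin' B v v := by
    intro d hdq
    have h2 : d.degree = 2 := by
      have := hq (mem_support_iff.mp hdq)
      rw [Finsupp.degree_eq_weight_one]; exact this
    obtain ⟨g, hg⟩ : ∃ g, d g ≠ 0 := by
      by_contra! h
      have : d = 0 := by ext g; exact h g
      simp [this] at h2
    have e1 : d = (d - Finsupp.single g 1) + Finsupp.single g 1 := by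
      ext k
      by_cases hk : g = k
      · subst hk; simp; omega
      · simp [hk]
    obtain ⟨k, hk⟩ : ∃ k, d - Finsupp.single g 1 = Finsupp.single k 1 := by
      have : (d - Finsupp.single g 1).degree = 1 := by
        have h3 := congrArg Finsupp.degree e1
        rw [map_add, Finsupp.degree_single, h2] at h3
        omega
      have h4 : d - Finsupp.single g 1 ∈ {d : Q →₀ ℕ | d.degree = 1} := this
      rw [← Finsupp.range_single_one] at h4
      obtain ⟨k, hk⟩ := h4
      exact ⟨k, hk.symm⟩
    rw [hk] at e1
    refine ⟨Matrix.single k g (q.coeff d), fun v => ?_⟩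
    rw [Matrix.toBilin'_apply]
    rw [eval_monomial, e1, Finsupp.prod_add_index' (by simp) (by intros; rw [pow_add])]
    simp only [Matrix.single_apply]
    rw [Finset.sum_eq_single k, Finset.sum_eq_single g]
    · simp; ring
    · intro b _ hb; simp [hb.symm]
    · simp
    · intro b _ hb; simp [hb.symm]
    · simp
  choose! B hB using hd
  refine ⟨∑ d ∈ q.support, B d, fun v => ?_⟩
  conv_lhs => rw [q.as_sum]
  simp only [map_sum, LinearMap.sum_apply]
  exact Finset.sum_congr rfl fun d hd => hB d hd v

/-- Evaluation at a point, as a linear polynomial in coefficients. -/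
noncomputable def E (i : Fin 4) (v : Q → ℂ) : MvPolynomial (Fin 4 × (Q →₀ ℕ)) ℂ :=
  ∑ d ∈ Finset.finsuppAntidiag (Finset.univ : Finset Q) 2, X (i, d) * C (∏ g, v g ^ d g)

lemma eval_E (q : Fin 4 → MvPolynomial Q ℂ) (i : Fin 4) (hq : (q i).IsHomogeneous 2)
    (v : Q → ℂ) : eval (fun x => (q x.1).coeff x.2) (E i v) = eval v (q i) := by
  rw [eval_eq' v, E, map_sum]
  simp only [map_mul, eval_X, eval_C]
  symm
  apply Finset.sum_subset
  · intro d hd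
    have := hq (mem_support_iff.mp hd)
    replace this : d.degree = 2 := by rw [Finsupp.degree_eq_weight_one]; exact this
    rw [Finset.mem_finsuppAntidiag]
    refine ⟨?_, Finset.subset_univ _⟩
    exact (Finsupp.degree_eq_sum d).symm.trans this
  · intro d _ hd
    rw [notMem_support_iff.mp hd, zero_mul]

/-- Polarization. -/
noncomputable def PE (i : Fin 4) (u w : Q → ℂ) : MvPolynomial (Fin 4 × (Q →₀ ℕ)) ℂ :=
  C (1 / 2) * (E i (u + w) - E i u - E i w)

lemma exists_bilin (q : MvPolynomial Q ℂ) (hq : q.IsHomogeneous 2) :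
    ∃ b : LinearMap.BilinForm ℂ (Q → ℂ), (∀ u w, b u w = b w u) ∧ (∀ v, eval v q = b v v) ∧
      ∀ u w, b u w = (1 / 2) * (eval (u + w) q - eval u q - eval w q) := by
  obtain ⟨B, hB⟩ := exists_matrix q hq
  set b := Matrix.toBilin' B
  refine ⟨(1 / 2 : ℂ) • (b + b.flip), fun u w => ?_, fun v => ?_, fun u w => ?_⟩
  · simp; ring
  · simp [hB]; ring
  · simp [hB]; ring

lemma equiv_bilin (q : MvPolynomial Q ℂ) (b : LinearMap.BilinForm ℂ (Q → ℂ)) (g : Q) (c : ℂ)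
    (hb : ∀ u w, b u w = (1 / 2) * (eval (u + w) q - eval u q - eval w q))
    (h : ∀ v : Q → ℂ, eval (fun h => v (g * h)) q = c * eval v q) (u w : Q → ℂ) :
    b (T g u) (T g w) = c * b u w := by
  rw [hb, hb, ← map_add]
  simp only [T_apply, h]
  ring

lemma kill {b x y : ℂ} (c : ℂ) (h : x * y * b = c * b) (hc : x * y ≠ c) : b = 0 := by
  by_contra hb
  exact hc (mul_right_cancel₀ hb h)

lemma killA {b : LinearMap.BilinForm ℂ (Q → ℂ)} {ε : ℂ}
    (hA : ∀ u w, b (T A u) (T A w) = ε * b u w) {u w : Q → ℂ} {x y : ℂ}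
    (hu : T A u = x • u) (hw : T A w = y • w) (hc : x * y ≠ ε) : b u w = 0 := by
  have := hA u w
  rw [hu, hw] at this
  simp only [map_smul, LinearMap.smul_apply, smul_eq_mul, ← mul_assoc] at this
  exact kill (x := x) (y := y) ε (by linear_combination this) hc

lemma killY {b : LinearMap.BilinForm ℂ (Q → ℂ)} {δ : ℂ}
    (hY : ∀ u w, b (T Y u) (T Y w) = δ * b u w) {u w : Q → ℂ} {x y : ℂ}
    (hu : T Y u = x • u) (hw : T Y w = y • w) (hc : x * y ≠ δ) : b u w = 0 := by
  have := hY u w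
  rw [hu, hw] at this
  simp only [map_smul, LinearMap.smul_apply, smul_eq_mul, ← mul_assoc] at this
  exact kill (x := x) (y := y) δ (by linear_combination this) hc

lemma expand (b : LinearMap.BilinForm ℂ (Q → ℂ)) (hs : ∀ u w, b u w = b w u)
    (u1 u2 u3 u4 : Q → ℂ) (x1 x2 x3 x4 : ℂ) :
    b (x1 • u1 + x2 • u2 + x3 • u3 + x4 • u4) (x1 • u1 + x2 • u2 + x3 • u3 + x4 • u4) =
    x1 ^ 2 * b u1 u1 + x2 ^ 2 * b u2 u2 + x3 ^ 2 * b u3 u3 + x4 ^ 2 * b u4 u4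
    + 2 * x1 * x2 * b u1 u2 + 2 * x1 * x3 * b u1 u3 + 2 * x1 * x4 * b u1 u4
    + 2 * x2 * x3 * b u2 u3 + 2 * x2 * x4 * b u2 u4 + 2 * x3 * x4 * b u3 u4 := by
  simp only [map_add, map_smul, LinearMap.add_apply, LinearMap.smul_apply, smul_eq_mul]
  rw [hs u2 u1, hs u3 u1, hs u4 u1, hs u3 u2, hs u4 u2, hs u4 u3]
  ring

lemma plus1 (b : LinearMap.BilinForm ℂ (Q → ℂ)) (hs : ∀ u w, b u w = b w u)
    (hA : ∀ u w, b (T A u) (T A w) = 1 * b u w)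
    (hY : ∀ u w, b (T Y u) (T Y w) = 1 * b u w) (x1 x2 x3 x4 : ℂ) :
    b (x1 • e1 + x2 • e2 + x3 • e3 + x4 • e4) (x1 • e1 + x2 • e2 + x3 • e3 + x4 • e4) =
    x1 ^ 2 * b e1 e1 + x2 ^ 2 * b e2 e2 + x3 ^ 2 * b e3 e3 + x4 ^ 2 * b e4 e4 := by
  rw [expand b hs, killY hY Ye1 Ye2 (by norm_num), killA hA Ae1 Ae3 (by norm_num),
    killA hA Ae1 Ae4 (by norm_num), killA hA Ae2 Ae3 (by norm_num),
    killA hA Ae2 Ae4 (by norm_num), killY hY Ye3 Ye4 (by norm_num)]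
  ring

lemma plus2 (b : LinearMap.BilinForm ℂ (Q → ℂ)) (hs : ∀ u w, b u w = b w u)
    (hA : ∀ u w, b (T A u) (T A w) = 1 * b u w)
    (hY : ∀ u w, b (T Y u) (T Y w) = (-1) * b u w) (x1 x2 x3 x4 : ℂ) :
    b (x1 • e1 + x2 • e2 + x3 • e3 + x4 • e4) (x1 • e1 + x2 • e2 + x3 • e3 + x4 • e4) =
    2 * (b e1 e2 * (x1 * x2) + b e3 e4 * (x3 * x4)) := by
  rw [expand b hs, killY hY Ye1 Ye1 (by norm_num), killY hY Ye2 Ye2 (by norm_num),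
    killY hY Ye3 Ye3 (by norm_num), killY hY Ye4 Ye4 (by norm_num),
    killA hA Ae1 Ae3 (by norm_num),
    killA hA Ae1 Ae4 (by norm_num), killA hA Ae2 Ae3 (by norm_num),
    killA hA Ae2 Ae4 (by norm_num)]
  ring

lemma plus3 (b : LinearMap.BilinForm ℂ (Q → ℂ)) (hs : ∀ u w, b u w = b w u)
    (hA : ∀ u w, b (T A u) (T A w) = (-1) * b u w)
    (hY : ∀ u w, b (T Y u) (T Y w) = 1 * b u w) (x1 x2 x3 x4 : ℂ) :
    b (x1 • e1 + x2 • e2 + x3 • e3 + x4 • e4) (x1 • e1 + x2 • e2 + x3 • e3 + x4 • e4) =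
    2 * (b e1 e3 * (x1 * x3) + b e2 e4 * (x2 * x4)) := by
  rw [expand b hs, killA hA Ae1 Ae1 (by norm_num), killA hA Ae2 Ae2 (by norm_num),
    killA hA Ae3 Ae3 (by norm_num), killA hA Ae4 Ae4 (by norm_num),
    killA hA Ae1 Ae2 (by norm_num),
    killY hY Ye1 Ye4 (by norm_num), killY hY Ye2 Ye3 (by norm_num),
    killA hA Ae3 Ae4 (by norm_num)]
  ring

lemma plus4 (b : LinearMap.BilinForm ℂ (Q → ℂ)) (hs : ∀ u w, b u w = b w u)
    (hA : ∀ u w, b (T A u) (T A w) = (-1) * b u w)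
    (hY : ∀ u w, b (T Y u) (T Y w) = (-1) * b u w) (x1 x2 x3 x4 : ℂ) :
    b (x1 • e1 + x2 • e2 + x3 • e3 + x4 • e4) (x1 • e1 + x2 • e2 + x3 • e3 + x4 • e4) =
    2 * (b e1 e4 * (x1 * x4) + b e2 e3 * (x2 * x3)) := by
  rw [expand b hs, killA hA Ae1 Ae1 (by norm_num), killA hA Ae2 Ae2 (by norm_num),
    killA hA Ae3 Ae3 (by norm_num), killA hA Ae4 Ae4 (by norm_num),
    killA hA Ae1 Ae2 (by norm_num),
    killY hY Ye1 Ye3 (by norm_num), killY hY Ye2 Ye4 (by norm_num),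
    killA hA Ae3 Ae4 (by norm_num)]
  ring

lemma minusA (b : LinearMap.BilinForm ℂ (Q → ℂ)) (hs : ∀ u w, b u w = b w u) (δ : ℂ)
    (hA : ∀ u w, b (T A u) (T A w) = 1 * b u w)
    (hY : ∀ u w, b (T Y u) (T Y w) = δ * b u w) (p1 p2 r1 r2 : ℂ) :
    b (p1 • w11 + p2 • w12 + r1 • w21 + r2 • w22) (p1 • w11 + p2 • w12 + r1 • w21 + r2 • w22) =
    2 * (b w11 w21 * (p1 * r1) + b w11 w22 * (p1 * r2) + b w12 w21 * (p2 * r1)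
      + b w12 w22 * (p2 * r2)) ∧
    b w11 w21 = - δ * b w11 w21 ∧ b w12 w22 = - δ * b w12 w22 ∧
    b w12 w21 = - δ * b w11 w22 := by
  refine ⟨?_, ?_, ?_, ?_⟩
  · rw [expand b hs, killA hA Aw11 Aw11 (by norm_num), killA hA Aw12 Aw12 (by norm_num),
      killA hA Aw21 Aw21 (by norm_num), killA hA Aw22 Aw22 (by norm_num),
      killA hA Aw11 Aw12 (by norm_num), killA hA Aw21 Aw22 (by norm_num)]
    ring
  · have := hY w11 w21
    rw [Yw11, Yw21, map_smul, hs, smul_eq_mul] at this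
    linear_combination -this
  · have := hY w12 w22
    rw [Yw12, Yw22, map_smul, hs, smul_eq_mul] at this
    linear_combination -this
  · have := hY w11 w22
    rw [Yw11, Yw22, map_smul, hs, smul_eq_mul] at this
    linear_combination -this

lemma minusB (b : LinearMap.BilinForm ℂ (Q → ℂ)) (hs : ∀ u w, b u w = b w u) (δ : ℂ)
    (hA : ∀ u w, b (T A u) (T A w) = (-1) * b u w)
    (hY : ∀ u w, b (T Y u) (T Y w) = δ * b u w) (p1 p2 r1 r2 : ℂ) :
    b (p1 • w11 + p2 • w12 + r1 • w21 + r2 • w22) (p1 • w11 + p2 • w12 + r1 • w21 + r2 • w22) =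
    (b w11 w11 * p1 ^ 2 + 2 * b w11 w12 * (p1 * p2) + b w12 w12 * p2 ^ 2) +
    δ * (b w11 w11 * r1 ^ 2 + 2 * b w11 w12 * (r1 * r2) + b w12 w12 * r2 ^ 2) := by
  rw [expand b hs, killA hA Aw11 Aw21 (by norm_num), killA hA Aw11 Aw22 (by norm_num),
    killA hA Aw12 Aw21 (by norm_num), killA hA Aw12 Aw22 (by norm_num)]
  have h1 := hY w11 w11
  have h2 := hY w11 w12
  have h3 := hY w12 w12
  rw [Yw11] at h1 h2
  rw [Yw12] at h2 h3
  rw [h1, h2, h3]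
  ring

lemma plus_alg (a b c d e f α1 α2 α3 α4 x1 x2 x3 x4 : ℂ)
    (ha : a ≠ 0) (hb : b ≠ 0) (hc : c ≠ 0) (hd : d ≠ 0) (he : e ≠ 0) (hf : f ≠ 0)
    (h1 : α1 ≠ 0) (h2 : α2 ≠ 0) (h3 : α3 ≠ 0) (h4 : α4 ≠ 0)
    (hD : α1 * (b * d * f) + α2 * (c * e * b) + α3 * (a * e * d) + α4 * (a * c * f) ≠ 0)
    (q1 : x1 ^ 2 * α1 + x2 ^ 2 * α2 + x3 ^ 2 * α3 + x4 ^ 2 * α4 = 0)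
    (q2 : a * (x1 * x2) + b * (x3 * x4) = 0)
    (q3 : c * (x1 * x3) + d * (x2 * x4) = 0)
    (q4 : e * (x1 * x4) + f * (x2 * x3) = 0) : x1 = 0 ∧ x2 = 0 ∧ x3 = 0 ∧ x4 = 0 := by
  by_cases z1 : x1 = 0
  · subst z1
    simp [hb, hd, hf] at q2 q3 q4
    rcases q2 with rfl | rfl
    · rcases q3 with rfl | rfl
      · simpa [h4] using q1
      · simpa [h2] using q1
    · rcases q4 with rfl | rfl
      · simpa [h3] using q1
      · simpa [h2] using q1
  by_cases z2 : x2 = 0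
  · subst z2
    simp [z1, hc, he] at q3 q4
    subst q3 q4
    simp [h1, z1] at q1
  by_cases z3 : x3 = 0
  · subst z3
    simp [z1, z2, ha] at q2
  by_cases z4 : x4 = 0
  · subst z4
    simp [z1, z2, ha] at q2
  exfalso
  apply hD
  have k4 : a * c * x1 ^ 2 = b * d * x4 ^ 2 := by
    apply mul_right_cancel₀ (mul_ne_zero z2 z3)
    linear_combination (c * x1 * x3) * q2 - (b * x3 * x4) * q3
  have k3 : a * e * x1 ^ 2 = b * f * x3 ^ 2 := by
    apply mul_right_cancel₀ (mul_ne_zero z2 z4)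
    linear_combination (e * x1 * x4) * q2 - (b * x3 * x4) * q4
  have k2 : c * e * x1 ^ 2 = d * f * x2 ^ 2 := by
    apply mul_right_cancel₀ (mul_ne_zero z3 z4)
    linear_combination (e * x1 * x4) * q3 - (d * x2 * x4) * q4
  apply mul_right_cancel₀ (pow_ne_zero 2 z1)
  linear_combination (b * d * f) * q1 + α2 * b * k2 + α3 * d * k3 + α4 * f * k4

lemma res_alg {A B C A' B' C' x y : ℂ}
    (hR : (A * C' - A' * C) ^ 2 - (A * B' - A' * B) * (B * C' - B' * C) ≠ 0)
    (h : A * x ^ 2 + B * (x * y) + C * y ^ 2 = 0)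
    (h' : A' * x ^ 2 + B' * (x * y) + C' * y ^ 2 = 0) : x = 0 ∧ y = 0 := by
  have k1 : y * ((A * B' - A' * B) * x + (A * C' - A' * C) * y) = 0 := by
    linear_combination A * h' - A' * h
  have k2 : x * ((A * C' - A' * C) * x + (B * C' - B' * C) * y) = 0 := by
    linear_combination C' * h - C * h'
  by_cases hx : x = 0
  · refine ⟨hx, ?_⟩
    by_contra hy
    subst hx
    simp [hy] at h h'
    apply hR; rw [h, h']; ring
  · exfalso
    by_cases hy : y = 0
    · subst hy
      simp [hx] at h h'
      apply hR; rw [h, h']; ring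
    · have l1 := (mul_eq_zero.mp k1).resolve_left hy
      have l2 := (mul_eq_zero.mp k2).resolve_left hx
      apply hR
      apply mul_right_cancel₀ hx
      linear_combination (A * C' - A' * C) * l2 - (B * C' - B' * C) * l1

lemma sqs {x y : ℂ} (h1 : x ^ 2 + y ^ 2 = 0) (h2 : x ^ 2 - y ^ 2 = 0) : x = 0 ∧ y = 0 := by
  have hx : x ^ 2 = 0 := by linear_combination (h1 + h2) / 2
  have hy : y ^ 2 = 0 := by linear_combination (h1 - h2) / 2
  exact ⟨by simpa using hx, by simpa using hy⟩

lemma sqs' {x y : ℂ} (h1 : x * y = 0) (h2 : x ^ 2 + y ^ 2 = 0) : x = 0 ∧ y = 0 := by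
  rcases mul_eq_zero.mp h1 with rfl | rfl <;> simpa using h2

lemma sqs'' {x y : ℂ} (h1 : x * y = 0) (h2 : x ^ 2 - y ^ 2 = 0) : x = 0 ∧ y = 0 := by
  rcases mul_eq_zero.mp h1 with rfl | rfl <;> simpa using h2

lemma minus_alg (β A2 B2 C2 A3 B3 C3 A4 B4 C4 p1 p2 r1 r2 : ℂ) (hβ : β ≠ 0)
    (h23 : (A2 * C3 - A3 * C2) ^ 2 - (A2 * B3 - A3 * B2) * (B2 * C3 - B3 * C2) ≠ 0)
    (h24 : (A2 * C4 - A4 * C2) ^ 2 - (A2 * B4 - A4 * B2) * (B2 * C4 - B4 * C2) ≠ 0)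
    (h34 : (A3 * C4 - A4 * C3) ^ 2 - (A3 * B4 - A4 * B3) * (B3 * C4 - B4 * C3) ≠ 0)
    (q1 : β * (p1 * r2 - p2 * r1) = 0)
    (q2 : 2 * (A2 * (p1 * r1) + C2 * (p2 * r2)) + B2 * (p1 * r2 + p2 * r1) = 0)
    (q3 : (A3 * p1 ^ 2 + B3 * (p1 * p2) + C3 * p2 ^ 2) +
      1 * (A3 * r1 ^ 2 + B3 * (r1 * r2) + C3 * r2 ^ 2) = 0)
    (q4 : (A4 * p1 ^ 2 + B4 * (p1 * p2) + C4 * p2 ^ 2) +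
      (-1) * (A4 * r1 ^ 2 + B4 * (r1 * r2) + C4 * r2 ^ 2) = 0) :
    p1 = 0 ∧ p2 = 0 ∧ r1 = 0 ∧ r2 = 0 := by
  have q1' : p1 * r2 - p2 * r1 = 0 := by simpa [hβ] using q1
  obtain ⟨x, y, c1, c2, rfl, rfl, rfl, rfl⟩ : ∃ x y c1 c2 : ℂ,
      p1 = x * c1 ∧ p2 = x * c2 ∧ r1 = y * c1 ∧ r2 = y * c2 := by
    by_cases h1 : p1 = 0
    · by_cases h2 : p2 = 0
      · exact ⟨0, 1, r1, r2, by simp [h1], by simp [h2], by simp, by simp⟩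
      · refine ⟨1, r2 / p2, p1, p2, by simp, by simp, ?_, ?_⟩
        · field_simp; linear_combination -q1'
        · field_simp
    · refine ⟨1, r1 / p1, p1, p2, by simp, by simp, ?_, ?_⟩
      · field_simp
      · field_simp; linear_combination q1'
  have e2 : (x * y) * (A2 * c1 ^ 2 + B2 * (c1 * c2) + C2 * c2 ^ 2) = 0 := by
    linear_combination q2 / 2
  have e3 : (x ^ 2 + y ^ 2) * (A3 * c1 ^ 2 + B3 * (c1 * c2) + C3 * c2 ^ 2) = 0 := by
    linear_combination q3
  have e4 : (x ^ 2 - y ^ 2) * (A4 * c1 ^ 2 + B4 * (c1 * c2) + C4 * c2 ^ 2) = 0 := by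
    linear_combination q4
  have key : (x = 0 ∧ y = 0) ∨ (c1 = 0 ∧ c2 = 0) := by
    rcases mul_eq_zero.mp e2 with f2 | f2
    · rcases mul_eq_zero.mp e3 with f3 | f3
      · left; exact sqs' f2 f3
      · rcases mul_eq_zero.mp e4 with f4 | f4
        · left; exact sqs'' f2 f4
        · right; exact res_alg h34 f3 f4
    · rcases mul_eq_zero.mp e3 with f3 | f3
      · rcases mul_eq_zero.mp e4 with f4 | f4
        · left; exact sqs f3 f4
        · right; exact res_alg h24 f2 f4
      · right; exact res_alg h23 f2 f3
  rcases key with ⟨rfl, rfl⟩ | ⟨rfl, rfl⟩ <;> simp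

/-- The discriminant-type expression whose nonvanishing is the genericity condition. -/
def disc {R : Type*} [CommRing R] (F : Fin 4 → (Q → ℂ) → (Q → ℂ) → R) (i1 i2 i3 i4 : Fin 4) : R :=
  let res : R → R → R → R → R → R → R := fun A B C A' B' C' =>
    (A * C' - A' * C) ^ 2 - (A * B' - A' * B) * (B * C' - B' * C)
  (F i2 e1 e2 * F i2 e3 e4 * F i3 e1 e3 * F i3 e2 e4 * F i4 e1 e4 * F i4 e2 e3) *
  (F i1 e1 e1 * F i1 e2 e2 * F i1 e3 e3 * F i1 e4 e4) *
  (F i1 e1 e1 * (F i2 e3 e4 * F i3 e2 e4 * F i4 e2 e3) +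
    F i1 e2 e2 * (F i3 e1 e3 * F i4 e1 e4 * F i2 e3 e4) +
    F i1 e3 e3 * (F i2 e1 e2 * F i4 e1 e4 * F i3 e2 e4) +
    F i1 e4 e4 * (F i2 e1 e2 * F i3 e1 e3 * F i4 e2 e3)) *
  F i1 w11 w22 *
  res (F i2 w11 w21) (2 * F i2 w11 w22) (F i2 w12 w22)
    (F i3 w11 w11) (2 * F i3 w11 w12) (F i3 w12 w12) *
  res (F i2 w11 w21) (2 * F i2 w11 w22) (F i2 w12 w22)
    (F i4 w11 w11) (2 * F i4 w11 w12) (F i4 w12 w12) *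
  res (F i3 w11 w11) (2 * F i3 w11 w12) (F i3 w12 w12)
    (F i4 w11 w11) (2 * F i4 w11 w12) (F i4 w12 w12)

lemma eval_disc (x : Fin 4 × (Q →₀ ℕ) → ℂ) (i1 i2 i3 i4 : Fin 4) :
    eval x (disc PE i1 i2 i3 i4) = disc (fun i u w => eval x (PE i u w)) i1 i2 i3 i4 := by
  simp only [disc, map_mul, map_add, map_sub, map_pow, map_ofNat]

lemma eval_PE (q : Fin 4 → MvPolynomial Q ℂ) (i : Fin 4) (hq : (q i).IsHomogeneous 2)
    (u w : Q → ℂ) : eval (fun x => (q x.1).coeff x.2) (PE i u w) =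
      (1 / 2) * (eval (u + w) (q i) - eval u (q i) - eval w (q i)) := by
  simp only [PE, map_mul, map_sub, eval_E q i hq, eval_C]

/-- Main freeness argument. -/
lemma no_fixed (b : Fin 4 → LinearMap.BilinForm ℂ (Q → ℂ)) (i1 i2 i3 i4 : Fin 4)
    (hs : ∀ i u w, b i u w = b i w u)
    (hA1 : ∀ u w, b i1 (T A u) (T A w) = 1 * b i1 u w)
    (hY1 : ∀ u w, b i1 (T Y u) (T Y w) = 1 * b i1 u w)
    (hA2 : ∀ u w, b i2 (T A u) (T A w) = 1 * b i2 u w)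
    (hY2 : ∀ u w, b i2 (T Y u) (T Y w) = (-1) * b i2 u w)
    (hA3 : ∀ u w, b i3 (T A u) (T A w) = (-1) * b i3 u w)
    (hY3 : ∀ u w, b i3 (T Y u) (T Y w) = 1 * b i3 u w)
    (hA4 : ∀ u w, b i4 (T A u) (T A w) = (-1) * b i4 u w)
    (hY4 : ∀ u w, b i4 (T Y u) (T Y w) = (-1) * b i4 u w)
    (hD : disc (fun i u w => b i u w) i1 i2 i3 i4 ≠ 0)
    (v : Q → ℂ) (hv : ∀ i, b i v v = 0) (c : ℂ) (hc : T (.a 2) v = c • v) : v = 0 := by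
  by_contra hv0
  simp only [disc, mul_ne_zero_iff] at hD
  obtain ⟨⟨⟨⟨⟨⟨⟨⟨⟨⟨⟨ha, hb⟩, hc'⟩, hd⟩, he⟩, hf⟩, ⟨⟨h1, h2⟩, h3⟩, h4⟩, hDD⟩, hβ⟩, h23⟩, h24⟩, h34⟩ := hD
  have hcc : c * c = 1 := by
    have h5 : T (.a 2) (T (.a 2) v) = v := by
      rw [← T_mul]
      have : (QuaternionGroup.a 2 * QuaternionGroup.a 2 : Q) = 1 := by decide
      rw [this]; ext h; simp [T_apply]
    rw [hc, map_smul, hc, smul_smul] at h5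
    have h6 : (c * c - 1) • v = 0 := by rw [sub_smul, h5, one_smul, sub_self]
    rcases smul_eq_zero.mp h6 with h | h
    · linear_combination h
    · exact absurd h hv0
  rcases mul_self_eq_one_iff.mp hcc with rfl | rfl
  · rw [one_smul] at hc
    obtain ⟨x1, x2, x3, x4, rfl⟩ := plus_decomp v hc
    have q1 := hv i1
    have q2 := hv i2
    have q3 := hv i3
    have q4 := hv i4
    rw [plus1 _ (hs i1) hA1 hY1] at q1
    rw [plus2 _ (hs i2) hA2 hY2] at q2
    rw [plus3 _ (hs i3) hA3 hY3] at q3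
    rw [plus4 _ (hs i4) hA4 hY4] at q4
    have two : (2 : ℂ) ≠ 0 := two_ne_zero
    obtain ⟨rfl, rfl, rfl, rfl⟩ := plus_alg _ _ _ _ _ _ _ _ _ _ x1 x2 x3 x4
      ha hb hc' hd he hf h1 h2 h3 h4 hDD q1 ((mul_eq_zero.mp q2).resolve_left two)
      ((mul_eq_zero.mp q3).resolve_left two) ((mul_eq_zero.mp q4).resolve_left two)
    simp at hv0
  · obtain ⟨p1, p2, r1, r2, rfl⟩ := minus_decomp v hc
    have q1 := hv i1
    have q2 := hv i2
    have q3 := hv i3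
    have q4 := hv i4
    obtain ⟨m1, m2, m3, m4⟩ := minusA _ (hs i1) _ hA1 hY1 p1 p2 r1 r2
    obtain ⟨n1, n2, n3, n4⟩ := minusA _ (hs i2) _ hA2 hY2 p1 p2 r1 r2
    rw [m1] at q1
    rw [n1] at q2
    rw [minusB _ (hs i3) _ hA3 hY3] at q3
    rw [minusB _ (hs i4) _ hA4 hY4] at q4
    have m2' : b i1 w11 w21 = 0 := by linear_combination m2 / 2
    have m3' : b i1 w12 w22 = 0 := by linear_combination m3 / 2
    obtain ⟨rfl, rfl, rfl, rfl⟩ := minus_alg _ _ _ _ _ _ _ _ _ _ p1 p2 r1 r2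
      hβ h23 h24 h34
      (by rw [m2', m3', m4] at q1; linear_combination q1 / 2)
      (by rw [n4] at q2; linear_combination q2) q3 q4
    simp at hv0

lemma pow_z (k : Q) (hk : k ≠ 1) : k = .a 2 ∨ k * k = .a 2 := by
  revert k; decide

/-! Explicit generic quadrics -/

noncomputable def LP (c : Q → ℂ) : MvPolynomial Q ℂ := ∑ g, C (c g) * X g
noncomputable def ell (c v : Q → ℂ) : ℂ := ∑ g, c g * v g

lemma eval_LP (c v : Q → ℂ) : eval v (LP c) = ell c v := by simp [LP, ell]

lemma hom_LP (c : Q → ℂ) : (LP c).IsHomogeneous 1 :=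
  IsHomogeneous.sum _ _ _ fun g _ => by
    simpa using (isHomogeneous_C Q (c g)).mul (isHomogeneous_X ℂ g)

lemma hom_LL (c d : Q → ℂ) : (LP c * LP d).IsHomogeneous 2 := (hom_LP c).mul (hom_LP d)

/-- `Q₈` as a sum type. -/
def sumEquiv : ZMod (2 * 2) ⊕ ZMod (2 * 2) ≃ Q where
  toFun
    | Sum.inl j => .a j
    | Sum.inr j => .xa j
  invFun
    | .a j => Sum.inl j
    | .xa j => Sum.inr j
  left_inv := by rintro (_ | _) <;> rfl
  right_inv := by rintro (_ | _) <;> rfl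

lemma ell_mk (p0 p1 p2 p3 r0 r1 r2 r3 p0' p1' p2' p3' r0' r1' r2' r3' : ℂ) :
    ell (mk p0 p1 p2 p3 r0 r1 r2 r3) (mk p0' p1' p2' p3' r0' r1' r2' r3') =
      p0 * p0' + p1 * p1' + p2 * p2' + p3 * p3' + r0 * r0' + r1 * r1' + r2 * r2' + r3 * r3' := by
  rw [ell, ← Equiv.sum_comp sumEquiv, Fintype.sum_sum_type]
  have h4 : ∀ f : ZMod (2 * 2) → ℂ, ∑ j, f j = f 0 + f 1 + f 2 + f 3 :=
    fun f => Fin.sum_univ_four (f : Fin 4 → ℂ)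
  rw [h4, h4, ← add_assoc, ← add_assoc, ← add_assoc]
  rfl

lemma ell_add (c u w : Q → ℂ) : ell c (u + w) = ell c u + ell c w := by
  simp [ell, mul_add, Finset.sum_add_distrib]

noncomputable def Qp : Bool × Bool → MvPolynomial Q ℂ
  | (true, true) => LP e1 * LP e1 + LP e2 * LP e2 + LP e3 * LP e3 + LP e4 * LP e4 +
      (LP w22 * LP w11 - LP w21 * LP w12)
  | (true, false) => LP e1 * LP e2 + LP e3 * LP e4 + (LP w22 * LP w11 + LP w21 * LP w12)
  | (false, true) => LP e1 * LP e3 + LP e2 * LP e4 + (LP w22 * LP w22 + LP w21 * LP w21)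
      + (LP w12 * LP w12 + LP w11 * LP w11)
  | (false, false) => LP e1 * LP e4 + LP e2 * LP e3 + (LP w22 * LP w22 - LP w21 * LP w21)
      - (LP w12 * LP w12 - LP w11 * LP w11)

lemma hom_Qp (s : Bool × Bool) : (Qp s).IsHomogeneous 2 := by
  rcases s with ⟨_ | _, _ | _⟩ <;> simp only [Qp] <;>
  · repeat' first
      | exact hom_LL _ _
      | apply IsHomogeneous.add
      | apply IsHomogeneous.sub

def sg (b : Bool) : ℂ := if b then 1 else -1

lemma ellA (v : Q → ℂ) :
    ell e1 (T A v) = ell e1 v ∧ ell e2 (T A v) = ell e2 v ∧ ell e3 (T A v) = - ell e3 v ∧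
    ell e4 (T A v) = - ell e4 v ∧ ell w22 (T A v) = Complex.I * ell w22 v ∧
    ell w21 (T A v) = Complex.I * ell w21 v ∧ ell w12 (T A v) = -Complex.I * ell w12 v ∧
    ell w11 (T A v) = -Complex.I * ell w11 v := by
  rw [eq_mk v, T_A]
  simp only [e1, e2, e3, e4, w11, w12, w21, w22, ell_mk]
  have := Complex.I_mul_I
  refine ⟨?_, ?_, ?_, ?_, ?_, ?_, ?_, ?_⟩ <;> ring_nf <;> simp only [Complex.I_sq] <;> ring

lemma ellY (v : Q → ℂ) :
    ell e1 (T Y v) = ell e1 v ∧ ell e2 (T Y v) = - ell e2 v ∧ ell e3 (T Y v) = ell e3 v ∧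
    ell e4 (T Y v) = - ell e4 v ∧ ell w22 (T Y v) = ell w12 v ∧
    ell w21 (T Y v) = ell w11 v ∧ ell w12 (T Y v) = - ell w22 v ∧
    ell w11 (T Y v) = - ell w21 v := by
  rw [eq_mk v, T_Y]
  simp only [e1, e2, e3, e4, w11, w12, w21, w22, ell_mk]
  refine ⟨?_, ?_, ?_, ?_, ?_, ?_, ?_, ?_⟩ <;> ring

lemma QpA (s : Bool × Bool) (v : Q → ℂ) : eval (T A v) (Qp s) = sg s.1 * eval v (Qp s) := by
  obtain ⟨h1, h2, h3, h4, h5, h6, h7, h8⟩ := ellA v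
  rcases s with ⟨_ | _, _ | _⟩ <;>
  simp only [Qp, map_add, map_sub, map_mul, eval_LP, h1, h2, h3, h4, h5, h6, h7, h8, sg] <;>
  ring_nf <;> simp only [Complex.I_sq] <;> simp <;> ring

lemma QpY (s : Bool × Bool) (v : Q → ℂ) : eval (T Y v) (Qp s) = sg s.2 * eval v (Qp s) := by
  obtain ⟨h1, h2, h3, h4, h5, h6, h7, h8⟩ := ellY v
  rcases s with ⟨_ | _, _ | _⟩ <;>
  simp only [Qp, map_add, map_sub, map_mul, eval_LP, h1, h2, h3, h4, h5, h6, h7, h8, sg] <;>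
  simp <;> ring

lemma gen_ind (S : Q → Prop) (h1 : S 1) (hA : S A) (hY : S Y)
    (hm : ∀ g k, S g → S k → S (g * k)) : ∀ g, S g := by
  have ha : ∀ j : ZMod (2 * 2), S (.a j) := by
    intro j
    change Fin 4 at j
    fin_cases j
    · exact h1
    · exact hA
    · exact hm A A hA hA
    · exact hm (A * A) A (hm A A hA hA) hA
  intro g
  rcases g with j | j
  · exact ha j
  · have := hm Y (.a j) hY (ha j)
    rwa [QuaternionGroup.xa_mul_a, zero_add] at this

lemma equiv_all (χ : Q →* ℂ) (q : MvPolynomial Q ℂ)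
    (hA : ∀ v, eval (T A v) q = χ A * eval v q) (hY : ∀ v, eval (T Y v) q = χ Y * eval v q) :
    ∀ g v, eval (T g v) q = χ g * eval v q := by
  apply gen_ind
  · intro v
    have : T 1 v = v := by ext; simp [T_apply]
    rw [this, map_one, one_mul]
  · exact hA
  · exact hY
  · intro g k hg hk v
    rw [T_mul, hk, hg, map_mul]; ring

lemma char_ext (χ ψ : Q →* ℂ) (hA : χ A = ψ A) (hY : χ Y = ψ Y) : χ = ψ := by
  ext g
  revert g
  apply gen_ind
  · simp
  · exact hA
  · exact hY
  · intro g k hg hk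
    rw [map_mul, map_mul, hg, hk]

lemma char_vals (χ : Q →* ℂ) : (χ A = 1 ∨ χ A = -1) ∧ (χ Y = 1 ∨ χ Y = -1) := by
  have r1 : (A * Y * A : Q) = Y := by decide
  have r2 : (Y * Y : Q) = A * A := by decide
  have r3 : (A * A * A * A : Q) = 1 := by decide
  have s1 := congrArg χ r1
  have s2 := congrArg χ r2
  have s3 := congrArg χ r3
  simp only [map_mul, map_one] at s1 s2 s3
  have hY0 : χ Y ≠ 0 := by
    intro h
    rw [h, zero_mul] at s2
    rw [← s2] at s3
    simp at s3
  have hAA : χ A * χ A = 1 := by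
    apply mul_right_cancel₀ hY0
    linear_combination s1
  exact ⟨mul_self_eq_one_iff.mp hAA, mul_self_eq_one_iff.mp (s2.trans hAA)⟩

open Classical in
/-- The signs of a character. -/
noncomputable def sgn (χ : Q →* ℂ) : Bool × Bool := (decide (χ A = 1), decide (χ Y = 1))

lemma sg_A (χ : Q →* ℂ) : χ A = sg (sgn χ).1 := by
  rcases (char_vals χ).1 with h | h <;> simp only [sgn, sg, h] <;> norm_num

lemma sg_Y (χ : Q →* ℂ) : χ Y = sg (sgn χ).2 := by
  rcases (char_vals χ).2 with h | h <;> simp only [sgn, sg, h] <;> norm_num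

lemma sgn_inj : Function.Injective sgn := by
  intro χ ψ h
  apply char_ext
  · rw [sg_A, sg_A, h]
  · rw [sg_Y, sg_Y, h]

lemma tab (u : Q → ℂ) (h : u = e1 ∨ u = e2 ∨ u = e3 ∨ u = e4) :
    ell w11 u = 0 ∧ ell w12 u = 0 ∧ ell w21 u = 0 ∧ ell w22 u = 0 := by
  rcases h with rfl | rfl | rfl | rfl <;>
  simp only [e1, e2, e3, e4, w11, w12, w21, w22, ell_mk] <;>
  refine ⟨?_, ?_, ?_, ?_⟩ <;> ring

lemma tab' (u : Q → ℂ) (h : u = w11 ∨ u = w12 ∨ u = w21 ∨ u = w22) :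
    ell e1 u = 0 ∧ ell e2 u = 0 ∧ ell e3 u = 0 ∧ ell e4 u = 0 := by
  rcases h with rfl | rfl | rfl | rfl <;>
  simp only [e1, e2, e3, e4, w11, w12, w21, w22, ell_mk] <;>
  refine ⟨?_, ?_, ?_, ?_⟩ <;> ring

lemma tab1 : ell e1 e1 = 8 ∧ ell e2 e1 = 0 ∧ ell e3 e1 = 0 ∧ ell e4 e1 = 0 := by
  simp only [e1, e2, e3, e4, ell_mk]; norm_num
lemma tab2 : ell e1 e2 = 0 ∧ ell e2 e2 = 8 ∧ ell e3 e2 = 0 ∧ ell e4 e2 = 0 := by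
  simp only [e1, e2, e3, e4, ell_mk]; norm_num
lemma tab3 : ell e1 e3 = 0 ∧ ell e2 e3 = 0 ∧ ell e3 e3 = 8 ∧ ell e4 e3 = 0 := by
  simp only [e1, e2, e3, e4, ell_mk]; norm_num
lemma tab4 : ell e1 e4 = 0 ∧ ell e2 e4 = 0 ∧ ell e3 e4 = 0 ∧ ell e4 e4 = 8 := by
  simp only [e1, e2, e3, e4, ell_mk]; norm_num
lemma tab11 : ell w22 w11 = 4 ∧ ell w21 w11 = 0 ∧ ell w12 w11 = 0 ∧ ell w11 w11 = 0 := by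
  simp only [w11, w12, w21, w22, ell_mk]; norm_num
lemma tab12 : ell w22 w12 = 0 ∧ ell w21 w12 = -4 ∧ ell w12 w12 = 0 ∧ ell w11 w12 = 0 := by
  simp only [w11, w12, w21, w22, ell_mk]; norm_num
lemma tab21 : ell w22 w21 = 0 ∧ ell w21 w21 = 0 ∧ ell w12 w21 = -4 ∧ ell w11 w21 = 0 := by
  simp only [w11, w12, w21, w22, ell_mk]; norm_num
lemma tab22 : ell w22 w22 = 0 ∧ ell w21 w22 = 0 ∧ ell w12 w22 = 0 ∧ ell w11 w22 = 4 := by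
  simp only [w11, w12, w21, w22, ell_mk]; norm_num

lemma disc_q0 (F : Fin 4 → (Q → ℂ) → (Q → ℂ) → ℂ) (s : Fin 4 → Bool × Bool)
    (hF : ∀ i u w, F i u w =
      (1 / 2) * (eval (u + w) (Qp (s i)) - eval u (Qp (s i)) - eval w (Qp (s i))))
    (i1 i2 i3 i4 : Fin 4) (h1 : s i1 = (true, true)) (h2 : s i2 = (true, false))
    (h3 : s i3 = (false, true)) (h4 : s i4 = (false, false)) :
    disc F i1 i2 i3 i4 ≠ 0 := by
  obtain ⟨a1, a2, a3, a4⟩ := tab e1 (by simp)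
  obtain ⟨b1, b2, b3, b4⟩ := tab e2 (by simp)
  obtain ⟨c1, c2, c3, c4⟩ := tab e3 (by simp)
  obtain ⟨d1, d2, d3, d4⟩ := tab e4 (by simp)
  obtain ⟨k1, k2, k3, k4⟩ := tab' w11 (by simp)
  obtain ⟨l1, l2, l3, l4⟩ := tab' w12 (by simp)
  obtain ⟨m1, m2, m3, m4⟩ := tab' w21 (by simp)
  obtain ⟨n1, n2, n3, n4⟩ := tab' w22 (by simp)
  simp only [disc, hF, h1, h2, h3, h4, Qp, map_add, map_sub, map_mul, eval_LP, ell_add,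
    a1, a2, a3, a4, b1, b2, b3, b4, c1, c2, c3, c4, d1, d2, d3, d4, k1, k2, k3, k4,
    l1, l2, l3, l4, m1, m2, m3, m4, n1, n2, n3, n4, tab1, tab2, tab3, tab4, tab11, tab12,
    tab21, tab22]
  norm_num

end BQ8

open BQ8

/-- **Beauville's example.** Let `V = ℂ[Q₈]` be the regular representation of the
quaternion group `Q₈` (functions `Q₈ → ℂ`, with `(g • v) h = v (g⁻¹ h)`), and let
`χ₁, …, χ₄` be the four distinct one-dimensional irreducible characters of `Q₈`.
For each `i` pick a quadric `qᵢ` in the `Vᵢ`-isotypic component of `Sym²(V*)`, i.e. a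
homogeneous polynomial of degree 2 on `V` transforming under `Q₈` by the character `χᵢ`.
Then, for a generic such choice of `q₁, …, q₄` (genericity being expressed by the
nonvanishing of a nonzero polynomial `P` in the coefficients of the `qᵢ`, which does not
identically vanish on the space of admissible choices), `Q₈` acts freely on the complete
intersection `X = {q₁ = q₂ = q₃ = q₄ = 0} ⊆ ℙ(V)`: no non-identity element of `Q₈` has a
fixed point on `X`. -/
theorem beauville_Q8_free_action
    (χ : Fin 4 → (QuaternionGroup 2 →* ℂ)) (hχ : Function.Injective χ) :
    ∃ P : MvPolynomial (Fin 4 × (QuaternionGroup 2 →₀ ℕ)) ℂ,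
      P ≠ 0 ∧
      (∃ q₀ : Fin 4 → MvPolynomial (QuaternionGroup 2) ℂ,
        (∀ i, (q₀ i).IsHomogeneous 2) ∧
        (∀ i (g : QuaternionGroup 2) (v : QuaternionGroup 2 → ℂ),
          eval (fun h => v (g * h)) (q₀ i) = χ i g * eval v (q₀ i)) ∧
        eval (fun x => (q₀ x.1).coeff x.2) P ≠ 0) ∧
      ∀ q : Fin 4 → MvPolynomial (QuaternionGroup 2) ℂ,
        (∀ i, (q i).IsHomogeneous 2) →
        (∀ i (g : QuaternionGroup 2) (v : QuaternionGroup 2 → ℂ),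
          eval (fun h => v (g * h)) (q i) = χ i g * eval v (q i)) →
        eval (fun x => (q x.1).coeff x.2) P ≠ 0 →
        ∀ g : QuaternionGroup 2, g ≠ 1 →
          ∀ v : QuaternionGroup 2 → ℂ, v ≠ 0 → (∀ i, eval v (q i) = 0) →
            ¬ ∃ c : ℂ, (fun h => v (g⁻¹ * h)) = c • v := by
  have hsb : Function.Bijective (fun i => sgn (χ i)) := by
    rw [Fintype.bijective_iff_injective_and_card]
    exact ⟨sgn_inj.comp hχ, by simp⟩
  obtain ⟨i1, h1⟩ := hsb.2 (true, true)
  obtain ⟨i2, h2⟩ := hsb.2 (true, false)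
  obtain ⟨i3, h3⟩ := hsb.2 (false, true)
  obtain ⟨i4, h4⟩ := hsb.2 (false, false)
  have hne : eval (fun x : Fin 4 × (Q →₀ ℕ) => (Qp (sgn (χ x.1))).coeff x.2)
      (disc PE i1 i2 i3 i4) ≠ 0 := by
    rw [eval_disc]
    exact disc_q0 _ (fun i => sgn (χ i))
      (fun i u w => eval_PE (fun i => Qp (sgn (χ i))) i (hom_Qp _) u w) i1 i2 i3 i4 h1 h2 h3 h4
  refine ⟨disc PE i1 i2 i3 i4, ?_, ⟨fun i => Qp (sgn (χ i)), fun i => hom_Qp _, ?_, hne⟩, ?_⟩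
  · intro h0
    rw [h0] at hne
    simp at hne
  · intro i g v
    refine equiv_all (χ i) _ (fun v => ?_) (fun v => ?_) g v
    · rw [QpA, ← sg_A]
    · rw [QpY, ← sg_Y]
  · intro q hq hequiv hP g hg v hv hqv
    rintro ⟨c, hc⟩
    choose b hb1 hb2 hb3 using fun i => exists_bilin (q i) (hq i)
    have hA : ∀ i u w, b i (T A u) (T A w) = sg (sgn (χ i)).1 * b i u w := fun i u w => by
      rw [← sg_A]
      exact equiv_bilin (q i) (b i) A _ (hb3 i) (hequiv i A) u w
    have hY : ∀ i u w, b i (T Y u) (T Y w) = sg (sgn (χ i)).2 * b i u w := fun i u w => by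
      rw [← sg_Y]
      exact equiv_bilin (q i) (b i) Y _ (hb3 i) (hequiv i Y) u w
    simp only at h1 h2 h3 h4
    have hD : disc (fun i u w => b i u w) i1 i2 i3 i4 ≠ 0 := by
      rw [eval_disc] at hP
      convert hP using 5 with i u w
      rw [eval_PE q i (hq i), hb3]
    obtain ⟨c', hc'⟩ : ∃ c' : ℂ, T (.a 2) v = c' • v := by
      have hT : T g⁻¹ v = c • v := hc
      rcases pow_z g⁻¹ (by simpa using hg) with h | h
      · exact ⟨c, by rw [← h, hT]⟩
      · exact ⟨c * c, by rw [← h, T_mul, hT, map_smul, hT, smul_smul]⟩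
    have hA1 := hA i1
    have hA2 := hA i2
    have hA3 := hA i3
    have hA4 := hA i4
    have hY1 := hY i1
    have hY2 := hY i2
    have hY3 := hY i3
    have hY4 := hY i4
    rw [h1] at hA1 hY1
    rw [h2] at hA2 hY2
    rw [h3] at hA3 hY3
    rw [h4] at hA4 hY4
    exact hv (no_fixed b i1 i2 i3 i4 hb1 hA1 hY1 hA2 hY2 hA3 hY3 hA4 hY4 hD v
      (fun i => by rw [← hb2, hqv]) c' hc')
end

section
/- For each of the eight index sets μ ∈ {(1468), (1367), (1457), (2467), (2357), (2458), (1358), (2368)} ⊆ {1,...,8}, the system of quadrics q₁ = q₂ = q₃ = q₄ = 0 (from the family in Theorem p11), restricted to the coordinate subspace {xᵢ = 0 : i ∈ μ}, has exactly 8 solutions in ℙ⁷ for generic parameters; hence X has exactly 64 such singular points. -/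
open MvPolynomial

/-- The four quadrics `q₁, q₂, q₃, q₄` of the two-parameter family (Theorem p11),
in variables `x₁, …, x₈` (indexed `X 0, …, X 7`). -/
noncomputable def qfam (t₁ t₂ s₁ s₂ : ℂ) : Fin 4 → MvPolynomial (Fin 8) ℂ :=
  ![C t₁ * (X 0 ^ 2 + X 1 ^ 2) - C t₂ * (X 2 ^ 2 + X 3 ^ 2)
      + C t₁ * (X 4 ^ 2 + X 5 ^ 2) + C t₂ * (X 6 ^ 2 + X 7 ^ 2),
    -C t₂ * (X 0 ^ 2 + X 1 ^ 2) + C t₁ * (X 2 ^ 2 + X 3 ^ 2)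
      + C t₂ * (X 4 ^ 2 + X 5 ^ 2) + C t₁ * (X 6 ^ 2 + X 7 ^ 2),
    C s₁ * (X 0 ^ 2 - X 1 ^ 2) - C s₂ * (X 2 ^ 2 - X 3 ^ 2)
      + C s₁ * (X 4 ^ 2 - X 5 ^ 2) + C s₂ * (X 6 ^ 2 - X 7 ^ 2),
    -C s₂ * (X 0 ^ 2 - X 1 ^ 2) + C s₁ * (X 2 ^ 2 - X 3 ^ 2)
      + C s₂ * (X 4 ^ 2 - X 5 ^ 2) + C s₁ * (X 6 ^ 2 - X 7 ^ 2)]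

/-- Complex projective 7-space. -/
abbrev P7 := Projectivization ℂ (Fin 8 → ℂ)

/-- The eight index sets `(1468), (1367), (1457), (2467), (2357), (2458), (1358), (2368)`
(here in `0`-based indexing). -/
def muList : List (Finset (Fin 8)) :=
  [{0, 3, 5, 7}, {0, 2, 5, 6}, {0, 3, 4, 6}, {1, 3, 5, 6},
   {1, 2, 4, 6}, {1, 3, 4, 7}, {0, 2, 4, 7}, {1, 2, 5, 7}]

/-- The coefficient matrix of the four diagonal quadrics. -/
def cmat (a b c d : ℂ) : Matrix (Fin 4) (Fin 8) ℂ :=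
  !![a, a, -b, -b, a, a, b, b;
     -b, -b, a, a, b, b, a, a;
     c, -c, -d, d, c, -c, d, -d;
     -d, d, c, -c, d, -d, c, -c]

/-- The quadruples of columns that are generically independent. -/
def goodList : List (Fin 4 → Fin 8) :=
  [![0, 1, 2, 3], ![0, 1, 2, 4], ![0, 1, 2, 5], ![0, 1, 2, 6], ![0, 1, 2, 7], ![0, 1, 3, 4],
   ![0, 1, 3, 5], ![0, 1, 3, 6], ![0, 1, 3, 7], ![0, 1, 4, 5], ![0, 1, 4, 6], ![0, 1, 4, 7],
   ![0, 1, 5, 6], ![0, 1, 5, 7], ![0, 1, 6, 7], ![0, 2, 3, 4], ![0, 2, 3, 5], ![0, 2, 3, 6],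
   ![0, 2, 3, 7], ![0, 2, 4, 5], ![0, 2, 4, 6], ![0, 2, 5, 7], ![0, 2, 6, 7], ![0, 3, 4, 5],
   ![0, 3, 4, 7], ![0, 3, 5, 6], ![0, 3, 6, 7], ![0, 4, 5, 6], ![0, 4, 5, 7], ![0, 4, 6, 7],
   ![0, 5, 6, 7], ![1, 2, 3, 4], ![1, 2, 3, 5], ![1, 2, 3, 6], ![1, 2, 3, 7], ![1, 2, 4, 5],
   ![1, 2, 4, 7], ![1, 2, 5, 6], ![1, 2, 6, 7], ![1, 3, 4, 5], ![1, 3, 4, 6], ![1, 3, 5, 7],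
   ![1, 3, 6, 7], ![1, 4, 5, 6], ![1, 4, 5, 7], ![1, 4, 6, 7], ![1, 5, 6, 7], ![2, 3, 4, 5],
   ![2, 3, 4, 6], ![2, 3, 4, 7], ![2, 3, 5, 6], ![2, 3, 5, 7], ![2, 3, 6, 7], ![2, 4, 5, 6],
   ![2, 4, 5, 7], ![2, 4, 6, 7], ![2, 5, 6, 7], ![3, 4, 5, 6], ![3, 4, 5, 7], ![3, 4, 6, 7],
   ![3, 5, 6, 7], ![4, 5, 6, 7]]

/-- The eight dependent quadruples of columns. -/
def badList : List (Fin 4 → Fin 8) :=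
  [![0, 3, 5, 7], ![0, 2, 5, 6], ![0, 3, 4, 6], ![1, 3, 5, 6],
   ![1, 2, 4, 6], ![1, 3, 4, 7], ![0, 2, 4, 7], ![1, 2, 5, 7]]

/-- The minor of the coefficient matrix with columns `t`. -/
def minor (a b c d : ℂ) (t : Fin 4 → Fin 8) : Matrix (Fin 4) (Fin 4) ℂ :=
  (cmat a b c d).submatrix id t

/-- The genericity conditions. -/
def Gen (a b c d : ℂ) : Prop :=
  a * b * c * d ≠ 0 ∧ (a ^ 2 - b ^ 2) * (c ^ 2 - d ^ 2) ≠ 0 ∧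
  (a ^ 2 + b ^ 2) * (c ^ 2 + d ^ 2) ≠ 0 ∧ a * d - b * c ≠ 0 ∧ a * d + b * c ≠ 0 ∧
  a * c - b * d ≠ 0 ∧ a * c + b * d ≠ 0

theorem minor_det (a b c d : ℂ) (p q r s : Fin 8) :
    (minor a b c d ![p, q, r, s]).det =
      (cmat a b c d 0 p * cmat a b c d 1 q - cmat a b c d 1 p * cmat a b c d 0 q) *
        (cmat a b c d 2 r * cmat a b c d 3 s - cmat a b c d 3 r * cmat a b c d 2 s)
      - (cmat a b c d 0 p * cmat a b c d 1 r - cmat a b c d 1 p * cmat a b c d 0 r) *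
        (cmat a b c d 2 q * cmat a b c d 3 s - cmat a b c d 3 q * cmat a b c d 2 s)
      + (cmat a b c d 0 p * cmat a b c d 1 s - cmat a b c d 1 p * cmat a b c d 0 s) *
        (cmat a b c d 2 q * cmat a b c d 3 r - cmat a b c d 3 q * cmat a b c d 2 r)
      + (cmat a b c d 0 q * cmat a b c d 1 r - cmat a b c d 1 q * cmat a b c d 0 r) *
        (cmat a b c d 2 p * cmat a b c d 3 s - cmat a b c d 3 p * cmat a b c d 2 s)
      - (cmat a b c d 0 q * cmat a b c d 1 s - cmat a b c d 1 q * cmat a b c d 0 s) *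
        (cmat a b c d 2 p * cmat a b c d 3 r - cmat a b c d 3 p * cmat a b c d 2 r)
      + (cmat a b c d 0 r * cmat a b c d 1 s - cmat a b c d 1 r * cmat a b c d 0 s) *
        (cmat a b c d 2 p * cmat a b c d 3 q - cmat a b c d 3 p * cmat a b c d 2 q) := by
  unfold minor
  generalize cmat a b c d = A
  simp [Matrix.det_succ_row_zero, Fin.sum_univ_succ, Fin.succAbove]
  ring

set_option maxHeartbeats 4000000 in
theorem good_det {a b c d : ℂ} (h : Gen a b c d) :
    ∀ t ∈ goodList, (minor a b c d t).det ≠ 0 := by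
  obtain ⟨h1, h2, h3, h4, h5, h6, h7⟩ := h
  have h45 := mul_ne_zero h4 h5
  have h46 := mul_ne_zero h4 h6
  have h47 := mul_ne_zero h4 h7
  have h56 := mul_ne_zero h5 h6
  have h57 := mul_ne_zero h5 h7
  have h67 := mul_ne_zero h6 h7
  have h44 := mul_ne_zero h4 h4
  have h55 := mul_ne_zero h5 h5
  have h66 := mul_ne_zero h6 h6
  have h77 := mul_ne_zero h7 h7
  have key : ∀ t ∈ goodList, (minor a b c d t).det = 0 → False := by
    simp only [goodList, List.forall_mem_cons]
    and_intros
    all_goals first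
      | exact fun t ht => absurd ht List.not_mem_nil
      | (rw [minor_det]
         simp only [cmat, Matrix.of_apply, Matrix.cons_val]
         intro h
         first
           | exact h45 (by linear_combination h / 4)
           | exact h45 (by linear_combination -h / 4)
           | exact h46 (by linear_combination h / 4)
           | exact h46 (by linear_combination -h / 4)
           | exact h47 (by linear_combination h / 4)
           | exact h47 (by linear_combination -h / 4)
           | exact h56 (by linear_combination h / 4)
           | exact h56 (by linear_combination -h / 4)
           | exact h57 (by linear_combination h / 4)
           | exact h57 (by linear_combination -h / 4)
           | exact h67 (by linear_combination h / 4)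
           | exact h67 (by linear_combination -h / 4)
           | exact h44 (by linear_combination h / 4)
           | exact h44 (by linear_combination -h / 4)
           | exact h55 (by linear_combination h / 4)
           | exact h55 (by linear_combination -h / 4)
           | exact h66 (by linear_combination h / 4)
           | exact h66 (by linear_combination -h / 4)
           | exact h77 (by linear_combination h / 4)
           | exact h77 (by linear_combination -h / 4)
           | exact h2 (by linear_combination h / 4)
           | exact h2 (by linear_combination -h / 4)
           | exact h3 (by linear_combination h / 4)
           | exact h3 (by linear_combination -h / 4)
           | exact h1 (by linear_combination -h / 16))
  exact key

theorem bad_det (a b c d : ℂ) :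
    ∀ t ∈ badList, (minor a b c d t).det = 0 := by
  simp only [badList, List.forall_mem_cons]
  and_intros
  all_goals first
    | exact fun t ht => absurd ht List.not_mem_nil
    | (rw [minor_det]
       simp only [cmat, Matrix.of_apply, Matrix.cons_val]
       ring)

theorem bad_inj : ∀ t ∈ badList, Function.Injective t := by
  intro t ht i j
  revert t ht i j
  have h : badList.all (fun t => decide (∀ i j, t i = t j → i = j)) = true := by decide +kernel
  simpa only [List.all_eq_true, decide_eq_true_eq] using h

theorem good_inj : ∀ t ∈ goodList, Function.Injective t := by
  intro t ht i j
  revert t ht i j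
  have h : goodList.all (fun t => decide (∀ i j, t i = t j → i = j)) = true := by decide +kernel
  simpa only [List.all_eq_true, decide_eq_true_eq] using h

theorem comb_cover_aux : ∀ b₀ b₁ b₂ b₃ b₄ b₅ b₆ b₇ : Bool,
    (goodList.any fun t => decide (∀ m, ![b₀, b₁, b₂, b₃, b₄, b₅, b₆, b₇] (t m) = true)) ∨
    (goodList.any fun t => decide (∀ j, (∀ m, t m ≠ j) →
      ![b₀, b₁, b₂, b₃, b₄, b₅, b₆, b₇] j = false)) ∨
    muList.any fun μ => decide (∀ j ∈ μ, ![b₀, b₁, b₂, b₃, b₄, b₅, b₆, b₇] j = false) := by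
  decide +kernel

theorem comb_triple : ∀ μ ∈ muList, ∀ p, p ∉ μ →
    ∃ t ∈ goodList, ∀ j, (∀ m, t m ≠ j) → j ∈ μ ∨ j = p := by
  have h : muList.all (fun μ => decide (∀ p, p ∉ μ →
    goodList.any fun t => decide (∀ j, (∀ m, t m ≠ j) → j ∈ μ ∨ j = p))) = true := by
    decide +kernel
  simpa only [List.all_eq_true, List.any_eq_true, decide_eq_true_eq] using h

theorem comb_bad : ∀ μ ∈ muList, ∃ t ∈ badList, (∀ m, t m ∉ μ) ∧ ∀ j ∉ μ, ∃ m, t m = j := by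
  have h : muList.all (fun μ => badList.any fun t => decide
    ((∀ m, t m ∉ μ) ∧ ∀ j ∉ μ, ∃ m, t m = j)) = true := by
    decide +kernel
  simpa only [List.all_eq_true, List.any_eq_true, decide_eq_true_eq] using h

theorem mu_card : ∀ μ ∈ muList, μ.card = 4 := by
  have h : muList.all (fun μ => decide (μ.card = 4)) = true := by decide +kernel
  simpa only [List.all_eq_true, decide_eq_true_eq] using h

theorem comb_cover (S : Finset (Fin 8)) (h : ∀ t ∈ goodList, ∃ m, t m ∉ S)
    (h' : ∀ t ∈ goodList, ∃ j, (∀ m, t m ≠ j) ∧ j ∈ S) :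
    ∃ μ ∈ muList, ∀ j ∈ μ, j ∉ S := by
  let s : Fin 8 → Bool := fun j => decide (j ∈ S)
  have hs : ![s 0, s 1, s 2, s 3, s 4, s 5, s 6, s 7] = s := by
    ext j
    fin_cases j <;> rfl
  have := comb_cover_aux (s 0) (s 1) (s 2) (s 3) (s 4) (s 5) (s 6) (s 7)
  rw [hs] at this
  simp only [List.any_eq_true, decide_eq_true_eq, s, decide_eq_false_iff_not] at this
  rcases this with ⟨t, ht, hm⟩ | ⟨t, ht, hj⟩ | h3
  · obtain ⟨m, hm'⟩ := h t ht
    exact absurd (hm m) hm'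
  · obtain ⟨j, hj1, hj2⟩ := h' t ht
    exact absurd hj2 (hj j hj1)
  · exact h3

theorem sum_comp (f : Fin 8 → ℂ) (t : Fin 4 → Fin 8) (ht : Function.Injective t)
    (hf : ∀ j, (∀ m, t m ≠ j) → f j = 0) : ∑ m, f (t m) = ∑ j, f j := by
  refine Finset.sum_of_injOn t ht.injOn (by simp) ?_ (by simp)
  intro j _ hj
  exact hf j (by simpa using hj)

theorem good_ker {a b c d : ℂ} (h : Gen a b c d) (t : Fin 4 → Fin 8) (ht : t ∈ goodList)
    (z : Fin 8 → ℂ) (hz : ∀ j, (∀ m, t m ≠ j) → z j = 0)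
    (hA : ∀ i, ∑ j, cmat a b c d i j * z j = 0) : z = 0 := by
  have h0 : (minor a b c d t).mulVec (z ∘ t) = 0 := by
    ext i
    have := sum_comp (fun j => cmat a b c d i j * z j) t (good_inj t ht)
      (fun j hj => by simp [hz j hj])
    simp only [hA i] at this
    simpa [Matrix.mulVec, dotProduct, minor] using this
  have h1 := Matrix.eq_zero_of_mulVec_eq_zero (good_det h t ht) h0
  ext j
  by_cases hj : ∀ m, t m ≠ j
  · simpa using hz j hj
  · push Not at hj
    obtain ⟨m, rfl⟩ := hj
    exact congrFun h1 m

theorem exists_ker {a b c d : ℂ} (h : Gen a b c d) (μ : Finset (Fin 8)) (hμ : μ ∈ muList) :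
    ∃ k : Fin 8 → ℂ, (∀ j, k j = 0 ↔ j ∈ μ) ∧
      ∀ y : Fin 8 → ℂ, ((∀ i, ∑ j, cmat a b c d i j * y j = 0) ∧ ∀ j ∈ μ, y j = 0) ↔
        ∃ e, ∀ j, y j = e * k j := by
  obtain ⟨t, ht, ht1, ht2⟩ := comb_bad μ hμ
  have hinj := bad_inj t ht
  obtain ⟨w, hw0, hw⟩ := Matrix.exists_mulVec_eq_zero_iff.mpr (bad_det a b c d t ht)
  set k : Fin 8 → ℂ := Function.extend t w 0 with hk
  have hkt : ∀ m, k (t m) = w m := fun m => hinj.extend_apply w 0 m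
  have hkμ : ∀ j ∈ μ, k j = 0 := fun j hj => by
    rw [hk, Function.extend_apply']
    · rfl
    · rintro ⟨m, rfl⟩
      exact ht1 m hj
  have hkA : ∀ i, ∑ j, cmat a b c d i j * k j = 0 := fun i => by
    rw [← sum_comp (fun j => cmat a b c d i j * k j) t hinj]
    · simpa [Matrix.mulVec, dotProduct, minor, hkt] using congrFun hw i
    · intro j hj
      have : j ∈ μ := by
        by_contra hc
        obtain ⟨m, hm⟩ := ht2 j hc
        exact hj m hm
      simp [hkμ j this]
  have hk0 : k ≠ 0 := by
    intro h0
    apply hw0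
    ext m
    rw [← hkt, h0]
    rfl
  have key : ∀ p ∉ μ, ∀ z : Fin 8 → ℂ, (∀ i, ∑ j, cmat a b c d i j * z j = 0) →
      (∀ j ∈ μ, z j = 0) → z p = 0 → z = 0 := by
    intro p hp z hz hzμ hzp
    obtain ⟨t', ht', hc⟩ := comb_triple μ hμ p hp
    refine good_ker h t' ht' z (fun j hj => ?_) hz
    rcases hc j hj with hj | rfl
    · exact hzμ j hj
    · exact hzp
  have hkn : ∀ j, k j = 0 ↔ j ∈ μ := fun j =>
    ⟨fun hj => by
      by_contra hc
      exact hk0 (key j hc k hkA hkμ hj), hkμ j⟩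
  refine ⟨k, hkn, fun y => ⟨?_, ?_⟩⟩
  · rintro ⟨hy, hyμ⟩
    have hp : t 0 ∉ μ := ht1 0
    have hkp : k (t 0) ≠ 0 := fun h0 => hp ((hkn _).1 h0)
    have := key (t 0) hp (fun j => k (t 0) * y j - y (t 0) * k j) (fun i => by
      have : ∑ j, cmat a b c d i j * (k (t 0) * y j - y (t 0) * k j)
          = k (t 0) * ∑ j, cmat a b c d i j * y j - y (t 0) * ∑ j, cmat a b c d i j * k j := by
        rw [Finset.mul_sum, Finset.mul_sum, ← Finset.sum_sub_distrib]
        exact Finset.sum_congr rfl fun j _ => by ring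
      rw [this, hy, hkA]
      ring) (fun j hj => by simp [hyμ j hj, hkμ j hj]) (by ring)
    refine ⟨y (t 0) / k (t 0), fun j => ?_⟩
    have hj := congrFun this j
    simp only [Pi.zero_apply] at hj
    field_simp
    linear_combination hj
  · rintro ⟨e, he⟩
    refine ⟨fun i => ?_, fun j hj => by rw [he, hkμ j hj, mul_zero]⟩
    have : ∑ j, cmat a b c d i j * y j = e * ∑ j, cmat a b c d i j * k j := by
      rw [Finset.mul_sum]
      exact Finset.sum_congr rfl fun j _ => by rw [he]; ring
    rw [this, hkA, mul_zero]

/-- Points whose coordinates squared are proportional to a fixed vector. -/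
theorem count_eight (μ : Finset (Fin 8)) (hμ : μ.card = 4) (k : Fin 8 → ℂ)
    (hk : ∀ j, k j = 0 ↔ j ∈ μ) :
    {x : P7 | ∃ e, ∀ j, x.rep j ^ 2 = e * k j}.ncard = 8 := by
  classical
  have hs : ∀ j, ∃ w : ℂ, w ^ 2 = k j := fun j => IsAlgClosed.exists_pow_nat_eq (k j) (by norm_num)
  choose w hw using hs
  have hw0 : ∀ j, w j = 0 ↔ j ∈ μ := fun j => by
    rw [← hk, ← hw]
    simp
  have hcard : μᶜ.card = 4 := by rw [Finset.card_compl, hμ]; rfl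
  obtain ⟨p, hp⟩ : μᶜ.Nonempty := by
    rw [← Finset.card_pos, hcard]
    norm_num
  have hpμ : p ∉ μ := by simpa using hp
  have hwp : w p ≠ 0 := fun h0 => hpμ ((hw0 p).1 h0)
  let g : Finset (Fin 8) → Fin 8 → ℂ := fun σ j => if j ∈ σ then - w j else w j
  have hg2 : ∀ σ j, g σ j ^ 2 = k j := fun σ j => by
    simp only [g]
    split_ifs <;> simp [hw]
  have hg0 : ∀ σ, g σ ≠ 0 := fun σ h0 => by
    have := hg2 σ p
    rw [h0, ← hw] at this
    simp at this
    exact hwp (by simpa using this.symm)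
  let f : Finset (Fin 8) → P7 := fun σ => Projectivization.mk ℂ (g σ) (hg0 σ)
  have himg : {x : P7 | ∃ e, ∀ j, x.rep j ^ 2 = e * k j}
      = f '' ((μᶜ.erase p).powerset : Set (Finset (Fin 8))) := by
    ext x
    constructor
    · rintro ⟨e, he⟩
      set l := x.rep p / w p with hl
      have hl2 : l ^ 2 = e := by
        rw [hl, div_pow, he, hw]
        have : k p ≠ 0 := fun h0 => hpμ ((hk p).1 h0)
        field_simp
      have hl0 : l ≠ 0 := by
        intro h0
        apply x.rep_nonzero
        ext j
        have := he j
        rw [← hl2, h0] at this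
        simpa using this
      refine ⟨(μᶜ.erase p).filter (fun j => x.rep j ≠ l * w j), ?_, ?_⟩
      · simp only [Finset.coe_powerset, Set.mem_preimage, Set.mem_powerset_iff]
        exact_mod_cast Finset.filter_subset _ _
      · simp only [f]
        refine Eq.trans ?_ x.mk_rep
        rw [Projectivization.mk_eq_mk_iff']
        refine ⟨l⁻¹, ?_⟩
        ext j
        simp only [Pi.smul_apply, smul_eq_mul, g, Finset.mem_filter, Finset.mem_erase,
          Finset.mem_compl]
        rw [inv_mul_eq_iff_eq_mul₀ hl0]
        have hj : x.rep j = l * w j ∨ x.rep j = - (l * w j) := by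
          rw [← sq_eq_sq_iff_eq_or_eq_neg, he, ← hl2, ← hw]
          ring
        split_ifs with hc
        · rcases hj with hj | hj
          · exact absurd hj hc.2
          · rw [hj]; ring
        · by_cases hjp : j = p
          · subst hjp
            rw [hl]; field_simp
          · by_cases hjμ : j ∈ μ
            · have := (hw0 j).2 hjμ
              rcases hj with hj | hj <;> rw [hj, this] <;> simp
            · by_contra hne
              exact hc ⟨⟨hjp, hjμ⟩, hne⟩
    · rintro ⟨σ, -, rfl⟩
      obtain ⟨u, hu⟩ := Projectivization.exists_smul_eq_mk_rep ℂ (g σ) (hg0 σ)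
      refine ⟨(u : ℂ) ^ 2, fun j => ?_⟩
      simp only [f]
      rw [← hu, ← hg2 σ j]
      simp [Units.smul_def, mul_pow]
  rw [himg, Set.InjOn.ncard_image ?_, Set.ncard_coe_finset, Finset.card_powerset,
    Finset.card_erase_of_mem hp, hcard]
  · norm_num
  intro σ hσ τ hτ hst
  simp only [f] at hst
  rw [Projectivization.mk_eq_mk_iff'] at hst
  obtain ⟨u, hu⟩ := hst
  have hσ' : σ ⊆ μᶜ.erase p := Finset.mem_powerset.1 (Finset.mem_coe.1 hσ)
  have hτ' : τ ⊆ μᶜ.erase p := Finset.mem_powerset.1 (Finset.mem_coe.1 hτ)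
  have hpσ : p ∉ σ := fun hc => by simpa using hσ' hc
  have hpτ : p ∉ τ := fun hc => by simpa using hτ' hc
  have hu1 : u = 1 := by
    have := congrFun hu p
    simp only [Pi.smul_apply, smul_eq_mul, g, if_neg hpσ, if_neg hpτ] at this
    exact mul_right_cancel₀ hwp (by rw [this, one_mul])
  have hne : ∀ j ∈ μᶜ.erase p, - w j ≠ w j := fun j hj h0 => by
    have h1 : w j = 0 := by linear_combination -h0 / 2
    have h2 := (hw0 j).1 h1
    simp [h2] at hj
  subst hu1
  ext j
  have hj := congrFun hu j
  simp only [Pi.smul_apply, smul_eq_mul, g, one_mul] at hj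
  constructor
  · intro h1
    by_contra h2
    rw [if_pos h1, if_neg h2] at hj
    exact hne j (hσ' h1) hj.symm
  · intro h1
    by_contra h2
    rw [if_neg h2, if_pos h1] at hj
    exact hne j (hτ' h1) hj

theorem rank_lt_iff (J : Matrix (Fin 4) (Fin 8) ℂ) :
    J.rank < 4 ↔ ∃ l : Fin 4 → ℂ, l ≠ 0 ∧ Matrix.vecMul l J = 0 := by
  rw [← Matrix.rank_transpose, Matrix.rank]
  have hrn := LinearMap.finrank_range_add_finrank_ker (Matrix.transpose J).mulVecLin
  rw [Module.finrank_fin_fun] at hrn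
  have h1 : Module.finrank ℂ (LinearMap.range (Matrix.transpose J).mulVecLin) < 4 ↔
      LinearMap.ker (Matrix.transpose J).mulVecLin ≠ ⊥ := by
    rw [Ne, ← Submodule.finrank_eq_zero (R := ℂ)]
    omega
  rw [h1, Submodule.ne_bot_iff]
  simp only [LinearMap.mem_ker, Matrix.mulVecLin_apply, Matrix.mulVec_transpose]
  exact exists_congr fun l => and_comm

theorem qfam_eq (a b c d : ℂ) (i : Fin 4) :
    qfam a b c d i = ∑ j, C (cmat a b c d i j) * X j ^ 2 := by
  fin_cases i <;> simp [qfam, cmat, Fin.sum_univ_succ] <;> ring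

theorem qfam_eval (a b c d : ℂ) (i : Fin 4) (v : Fin 8 → ℂ) :
    eval v (qfam a b c d i) = ∑ j, cmat a b c d i j * v j ^ 2 := by
  rw [qfam_eq]
  simp

theorem qfam_pderiv (a b c d : ℂ) (i : Fin 4) (j : Fin 8) (v : Fin 8 → ℂ) :
    eval v (pderiv j (qfam a b c d i)) = cmat a b c d i j * (2 * v j) := by
  rw [qfam_eq]
  simp [pderiv_X, Derivation.leibniz_pow, Pi.single_apply]

/-- The solution set on a coordinate subspace. -/
def sol (a b c d : ℂ) (μ : Finset (Fin 8)) : Set P7 :=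
  {x : P7 | (∀ i, eval x.rep (qfam a b c d i) = 0) ∧ ∀ j ∈ μ, x.rep j = 0}

theorem sol_eq {a b c d : ℂ} (h : Gen a b c d) (μ : Finset (Fin 8)) (hμ : μ ∈ muList) :
    ∃ k : Fin 8 → ℂ, (∀ j, k j = 0 ↔ j ∈ μ) ∧
      sol a b c d μ = {x : P7 | ∃ e, ∀ j, x.rep j ^ 2 = e * k j} := by
  obtain ⟨k, hk, hy⟩ := exists_ker h μ hμ
  refine ⟨k, hk, ?_⟩
  ext x
  have := hy (fun j => x.rep j ^ 2)
  simpa [sol, qfam_eval] using this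

theorem sol_card {a b c d : ℂ} (h : Gen a b c d) (μ : Finset (Fin 8)) (hμ : μ ∈ muList) :
    (sol a b c d μ).ncard = 8 := by
  obtain ⟨k, hk, he⟩ := sol_eq h μ hμ
  rw [he]
  exact count_eight μ (mu_card μ hμ) k hk

theorem sol_supp {a b c d : ℂ} (h : Gen a b c d) (μ : Finset (Fin 8)) (hμ : μ ∈ muList)
    (x : P7) (hx : x ∈ sol a b c d μ) (j : Fin 8) : x.rep j = 0 ↔ j ∈ μ := by
  obtain ⟨k, hk, he⟩ := sol_eq h μ hμ
  rw [he] at hx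
  obtain ⟨e, hx⟩ := hx
  have he0 : e ≠ 0 := by
    rintro rfl
    apply x.rep_nonzero
    ext j
    simpa using hx j
  rw [← hk, ← sq_eq_zero_iff, hx j]
  simp [he0]

theorem sing_iff {a b c d : ℂ} (h : Gen a b c d) (x : P7)
    (hq : ∀ i, eval x.rep (qfam a b c d i) = 0) :
    (Matrix.of fun (i : Fin 4) (j : Fin 8) =>
      eval x.rep (pderiv j (qfam a b c d i))).rank < 4 ↔
    ∃ μ ∈ muList, ∀ j ∈ μ, x.rep j = 0 := by
  classical
  rw [rank_lt_iff]
  constructor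
  · rintro ⟨l, hl0, hl⟩
    obtain ⟨μ, hμ, hj⟩ := comb_cover (Finset.univ.filter fun j => x.rep j ≠ 0) (by
      intro t ht
      by_contra hc
      push Not at hc
      apply hl0
      refine Matrix.eq_zero_of_vecMul_eq_zero (good_det h t ht) ?_
      ext m
      have h1 := congrFun hl (t m)
      have h2 : x.rep (t m) ≠ 0 := by simpa using hc m
      simp only [Matrix.vecMul, dotProduct, Matrix.of_apply, qfam_pderiv, Pi.zero_apply,
        ← mul_assoc] at h1
      simp only [Matrix.vecMul, dotProduct, minor, Matrix.submatrix_apply, id, Pi.zero_apply]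
      rw [← Finset.sum_mul, ← Finset.sum_mul] at h1
      simpa [h2] using h1) (by
      intro t ht
      by_contra hc
      push Not at hc
      apply x.rep_nonzero
      have h0 := good_ker h t ht (fun j => x.rep j ^ 2)
        (fun j hj => by simpa using hc j hj) (fun i => by rw [← qfam_eval]; exact hq i)
      ext j
      simpa using congrFun h0 j)
    exact ⟨μ, hμ, fun j hjμ => by simpa using hj j hjμ⟩
  · rintro ⟨μ, hμ, hx⟩
    obtain ⟨t, ht, ht1, ht2⟩ := comb_bad μ hμ
    obtain ⟨l, hl0, hl⟩ := Matrix.exists_vecMul_eq_zero_iff.mpr (bad_det a b c d t ht)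
    refine ⟨l, hl0, ?_⟩
    ext j
    simp only [Matrix.vecMul, dotProduct, Matrix.of_apply, qfam_pderiv, Pi.zero_apply,
      ← mul_assoc]
    rw [← Finset.sum_mul, ← Finset.sum_mul]
    by_cases hj : j ∈ μ
    · simp [hx j hj]
    · obtain ⟨m, rfl⟩ := ht2 j hj
      have := congrFun hl m
      simp only [Matrix.vecMul, dotProduct, minor, Matrix.submatrix_apply, id,
        Pi.zero_apply] at this
      rw [this]
      simp

theorem sing_card {a b c d : ℂ} (h : Gen a b c d) :
    {x : P7 | (∀ i, eval x.rep (qfam a b c d i) = 0) ∧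
          (Matrix.of fun (i : Fin 4) (j : Fin 8) =>
            eval x.rep (pderiv j (qfam a b c d i))).rank < 4}.ncard = 64 := by
  classical
  have hU : {x : P7 | (∀ i, eval x.rep (qfam a b c d i) = 0) ∧
          (Matrix.of fun (i : Fin 4) (j : Fin 8) =>
            eval x.rep (pderiv j (qfam a b c d i))).rank < 4}
      = ⋃ μ ∈ muList.toFinset, sol a b c d μ := by
    ext x
    simp only [Set.mem_ofPred_eq, Set.mem_iUnion, sol, List.mem_toFinset, exists_prop]
    constructor
    · rintro ⟨h1, hr⟩
      obtain ⟨μ, h2, h3⟩ := (sing_iff h x h1).1 hr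
      exact ⟨μ, h2, h1, h3⟩
    · rintro ⟨μ, h2, h1, h3⟩
      exact ⟨h1, (sing_iff h x h1).2 ⟨μ, h2, h3⟩⟩
  have hfin : ∀ μ ∈ muList, (sol a b c d μ).Finite := fun μ hμ =>
    Set.finite_of_ncard_ne_zero (by rw [sol_card h μ hμ]; norm_num)
  have hb : (⋃ μ ∈ muList.toFinset, sol a b c d μ)
      = ((muList.toFinset.attach.biUnion fun μ =>
        (hfin μ.1 (List.mem_toFinset.1 μ.2)).toFinset : Finset P7) : Set P7) := by
    ext x
    simp
  rw [hU, hb, Set.ncard_coe_finset, Finset.card_biUnion]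
  · rw [Finset.sum_congr rfl (g := fun _ => 8)]
    · rw [Finset.sum_const, Finset.card_attach]
      have : muList.toFinset.card = 8 := by decide +kernel
      rw [this]
      rfl
    · intro μ _
      rw [← Set.ncard_eq_toFinset_card _ _]
      exact sol_card h μ.1 (List.mem_toFinset.1 μ.2)
  · intro μ _ ν _ hne
    rw [Function.onFun, Finset.disjoint_left]
    intro x hx hx'
    rw [Set.Finite.mem_toFinset] at hx hx'
    apply hne
    apply Subtype.ext
    ext j
    rw [← sol_supp h μ.1 (List.mem_toFinset.1 μ.2) x hx j,
      ← sol_supp h ν.1 (List.mem_toFinset.1 ν.2) x hx' j]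

/-- The genericity polynomial. -/
noncomputable def genPoly : MvPolynomial (Fin 4) ℂ :=
  (X 0 * X 1 * X 2 * X 3) * ((X 0 ^ 2 - X 1 ^ 2) * (X 2 ^ 2 - X 3 ^ 2)) *
  ((X 0 ^ 2 + X 1 ^ 2) * (X 2 ^ 2 + X 3 ^ 2)) * (X 0 * X 3 - X 1 * X 2) *
  (X 0 * X 3 + X 1 * X 2) * (X 0 * X 2 - X 1 * X 3) * (X 0 * X 2 + X 1 * X 3)

theorem genPoly_eval (a b c d : ℂ) : eval ![a, b, c, d] genPoly =
  (a * b * c * d) * ((a ^ 2 - b ^ 2) * (c ^ 2 - d ^ 2)) *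
  ((a ^ 2 + b ^ 2) * (c ^ 2 + d ^ 2)) * (a * d - b * c) *
  (a * d + b * c) * (a * c - b * d) * (a * c + b * d) := by
  simp [genPoly]

/-- For generic parameters, for each of the eight index sets `μ`, the system
`q₁ = q₂ = q₃ = q₄ = 0` restricted to the coordinate subspace `{xᵢ = 0 : i ∈ μ}` has
exactly 8 solutions in `ℙ⁷`; hence `X` has exactly `8 × 8 = 64` such singular points
(singularity being rank `< 4` of the Jacobian). -/
theorem eight_solutions_per_index_set_and_64_singular_points :
    ∃ P : MvPolynomial (Fin 4) ℂ, P ≠ 0 ∧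
      ∀ t₁ t₂ s₁ s₂ : ℂ, eval ![t₁, t₂, s₁, s₂] P ≠ 0 →
        (∀ μ ∈ muList,
          {x : P7 | (∀ i, eval x.rep (qfam t₁ t₂ s₁ s₂ i) = 0) ∧
            ∀ j ∈ μ, x.rep j = 0}.ncard = 8) ∧
        {x : P7 | (∀ i, eval x.rep (qfam t₁ t₂ s₁ s₂ i) = 0) ∧
          (Matrix.of fun (i : Fin 4) (j : Fin 8) =>
            eval x.rep (pderiv j (qfam t₁ t₂ s₁ s₂ i))).rank < 4}.ncard = 64 := by
  refine ⟨genPoly, ?_, ?_⟩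
  · intro h0
    have h1 := genPoly_eval 1 2 1 3
    rw [h0] at h1
    norm_num at h1
  · intro a b c d hP
    rw [genPoly_eval] at hP
    have h : Gen a b c d := by
      refine ⟨?_, ?_, ?_, ?_, ?_, ?_, ?_⟩ <;> intro h0 <;> apply hP <;> rw [h0] <;> ring
    exact ⟨fun μ hμ => sol_card h μ hμ, sing_card h⟩
end

section
/- Let X ⊆ ℙ⁷ be the threefold cut out by the four quadrics of the G₄-invariant family (Theorem p11) and let f₁ = r₁x₁x₂ − r₂x₃x₄ + r₁x₅x₆ + r₂x₇x₈ and f₂ = −r₂x₁x₂ + r₁x₃x₄ + r₂x₅x₆ + r₁x₇x₈. Then the rational map φ : X ⇢ ℙ¹, x ↦ (f₁(x) : f₂(x)), is well-defined at every point of X except the 64 ordinary double points, which are precisely the common base points of the pencil spanned by f₁ and f₂ on X. -/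
open MvPolynomial

/-- The quadric `f₁ = r₁x₁x₂ − r₂x₃x₄ + r₁x₅x₆ + r₂x₇x₈`. -/
noncomputable def f1 (r₁ r₂ : ℂ) : MvPolynomial (Fin 8) ℂ :=
  C r₁ * (X 0 * X 1) - C r₂ * (X 2 * X 3) + C r₁ * (X 4 * X 5) + C r₂ * (X 6 * X 7)

/-- The quadric `f₂ = −r₂x₁x₂ + r₁x₃x₄ + r₂x₅x₆ + r₁x₇x₈`. -/
noncomputable def f2 (r₁ r₂ : ℂ) : MvPolynomial (Fin 8) ℂ :=
  -C r₂ * (X 0 * X 1) + C r₁ * (X 2 * X 3) + C r₂ * (X 4 * X 5) + C r₁ * (X 6 * X 7)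

/-- The rational map `φ = (f₁ : f₂) : X ⇢ ℙ¹` is well-defined at a point `v` of the
cone over `X` if, after possibly removing a common factor, it has a representative
`(g₁ : g₂)` (agreeing with `(f₁ : f₂)` on `X`) with `g₁` and `g₂` not both vanishing
at `v`. -/
def DefinedAt (q : Fin 4 → MvPolynomial (Fin 8) ℂ) (fa fb : MvPolynomial (Fin 8) ℂ)
    (v : Fin 8 → ℂ) : Prop :=
  ∃ (d : ℕ) (g₁ g₂ : MvPolynomial (Fin 8) ℂ),
    g₁.IsHomogeneous d ∧ g₂.IsHomogeneous d ∧
    (∀ w : Fin 8 → ℂ, (∀ i, eval w (q i) = 0) → eval w (g₁ * fb - g₂ * fa) = 0) ∧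
    (eval v g₁ ≠ 0 ∨ eval v g₂ ≠ 0)

/-- Any two columns of the `2 × 4` coefficient matrix are independent. -/
lemma key_columns {p q m1 m2 m3 m4 α β : ℂ} (hp : p ≠ 0) (hq : q ≠ 0) (h4 : p ^ 4 - q ^ 4 ≠ 0)
    (hQ : m1 ^ 2 - m2 ^ 2 - m3 ^ 2 + m4 ^ 2 = 0)
    (hne : ¬ (m1 = 0 ∧ m2 = 0 ∧ m3 = 0 ∧ m4 = 0))
    (e1 : m1 * (p * α - q * β) = 0) (e2 : m2 * (-q * α + p * β) = 0)
    (e3 : m3 * (p * α + q * β) = 0) (e4 : m4 * (q * α + p * β) = 0) : α = 0 ∧ β = 0 := by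
  have hm : p ^ 2 - q ^ 2 ≠ 0 := fun h => h4 (by linear_combination (p ^ 2 + q ^ 2) * h)
  have hpl : p ^ 2 + q ^ 2 ≠ 0 := fun h => h4 (by linear_combination (p ^ 2 - q ^ 2) * h)
  have fin : ∀ c : ℂ, c ≠ 0 → c * α = 0 → c * β = 0 → α = 0 ∧ β = 0 := fun c hc h1 h2 =>
    ⟨(mul_eq_zero.mp h1).resolve_left hc, (mul_eq_zero.mp h2).resolve_left hc⟩
  have hpq : 2 * p * q ≠ 0 := by simp [hp, hq]
  rcases mul_eq_zero.mp e1 with a1 | a1 <;> rcases mul_eq_zero.mp e2 with a2 | a2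
  · rcases mul_eq_zero.mp e3 with a3 | a3 <;> rcases mul_eq_zero.mp e4 with a4 | a4
    · exact absurd ⟨a1, a2, a3, a4⟩ hne
    · refine absurd ⟨a1, a2, a3, ?_⟩ hne
      simpa [a1, a2, a3] using hQ
    · refine absurd ⟨a1, a2, ?_, a4⟩ hne
      simpa [a1, a2, a4] using hQ
    · exact fin _ hm (by linear_combination p * a3 - q * a4) (by linear_combination p * a4 - q * a3)
  · rcases mul_eq_zero.mp e3 with a3 | a3
    · rcases mul_eq_zero.mp e4 with a4 | a4
      · refine absurd ⟨a1, ?_, a3, a4⟩ hne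
        simpa [a1, a3, a4] using hQ
      · exact fin _ hpq (by linear_combination p * a4 - p * a2)
          (by linear_combination q * a4 + q * a2)
    · exact fin _ hpl (by linear_combination p * a3 - q * a2)
        (by linear_combination p * a2 + q * a3)
  · rcases mul_eq_zero.mp e3 with a3 | a3
    · rcases mul_eq_zero.mp e4 with a4 | a4
      · refine absurd ⟨?_, a2, a3, a4⟩ hne
        simpa [a2, a3, a4] using hQ
      · exact fin _ hpl (by linear_combination p * a1 + q * a4)
          (by linear_combination p * a4 - q * a1)
    · exact fin _ hpq (by linear_combination q * a1 + q * a3)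
        (by linear_combination p * a3 - p * a1)
  · exact fin _ hm (by linear_combination p * a1 + q * a2) (by linear_combination p * a2 + q * a1)

/-- The kernel plane lies on the quadric `A₁² - A₂² - A₃² + A₄² = 0`. -/
lemma plane_on_quadric {p q a1 a2 a3 a4 : ℂ} (hp : p ≠ 0) (hq : q ≠ 0)
    (h1 : p * a1 - q * a2 + p * a3 + q * a4 = 0)
    (h2 : -q * a1 + p * a2 + q * a3 + p * a4 = 0) :
    a1 ^ 2 - a2 ^ 2 - a3 ^ 2 + a4 ^ 2 = 0 := by
  have : p * q * (a1 ^ 2 - a2 ^ 2 - a3 ^ 2 + a4 ^ 2) = 0 := by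
    linear_combination (-q * (a3 - a1)) * h1 + q * (a4 - a2) * h2
  exact (mul_eq_zero.mp this).resolve_left (mul_ne_zero hp hq)

lemma rank_four_iff (J : Matrix (Fin 4) (Fin 8) ℂ) :
    J.rank = 4 ↔ ∀ α : Fin 4 → ℂ, Matrix.vecMul α J = 0 → α = 0 := by
  have h1 : J.rank = 4 ↔ LinearIndependent ℂ J.row := by
    rw [Matrix.rank_eq_finrank_span_row, linearIndependent_iff_card_eq_finrank_span]
    simp [Set.finrank, eq_comm]
  rw [h1, ← Matrix.vecMul_injective_iff]
  constructor
  · intro h α hα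
    exact h (by simpa using hα)
  · intro h x y hxy
    have : Matrix.vecMul (x - y) J = 0 := by
      rw [Matrix.sub_vecMul]; exact sub_eq_zero.mpr hxy
    exact sub_eq_zero.mp (h _ this)

lemma vanish_iff (t₁ t₂ s₁ s₂ : ℂ) (v : Fin 8 → ℂ) :
    (∀ i, eval v (qfam t₁ t₂ s₁ s₂ i) = 0) ↔
      (t₁ * (v 0 ^ 2 + v 1 ^ 2) - t₂ * (v 2 ^ 2 + v 3 ^ 2)
        + t₁ * (v 4 ^ 2 + v 5 ^ 2) + t₂ * (v 6 ^ 2 + v 7 ^ 2) = 0) ∧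
      (-t₂ * (v 0 ^ 2 + v 1 ^ 2) + t₁ * (v 2 ^ 2 + v 3 ^ 2)
        + t₂ * (v 4 ^ 2 + v 5 ^ 2) + t₁ * (v 6 ^ 2 + v 7 ^ 2) = 0) ∧
      (s₁ * (v 0 ^ 2 - v 1 ^ 2) - s₂ * (v 2 ^ 2 - v 3 ^ 2)
        + s₁ * (v 4 ^ 2 - v 5 ^ 2) + s₂ * (v 6 ^ 2 - v 7 ^ 2) = 0) ∧
      (-s₂ * (v 0 ^ 2 - v 1 ^ 2) + s₁ * (v 2 ^ 2 - v 3 ^ 2)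
        + s₂ * (v 4 ^ 2 - v 5 ^ 2) + s₁ * (v 6 ^ 2 - v 7 ^ 2) = 0) := by
  simp [Fin.forall_fin_succ, qfam]

/-- The left kernel of the Jacobian, explicitly. -/
lemma left_kernel_iff (t₁ t₂ s₁ s₂ : ℂ) (v : Fin 8 → ℂ) (α : Fin 4 → ℂ) :
    Matrix.vecMul α (Matrix.of fun (i : Fin 4) (j : Fin 8) =>
        eval v (pderiv j (qfam t₁ t₂ s₁ s₂ i))) = 0 ↔
      (v 0 * ((t₁ * α 0 - t₂ * α 1) + (s₁ * α 2 - s₂ * α 3)) = 0 ∧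
       v 1 * ((t₁ * α 0 - t₂ * α 1) - (s₁ * α 2 - s₂ * α 3)) = 0) ∧
      (v 2 * ((-t₂ * α 0 + t₁ * α 1) + (-s₂ * α 2 + s₁ * α 3)) = 0 ∧
       v 3 * ((-t₂ * α 0 + t₁ * α 1) - (-s₂ * α 2 + s₁ * α 3)) = 0) ∧
      (v 4 * ((t₁ * α 0 + t₂ * α 1) + (s₁ * α 2 + s₂ * α 3)) = 0 ∧
       v 5 * ((t₁ * α 0 + t₂ * α 1) - (s₁ * α 2 + s₂ * α 3)) = 0) ∧
      (v 6 * ((t₂ * α 0 + t₁ * α 1) + (s₂ * α 2 + s₁ * α 3)) = 0 ∧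
       v 7 * ((t₂ * α 0 + t₁ * α 1) - (s₂ * α 2 + s₁ * α 3)) = 0) := by
  have h2 : ∀ x y : ℂ, x = 2 * y → (x = 0 ↔ y = 0) := by
    rintro x y rfl; simp
  rw [_root_.funext_iff]
  simp only [Fin.forall_fin_succ, Matrix.vecMul, dotProduct, Fin.sum_univ_four, Matrix.of_apply,
    qfam, Pi.zero_apply, and_assoc]
  refine and_congr ?_ (and_congr ?_ (and_congr ?_ (and_congr ?_ (and_congr ?_ (and_congr ?_
    (and_congr ?_ ?_))))))
  all_goals
    simp [pderiv_X, Pi.single_apply, Fin.ext_iff, Derivation.leibniz_pow]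
    rw [← mul_eq_zero]
    apply h2
    ring

/-- At a point where all products vanish the Jacobian drops rank. -/
lemma exists_left_kernel {t₁ t₂ s₁ s₂ : ℂ} {v : Fin 8 → ℂ} (hv : v ≠ 0)
    (hX : ∀ i, eval v (qfam t₁ t₂ s₁ s₂ i) = 0)
    (m1 : v 0 * v 1 = 0) (m2 : v 2 * v 3 = 0) (m3 : v 4 * v 5 = 0) (m4 : v 6 * v 7 = 0) :
    ∃ α : Fin 4 → ℂ, α ≠ 0 ∧ Matrix.vecMul α (Matrix.of fun (i : Fin 4) (j : Fin 8) =>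
        eval v (pderiv j (qfam t₁ t₂ s₁ s₂ i))) = 0 := by
  obtain ⟨h1, h2, h3, h4⟩ := (vanish_iff _ _ _ _ _).mp hX
  set N : Matrix (Fin 4) (Fin 4) ℂ :=
    !![(v 0 + v 1) * t₁, (v 2 + v 3) * (-t₂), (v 4 + v 5) * t₁, (v 6 + v 7) * t₂;
       (v 0 + v 1) * (-t₂), (v 2 + v 3) * t₁, (v 4 + v 5) * t₂, (v 6 + v 7) * t₁;
       (v 0 - v 1) * s₁, (v 2 - v 3) * (-s₂), (v 4 - v 5) * s₁, (v 6 - v 7) * s₂;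
       (v 0 - v 1) * (-s₂), (v 2 - v 3) * s₁, (v 4 - v 5) * s₂, (v 6 - v 7) * s₁] with hN
  have hz : N.mulVec ![v 0 + v 1, v 2 + v 3, v 4 + v 5, v 6 + v 7] = 0 := by
    ext i
    fin_cases i <;> simp [hN, Matrix.mulVec, dotProduct, Fin.sum_univ_four]
    · linear_combination h1 + 2 * t₁ * m1 - 2 * t₂ * m2 + 2 * t₁ * m3 + 2 * t₂ * m4
    · linear_combination h2 - 2 * t₂ * m1 + 2 * t₁ * m2 + 2 * t₂ * m3 + 2 * t₁ * m4
    · linear_combination h3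
    · linear_combination h4
  have hz0 : ![v 0 + v 1, v 2 + v 3, v 4 + v 5, v 6 + v 7] ≠ 0 := by
    intro h
    apply hv
    have c0 : v 0 + v 1 = 0 := congrFun h 0
    have c1 : v 2 + v 3 = 0 := congrFun h 1
    have c2 : v 4 + v 5 = 0 := congrFun h 2
    have c3 : v 6 + v 7 = 0 := congrFun h 3
    have aux : ∀ x y : ℂ, x + y = 0 → x * y = 0 → x = 0 ∧ y = 0 := by
      intro x y h h'
      rcases mul_eq_zero.mp h' with rfl | rfl <;> simpa using h
    obtain ⟨d0, d1⟩ := aux _ _ c0 m1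
    obtain ⟨d2, d3⟩ := aux _ _ c1 m2
    obtain ⟨d4, d5⟩ := aux _ _ c2 m3
    obtain ⟨d6, d7⟩ := aux _ _ c3 m4
    ext i
    fin_cases i <;> simpa
  have hdet : N.det = 0 := Matrix.exists_mulVec_eq_zero_iff.mp ⟨_, hz0, hz⟩
  obtain ⟨α, hα, hαN⟩ := Matrix.exists_vecMul_eq_zero_iff.mpr hdet
  refine ⟨α, hα, (left_kernel_iff _ _ _ _ _ _).mpr ?_⟩
  have aux : ∀ x y a b : ℂ, x * y = 0 → (x + y) * a + (x - y) * b = 0 →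
      x * (a + b) = 0 ∧ y * (a - b) = 0 := by
    intro x y a b h h'
    rcases mul_eq_zero.mp h with rfl | rfl
    · exact ⟨by ring, by linear_combination h'⟩
    · exact ⟨by linear_combination h', by ring⟩
  have n0 := congrFun hαN 0
  have n1 := congrFun hαN 1
  have n2 := congrFun hαN 2
  have n3 := congrFun hαN 3
  simp [hN, Matrix.vecMul, dotProduct, Fin.sum_univ_four] at n0 n1 n2 n3
  exact ⟨aux _ _ _ _ m1 (by linear_combination n0), aux _ _ _ _ m2 (by linear_combination n1),
    aux _ _ _ _ m3 (by linear_combination n2), aux _ _ _ _ m4 (by linear_combination n3)⟩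

/-- The line in `X` through a node `v`, one for each choice of signs. -/
noncomputable def nodeLine (v : Fin 8 → ℂ) (d1 d2 d3 d4 η : ℂ) : Fin 8 → ℂ :=
  ![v 0 + η * d1 * v 1, v 1 + η * d1 * v 0, v 2 + η * d2 * v 3, v 3 + η * d2 * v 2,
    v 4 + η * d3 * v 5, v 5 + η * d3 * v 4, v 6 + η * d4 * v 7, v 7 + η * d4 * v 6]

lemma nodeLine_mem {t₁ t₂ s₁ s₂ : ℂ} {v : Fin 8 → ℂ}
    (hX : ∀ i, eval v (qfam t₁ t₂ s₁ s₂ i) = 0)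
    (m1 : v 0 * v 1 = 0) (m2 : v 2 * v 3 = 0) (m3 : v 4 * v 5 = 0) (m4 : v 6 * v 7 = 0)
    {d1 d2 d3 d4 : ℂ} (e1 : d1 ^ 2 = 1) (e2 : d2 ^ 2 = 1) (e3 : d3 ^ 2 = 1) (e4 : d4 ^ 2 = 1)
    (η : ℂ) : ∀ i, eval (nodeLine v d1 d2 d3 d4 η) (qfam t₁ t₂ s₁ s₂ i) = 0 := by
  obtain ⟨h1, h2, h3, h4⟩ := (vanish_iff _ _ _ _ _).mp hX
  have auxA : ∀ x y d : ℂ, x * y = 0 → d ^ 2 = 1 →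
      (x + η * d * y) ^ 2 + (y + η * d * x) ^ 2 = (1 + η ^ 2) * (x ^ 2 + y ^ 2) := by
    intro x y d h h'
    linear_combination 4 * η * d * h + η ^ 2 * (x ^ 2 + y ^ 2) * h'
  have auxB : ∀ x y d : ℂ, d ^ 2 = 1 →
      (x + η * d * y) ^ 2 - (y + η * d * x) ^ 2 = (1 - η ^ 2) * (x ^ 2 - y ^ 2) := by
    intro x y d h'
    linear_combination -η ^ 2 * (x ^ 2 - y ^ 2) * h'
  rw [vanish_iff]
  simp only [nodeLine, Matrix.cons_val]
  rw [auxA _ _ _ m1 e1, auxA _ _ _ m2 e2, auxA _ _ _ m3 e3, auxA _ _ _ m4 e4,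
    auxB _ _ _ e1, auxB _ _ _ e2, auxB _ _ _ e3, auxB _ _ _ e4]
  refine ⟨?_, ?_, ?_, ?_⟩
  · linear_combination (1 + η ^ 2) * h1
  · linear_combination (1 + η ^ 2) * h2
  · linear_combination (1 - η ^ 2) * h3
  · linear_combination (1 - η ^ 2) * h4

/-- The linear constraint on the value of a representative at `v` along a line. -/
lemma node_relation {t₁ t₂ s₁ s₂ r₁ r₂ : ℂ} {v : Fin 8 → ℂ}
    (hX : ∀ i, eval v (qfam t₁ t₂ s₁ s₂ i) = 0)
    (m1 : v 0 * v 1 = 0) (m2 : v 2 * v 3 = 0) (m3 : v 4 * v 5 = 0) (m4 : v 6 * v 7 = 0)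
    {g₁ g₂ : MvPolynomial (Fin 8) ℂ}
    (hg : ∀ w : Fin 8 → ℂ, (∀ i, eval w (qfam t₁ t₂ s₁ s₂ i) = 0) →
      eval w (g₁ * f2 r₁ r₂ - g₂ * f1 r₁ r₂) = 0)
    {d1 d2 d3 d4 : ℂ} (e1 : d1 ^ 2 = 1) (e2 : d2 ^ 2 = 1) (e3 : d3 ^ 2 = 1) (e4 : d4 ^ 2 = 1) :
    eval v g₁ * (-r₂ * (d1 * (v 0 ^ 2 + v 1 ^ 2)) + r₁ * (d2 * (v 2 ^ 2 + v 3 ^ 2))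
        + r₂ * (d3 * (v 4 ^ 2 + v 5 ^ 2)) + r₁ * (d4 * (v 6 ^ 2 + v 7 ^ 2)))
      - eval v g₂ * (r₁ * (d1 * (v 0 ^ 2 + v 1 ^ 2)) - r₂ * (d2 * (v 2 ^ 2 + v 3 ^ 2))
        + r₁ * (d3 * (v 4 ^ 2 + v 5 ^ 2)) + r₂ * (d4 * (v 6 ^ 2 + v 7 ^ 2))) = 0 := by
  set F2 := (-r₂ * (d1 * (v 0 ^ 2 + v 1 ^ 2)) + r₁ * (d2 * (v 2 ^ 2 + v 3 ^ 2))
        + r₂ * (d3 * (v 4 ^ 2 + v 5 ^ 2)) + r₁ * (d4 * (v 6 ^ 2 + v 7 ^ 2))) with hF2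
  set F1 := (r₁ * (d1 * (v 0 ^ 2 + v 1 ^ 2)) - r₂ * (d2 * (v 2 ^ 2 + v 3 ^ 2))
        + r₁ * (d3 * (v 4 ^ 2 + v 5 ^ 2)) + r₂ * (d4 * (v 6 ^ 2 + v 7 ^ 2))) with hF1
  let L : ℂ → Fin 8 → ℂ := nodeLine v d1 d2 d3 d4
  have hL : Continuous L := by
    refine continuous_pi fun i => ?_
    fin_cases i <;> simp [L, nodeLine] <;> fun_prop
  have hL0 : L 0 = v := by
    ext i
    fin_cases i <;> simp [L, nodeLine]
  have hc : Continuous fun η => eval (L η) g₁ * F2 - eval (L η) g₂ * F1 :=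
    (((continuous_eval g₁).comp hL).mul continuous_const).sub
      (((continuous_eval g₂).comp hL).mul continuous_const)
  have hzero : ∀ η : ℂ, η ≠ 0 → eval (L η) g₁ * F2 - eval (L η) g₂ * F1 = 0 := by
    intro η hη
    have h := hg (L η) (nodeLine_mem hX m1 m2 m3 m4 e1 e2 e3 e4 η)
    have auxM : ∀ x y d : ℂ, x * y = 0 → d ^ 2 = 1 →
        (x + η * d * y) * (y + η * d * x) = η * (d * (x ^ 2 + y ^ 2)) := by
      intro x y d h h'
      linear_combination (1 + η ^ 2 * d ^ 2) * h
    have hf2 : eval (L η) (f2 r₁ r₂) = η * F2 := by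
      simp only [f2, map_add, map_mul, map_neg, eval_C, eval_X, L, nodeLine, Matrix.cons_val]
      rw [auxM _ _ _ m1 e1, auxM _ _ _ m2 e2, auxM _ _ _ m3 e3, auxM _ _ _ m4 e4, hF2]
      ring
    have hf1 : eval (L η) (f1 r₁ r₂) = η * F1 := by
      simp only [f1, map_add, map_sub, map_mul, eval_C, eval_X, L, nodeLine, Matrix.cons_val]
      rw [auxM _ _ _ m1 e1, auxM _ _ _ m2 e2, auxM _ _ _ m3 e3, auxM _ _ _ m4 e4, hF1]
      ring
    rw [map_sub, map_mul, map_mul, hf1, hf2] at h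
    refine (mul_eq_zero.mp (?_ : η * _ = 0)).resolve_left hη
    linear_combination h
  have hall := hc.ext_on (dense_compl_singleton (0 : ℂ)) continuous_const
    (fun η hη => hzero η hη)
  have := congrFun hall 0
  simpa [hL0] using this

/-- For generic parameters `t₁, t₂, s₁, s₂, r₁, r₂`, the rational map
`φ = (f₁ : f₂) : X ⇢ ℙ¹` on the complete intersection `X = {q₁ = ⋯ = q₄ = 0} ⊆ ℙ⁷`
is well-defined exactly at the nonsingular points of `X`: its base points are precisely
the 64 ordinary double points (the singular points, where the Jacobian has rank `< 4`). -/
theorem phi_defined_away_from_the_64_nodes :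
    ∃ P : MvPolynomial (Fin 6) ℂ, P ≠ 0 ∧
      ∀ t₁ t₂ s₁ s₂ r₁ r₂ : ℂ, eval ![t₁, t₂, s₁, s₂, r₁, r₂] P ≠ 0 →
        ∀ v : Fin 8 → ℂ, v ≠ 0 → (∀ i, eval v (qfam t₁ t₂ s₁ s₂ i) = 0) →
          (DefinedAt (qfam t₁ t₂ s₁ s₂) (f1 r₁ r₂) (f2 r₁ r₂) v ↔
            (Matrix.of fun (i : Fin 4) (j : Fin 8) =>
              eval v (pderiv j (qfam t₁ t₂ s₁ s₂ i))).rank = 4) := by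
  let Q : Fin 6 → Fin 6 → MvPolynomial (Fin 6) ℂ := fun i j => X i * X j * (X i ^ 4 - X j ^ 4)
  refine ⟨Q 0 1 * Q 2 3 * Q 4 5, ?_, ?_⟩
  · intro h
    have := congrArg (eval ![1, 2, 1, 2, 1, 2]) h
    simp [Q] at this
    norm_num at this
  intro t₁ t₂ s₁ s₂ r₁ r₂ hP v hv hX
  simp only [Q, map_mul, map_sub, map_pow, eval_X, Matrix.cons_val, mul_ne_zero_iff] at hP
  obtain ⟨⟨⟨⟨ht1, ht2⟩, ht⟩, ⟨hs1, hs2⟩, hs⟩, ⟨hr1, hr2⟩, hr⟩ := hP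
  obtain ⟨h1, h2, h3, h4⟩ := (vanish_iff _ _ _ _ _).mp hX
  have hA := plane_on_quadric ht1 ht2 h1 h2
  have hB := plane_on_quadric hs1 hs2 h3 h4
  have hM : (v 0 * v 1) ^ 2 - (v 2 * v 3) ^ 2 - (v 4 * v 5) ^ 2 + (v 6 * v 7) ^ 2 = 0 := by
    linear_combination (hA - hB) / 4
  rw [rank_four_iff]
  by_cases hne : v 0 * v 1 = 0 ∧ v 2 * v 3 = 0 ∧ v 4 * v 5 = 0 ∧ v 6 * v 7 = 0
  · obtain ⟨m1, m2, m3, m4⟩ := hne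
    refine iff_of_false ?_ ?_
    · rintro ⟨d, g₁, g₂, -, -, hg, hne⟩
      have one : (1 : ℂ) ^ 2 = 1 := by norm_num
      have neg : (-1 : ℂ) ^ 2 = 1 := by norm_num
      have R0 := node_relation hX m1 m2 m3 m4 hg one one one one
      have R1 := node_relation hX m1 m2 m3 m4 hg neg one one one
      have R2 := node_relation hX m1 m2 m3 m4 hg one neg one one
      have R3 := node_relation hX m1 m2 m3 m4 hg one one neg one
      have R4 := node_relation hX m1 m2 m3 m4 hg one one one neg
      have hAne : ¬ (v 0 ^ 2 + v 1 ^ 2 = 0 ∧ v 2 ^ 2 + v 3 ^ 2 = 0 ∧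
          v 4 ^ 2 + v 5 ^ 2 = 0 ∧ v 6 ^ 2 + v 7 ^ 2 = 0) := by
        rintro ⟨a1, a2, a3, a4⟩
        apply hv
        have aux : ∀ x y : ℂ, x ^ 2 + y ^ 2 = 0 → x * y = 0 → x = 0 ∧ y = 0 := by
          intro x y h h'
          rcases mul_eq_zero.mp h' with rfl | rfl <;> simpa using h
        obtain ⟨c0, c1⟩ := aux _ _ a1 m1
        obtain ⟨c2, c3⟩ := aux _ _ a2 m2
        obtain ⟨c4, c5⟩ := aux _ _ a3 m3
        obtain ⟨c6, c7⟩ := aux _ _ a4 m4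
        ext i
        fin_cases i <;> simpa
      have := key_columns (α := -eval v g₂) (β := eval v g₁) hr1 hr2 hr hA hAne
        (by linear_combination (R0 - R1) / 2) (by linear_combination (R0 - R2) / 2)
        (by linear_combination (R0 - R3) / 2) (by linear_combination (R0 - R4) / 2)
      rcases hne with h | h
      · exact h this.2
      · exact h (neg_eq_zero.mp this.1)
    · intro h
      obtain ⟨α, hα, hαJ⟩ := exists_left_kernel hv hX m1 m2 m3 m4
      exact hα (h α hαJ)
  · refine iff_of_true ?_ ?_
    · by_cases hf : v 0 * v 1 + v 4 * v 5 = 0 ∧ v 2 * v 3 + v 6 * v 7 = 0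
      · refine ⟨2, X 6 * X 7 - X 2 * X 3, X 4 * X 5 - X 0 * X 1,
          ((isHomogeneous_X _ _).mul (isHomogeneous_X _ _)).sub
            ((isHomogeneous_X _ _).mul (isHomogeneous_X _ _)),
          ((isHomogeneous_X _ _).mul (isHomogeneous_X _ _)).sub
            ((isHomogeneous_X _ _).mul (isHomogeneous_X _ _)), ?_, ?_⟩
        · intro w hw
          obtain ⟨k1, k2, k3, k4⟩ := (vanish_iff _ _ _ _ _).mp hw
          have kA := plane_on_quadric ht1 ht2 k1 k2
          have kB := plane_on_quadric hs1 hs2 k3 k4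
          simp [f1, f2]
          linear_combination r₁ * (kA - kB) / 4
        · by_contra! hcon
          apply hne
          simp at hcon
          obtain ⟨u1, u2⟩ := hf
          obtain ⟨u3, u4⟩ := hcon
          refine ⟨?_, ?_, ?_, ?_⟩
          · linear_combination (u1 - u4) / 2
          · linear_combination (u2 - u3) / 2
          · linear_combination (u1 + u4) / 2
          · linear_combination (u2 + u3) / 2
      · refine ⟨2, X 0 * X 1 + X 4 * X 5, X 2 * X 3 + X 6 * X 7,
          ((isHomogeneous_X _ _).mul (isHomogeneous_X _ _)).add
            ((isHomogeneous_X _ _).mul (isHomogeneous_X _ _)),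
          ((isHomogeneous_X _ _).mul (isHomogeneous_X _ _)).add
            ((isHomogeneous_X _ _).mul (isHomogeneous_X _ _)), ?_, ?_⟩
        · intro w hw
          obtain ⟨k1, k2, k3, k4⟩ := (vanish_iff _ _ _ _ _).mp hw
          have kA := plane_on_quadric ht1 ht2 k1 k2
          have kB := plane_on_quadric hs1 hs2 k3 k4
          simp [f1, f2]
          linear_combination -r₂ * (kA - kB) / 4
        · by_contra! hcon
          apply hf
          simpa using hcon
    · intro α hα
      obtain ⟨⟨a0, a1⟩, ⟨a2, a3⟩, ⟨a4, a5⟩, ⟨a6, a7⟩⟩ := (left_kernel_iff _ _ _ _ _ _).mp hα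
      have hT := key_columns (α := α 0) (β := α 1) ht1 ht2 ht hM hne
        (by linear_combination (v 1 * a0 + v 0 * a1) / 2)
        (by linear_combination (v 3 * a2 + v 2 * a3) / 2)
        (by linear_combination (v 5 * a4 + v 4 * a5) / 2)
        (by linear_combination (v 7 * a6 + v 6 * a7) / 2)
      have hS := key_columns (α := α 2) (β := α 3) hs1 hs2 hs hM hne
        (by linear_combination (v 1 * a0 - v 0 * a1) / 2)
        (by linear_combination (v 3 * a2 - v 2 * a3) / 2)
        (by linear_combination (v 5 * a4 - v 4 * a5) / 2)
        (by linear_combination (v 7 * a6 - v 6 * a7) / 2)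
      ext i
      fin_cases i
      · exact hT.1
      · exact hT.2
      · exact hS.1
      · exact hS.2
end
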